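/- arXiv:1807.03465 — 2 statements merged into one kernel-verified Lean document; each statement's English description precedes it below -/
import Mathlib

section
/- There is a universal constant C > 0 such that for every n ≥ 1 and every isotropic logconcave probability density p on ℝⁿ, the slicing constant satisfies L_p = p(0)^{1/n} ≤ C·σ(n), where σ(n) is the supremum of the thin-shell constant σ_q over all isotropic logconcave densities q on ℝⁿ. -/
open MeasureTheory Real Filter

noncomputable section

/-- A nonnegative function is logconcave if
`p (l • x + (1-l) • y) ≥ p x ^ l * p y ^ (1-l)` for all `x, y` and `l ∈ [0,1]`. -/
def IsLogConcave {n : ℕ} (p : EuclideanSpace ℝ (Fin n) → ℝ) : Prop :=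
  ∀ x y : EuclideanSpace ℝ (Fin n), ∀ l : ℝ, 0 ≤ l → l ≤ 1 →
    p x ^ l * p y ^ (1 - l) ≤ p (l • x + (1 - l) • y)

/-- `p` is a probability density on `ℝⁿ`. -/
def IsDensity {n : ℕ} (p : EuclideanSpace ℝ (Fin n) → ℝ) : Prop :=
  (∀ x, 0 ≤ p x) ∧ Integrable p ∧ (∫ x, p x) = 1

/-- `p` is isotropic: zero mean and identity covariance. -/
def IsIsotropic {n : ℕ} (p : EuclideanSpace ℝ (Fin n) → ℝ) : Prop :=
  (∫ x, p x • x) = 0 ∧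
  ∀ i j : Fin n, (∫ x, p x * (x i * x j)) = if i = j then 1 else 0

/-- The thin-shell constant of `p`: `σ_p = (Var_{x∼p} ‖x‖)^{1/2}`. -/
def thinShellConst {n : ℕ} (p : EuclideanSpace ℝ (Fin n) → ℝ) : ℝ :=
  Real.sqrt ((∫ x, p x * ‖x‖ ^ 2) - (∫ x, p x * ‖x‖) ^ 2)

/-- `σ(n)`: the supremum of the thin-shell constants of all isotropic logconcave
densities on `ℝⁿ`. -/
def sigmaSup (n : ℕ) : ℝ :=
  sSup {s : ℝ | ∃ q : EuclideanSpace ℝ (Fin n) → ℝ,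
    IsDensity q ∧ IsLogConcave q ∧ IsIsotropic q ∧ s = thinShellConst q}

section

open scoped ENNReal Pointwise Topology

theorem volume_add_volume_le_of_isCompact {K L C : Set ℝ} (hK : IsCompact K) (hL : IsCompact L)
    (hK' : K.Nonempty) (hL' : L.Nonempty) (h : ∀ x ∈ K, ∀ y ∈ L, x + y ∈ C) :
    volume K + volume L ≤ volume C := by
  obtain ⟨a, ha, hamax⟩ := hK.exists_isGreatest hK'
  obtain ⟨b, hb, hbmin⟩ := hL.exists_isLeast hL'
  set K' : Set ℝ := (fun x => x + (-b)) ⁻¹' K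
  set L' : Set ℝ := (fun x => -a + x) ⁻¹' L
  have hKv : volume K' = volume K := measure_preimage_add_right volume (-b) K
  have hLv : volume L' = volume L := measure_preimage_add volume (-a) L
  have hLm : MeasurableSet L' := (measurable_const_add (-a)) hL.isClosed.measurableSet
  have hint : volume (K' ∩ L') = 0 := by
    refine measure_mono_null (t := {a + b}) ?_ (measure_singleton _)
    rintro x ⟨hx, hx'⟩
    have h1 : x + -b ≤ a := hamax hx
    have h2 : b ≤ -a + x := hbmin hx'
    simp only [Set.mem_singleton_iff]
    linarith
  have hsub : K' ∪ L' ⊆ C := by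
    rintro x (hx | hx)
    · have := h _ hx b hb
      simpa using this
    · have := h a ha _ hx
      simpa using this
  calc volume K + volume L = volume K' + volume L' := by rw [hKv, hLv]
    _ = volume (K' ∪ L') := by rw [← measure_union_add_inter K' hLm, hint, add_zero]
    _ ≤ volume C := measure_mono hsub

/-- The one-dimensional Brunn–Minkowski inequality. -/
theorem volume_add_volume_le {A B C : Set ℝ} (hA : MeasurableSet A) (hB : MeasurableSet B)
    (hA' : A.Nonempty) (hB' : B.Nonempty) (h : ∀ x ∈ A, ∀ y ∈ B, x + y ∈ C) :
    volume A + volume B ≤ volume C := by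
  obtain ⟨a, ha⟩ := hA'
  obtain ⟨b, hb⟩ := hB'
  rcases eq_or_ne (volume A) 0 with hA0 | hA0
  · rw [hA0, zero_add, ← measure_preimage_add volume (-a) B]
    exact measure_mono fun x hx => by simpa using h a ha _ hx
  rcases eq_or_ne (volume B) 0 with hB0 | hB0
  · rw [hB0, add_zero, ← measure_preimage_add_right volume (-b) A]
    exact measure_mono fun x hx => by simpa using h _ hx b hb
  rw [hA.measure_eq_iSup_isCompact, hB.measure_eq_iSup_isCompact]
  simp only [iSup_and']
  refine ENNReal.biSup_add_biSup_le' ?_ ?_ ?_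
  · exact ⟨{a}, by simpa using ha, isCompact_singleton⟩
  · exact ⟨{b}, by simpa using hb, isCompact_singleton⟩
  · rintro K ⟨hKA, hK⟩ L ⟨hLB, hL⟩
    rcases K.eq_empty_or_nonempty with rfl | hKn
    · rw [measure_empty, zero_add, ← measure_preimage_add volume (-a) L]
      exact measure_mono fun x hx => by simpa using h a ha _ (hLB hx)
    rcases L.eq_empty_or_nonempty with rfl | hLn
    · rw [measure_empty, add_zero, ← measure_preimage_add_right volume (-b) K]
      exact measure_mono fun x hx => by simpa using h _ (hKA hx) b hb
    exact volume_add_volume_le_of_isCompact hK hL hKn hLn fun x hx y hy => h x (hKA hx) y (hLB hy)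

theorem lintegral_add_lintegral_le_of_mul_le_sq {f g h : ℝ → ℝ} (hf : Measurable f)
    (hg : Measurable g) (hh : Measurable h) (hf0 : 0 ≤ f) (hg0 : 0 ≤ g) (hh0 : 0 ≤ h)
    (hf1 : ∀ x, f x ≤ 1) (hg1 : ∀ x, g x ≤ 1) (hfs : ∀ t < 1, ∃ x, t < f x)
    (hgs : ∀ t < 1, ∃ x, t < g x) (hfg : ∀ x y, f x * g y ≤ h (x + y) ^ 2) :
    (∫⁻ x, ENNReal.ofReal (f x)) + ∫⁻ x, ENNReal.ofReal (g x) ≤ ∫⁻ x, ENNReal.ofReal (h x) := by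
  rw [lintegral_eq_lintegral_meas_lt _ (ae_of_all _ hf0) hf.aemeasurable,
    lintegral_eq_lintegral_meas_lt _ (ae_of_all _ hg0) hg.aemeasurable,
    lintegral_eq_lintegral_meas_lt _ (ae_of_all _ hh0) hh.aemeasurable,
    ← lintegral_add_left (f := fun t => volume {a | t < f a}) (Antitone.measurable
      fun s t hst => measure_mono fun x (hx : t < f x) => lt_of_le_of_lt hst hx)]
  refine setLIntegral_mono' measurableSet_Ioi fun t (ht : 0 < t) => ?_
  rcases le_or_gt 1 t with h1 | h1
  · have e1 : {a | t < f a} = ∅ := Set.eq_empty_of_forall_notMem fun x (hx : t < f x) => by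
      linarith [hf1 x]
    have e2 : {a | t < g a} = ∅ := Set.eq_empty_of_forall_notMem fun x (hx : t < g x) => by
      linarith [hg1 x]
    simp [e1, e2]
  · refine volume_add_volume_le (hf measurableSet_Ioi) (hg measurableSet_Ioi) (hfs t h1) (hgs t h1)
      fun x (hx : t < f x) y (hy : t < g y) => ?_
    refine lt_of_pow_lt_pow_left₀ 2 (hh0 _) (lt_of_lt_of_le ?_ (hfg x y))
    rw [sq]
    exact mul_lt_mul'' hx hy ht.le ht.le

theorem ENNReal.four_mul_mul_le_add_sq (a b : ℝ≥0∞) : 4 * a * b ≤ (a + b) ^ 2 := by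
  rcases eq_or_ne a ∞ with rfl | ha
  · simp
  rcases eq_or_ne b ∞ with rfl | hb
  · simp
  lift a to NNReal using ha
  lift b to NNReal using hb
  norm_cast
  rw [← NNReal.coe_le_coe]
  push_cast
  nlinarith [sq_nonneg ((a : ℝ) - b)]

theorem four_mul_lintegral_mul_lintegral_le_of_bounded {f g h : ℝ → ℝ≥0∞} (hf : Measurable f)
    (hg : Measurable g) (hh : Measurable h) {k : ℝ≥0∞} (hk : k ≠ ∞) (hfk : ∀ x, f x ≤ k)
    (hgk : ∀ x, g x ≤ k) (hfg : ∀ x y, f x * g y ≤ h (x + y) ^ 2) :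
    4 * (∫⁻ x, f x) * (∫⁻ x, g x) ≤ (∫⁻ x, h x) ^ 2 := by
  set F := ⨆ x, f x with hF
  set G := ⨆ x, g x with hG
  have hFt : F ≠ ∞ := ne_top_of_le_ne_top hk (iSup_le hfk)
  have hGt : G ≠ ∞ := ne_top_of_le_ne_top hk (iSup_le hgk)
  rcases eq_or_ne F 0 with hF0 | hF0
  · have : ∀ x, f x = 0 := ENNReal.iSup_eq_zero.1 hF0
    simp [this]
  rcases eq_or_ne G 0 with hG0 | hG0
  · have : ∀ x, g x = 0 := ENNReal.iSup_eq_zero.1 hG0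
    simp [this]
  set c := (F * G) ^ (1 / 2 : ℝ) with hc
  have hc2 : c ^ 2 = F * G := by
    rw [hc, ← ENNReal.rpow_natCast, ← ENNReal.rpow_mul]; norm_num
  have hFG : F * G ≠ ∞ := ENNReal.mul_ne_top hFt hGt
  have hct : c ≠ ∞ := fun hcc => by rw [hcc] at hc2; exact hFG (by rw [← hc2]; simp)
  have hc0 : c ≠ 0 := fun hcc => by
    rw [hcc] at hc2; exact mul_ne_zero hF0 hG0 (by rw [← hc2]; simp)
  have hf1 : ∀ x, f x / F ≤ 1 := fun x => ENNReal.div_le_of_le_mul (by simpa using le_iSup f x)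
  have hg1 : ∀ x, g x / G ≤ 1 := fun x => ENNReal.div_le_of_le_mul (by simpa using le_iSup g x)
  have hft : ∀ x, f x / F ≠ ∞ := fun x => ne_top_of_le_ne_top ENNReal.one_ne_top (hf1 x)
  have hgt : ∀ x, g x / G ≠ ∞ := fun x => ne_top_of_le_ne_top ENNReal.one_ne_top (hg1 x)
  have hht : ∀ x, min (h x / c) 1 ≠ ∞ := fun x =>
    ne_top_of_le_ne_top ENNReal.one_ne_top (min_le_right _ _)
  have hsup : ∀ (u : ℝ → ℝ≥0∞) (U : ℝ≥0∞), U = ⨆ x, u x → U ≠ ∞ → U ≠ 0 →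
      (∀ x, u x / U ≠ ∞) → ∀ t < 1, ∃ x, t < (u x / U).toReal := by
    intro u U hU hUt hU0 hut t ht
    rcases lt_or_ge t 0 with h0 | h0
    · exact ⟨0, lt_of_lt_of_le h0 ENNReal.toReal_nonneg⟩
    have : ENNReal.ofReal t * U < ⨆ x, u x := by
      rw [← hU]
      calc ENNReal.ofReal t * U < 1 * U :=
            ENNReal.mul_lt_mul_left hU0 hUt (by simpa using ht)
        _ = U := one_mul U
    obtain ⟨x, hx⟩ := lt_iSup_iff.1 this
    refine ⟨x, (ENNReal.ofReal_lt_iff_lt_toReal h0 (hut x)).1 ?_⟩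
    exact (ENNReal.lt_div_iff_mul_lt (Or.inl hU0) (Or.inl hUt)).2 hx
  have key := lintegral_add_lintegral_le_of_mul_le_sq
    (f := fun x => (f x / F).toReal) (g := fun x => (g x / G).toReal)
    (h := fun x => (min (h x / c) 1).toReal) (by fun_prop) (by fun_prop) (by fun_prop)
    (fun x => ENNReal.toReal_nonneg) (fun x => ENNReal.toReal_nonneg)
    (fun x => ENNReal.toReal_nonneg)
    (fun x => by simpa using ENNReal.toReal_mono ENNReal.one_ne_top (hf1 x))
    (fun x => by simpa using ENNReal.toReal_mono ENNReal.one_ne_top (hg1 x))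
    (hsup f F hF hFt hF0 hft) (hsup g G hG hGt hG0 hgt) (fun x y => by
      rw [← ENNReal.toReal_mul, ← ENNReal.toReal_pow]
      refine ENNReal.toReal_mono (ENNReal.pow_ne_top (hht _)) ?_
      rcases min_cases (h (x + y) / c) 1 with ⟨e, -⟩ | ⟨e, -⟩
      · rw [e, ENNReal.div_eq_inv_mul, ENNReal.div_eq_inv_mul, ENNReal.div_eq_inv_mul, mul_pow,
          ← ENNReal.inv_pow, hc2, ENNReal.mul_inv (Or.inl hF0) (Or.inl hFt)]
        calc F⁻¹ * f x * (G⁻¹ * g y) = F⁻¹ * G⁻¹ * (f x * g y) := by ring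
          _ ≤ F⁻¹ * G⁻¹ * h (x + y) ^ 2 := by gcongr; exact hfg x y
      · rw [e]; simpa using mul_le_mul' (hf1 x) (hg1 y))
  simp only [ENNReal.ofReal_toReal (hft _), ENNReal.ofReal_toReal (hgt _),
    ENNReal.ofReal_toReal (hht _)] at key
  have e1 : ∫⁻ x, f x = F * ∫⁻ x, f x / F := by
    rw [← lintegral_const_mul _ (by fun_prop)]
    simp only [ENNReal.mul_div_cancel hF0 hFt]
  have e2 : ∫⁻ x, g x = G * ∫⁻ x, g x / G := by
    rw [← lintegral_const_mul _ (by fun_prop)]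
    simp only [ENNReal.mul_div_cancel hG0 hGt]
  have e3 : c * ∫⁻ x, min (h x / c) 1 ≤ ∫⁻ x, h x := by
    rw [← lintegral_const_mul _ (by fun_prop)]
    refine lintegral_mono fun x => ?_
    calc c * min (h x / c) 1 ≤ c * (h x / c) := by gcongr; exact min_le_left _ _
      _ = h x := ENNReal.mul_div_cancel hc0 hct
  rw [e1, e2]
  calc 4 * (F * ∫⁻ x, f x / F) * (G * ∫⁻ x, g x / G)
      = F * G * (4 * (∫⁻ x, f x / F) * ∫⁻ x, g x / G) := by ring
    _ ≤ F * G * ((∫⁻ x, f x / F) + ∫⁻ x, g x / G) ^ 2 := by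
        gcongr; exact ENNReal.four_mul_mul_le_add_sq _ _
    _ ≤ F * G * (∫⁻ x, min (h x / c) 1) ^ 2 := by gcongr
    _ = (c * ∫⁻ x, min (h x / c) 1) ^ 2 := by rw [mul_pow, hc2]
    _ ≤ (∫⁻ x, h x) ^ 2 := by gcongr

/-- The midpoint Prékopa–Leindler property of a measure, with constant `c`
(which is `2 ^ (2 * n)` for Lebesgue measure on an `n`-dimensional space). -/
def HasPrekopaLeindler {E : Type*} [Add E] [MeasurableSpace E] (μ : Measure E) (c : ℝ≥0∞) : Prop :=
  ∀ f g h : E → ℝ≥0∞, Measurable f → Measurable g → Measurable h →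
    (∀ x y, f x * g y ≤ h (x + y) ^ 2) →
      c * (∫⁻ x, f x ∂μ) * (∫⁻ x, g x ∂μ) ≤ (∫⁻ x, h x ∂μ) ^ 2

theorem iSup_lintegral_min_natCast {α : Type*} [MeasurableSpace α] (μ : Measure α) {f : α → ℝ≥0∞}
    (hf : Measurable f) : ⨆ k : ℕ, ∫⁻ x, min (f x) k ∂μ = ∫⁻ x, f x ∂μ := by
  rw [← lintegral_iSup (f := fun (k : ℕ) x => min (f x) k) (fun k => by fun_prop)
    (fun i j hij x => min_le_min le_rfl (by exact_mod_cast hij))]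
  refine lintegral_congr fun x => ?_
  rw [← inf_iSup_eq, ENNReal.iSup_natCast]
  simp

theorem hasPrekopaLeindler_real : HasPrekopaLeindler (volume : Measure ℝ) 4 := by
  intro f g h hf hg hh hfg
  rw [← iSup_lintegral_min_natCast volume hf, ← iSup_lintegral_min_natCast volume hg,
    ENNReal.mul_iSup]
  refine iSup_le fun j => ?_
  rw [ENNReal.mul_iSup, ENNReal.iSup_mul]
  refine iSup_le fun i => ?_
  refine four_mul_lintegral_mul_lintegral_le_of_bounded (by fun_prop) (by fun_prop) hh
    (k := max i j) (by simp) (fun x => (min_le_right _ _).trans (le_max_left _ _))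
    (fun x => (min_le_right _ _).trans (le_max_right _ _)) fun x y => ?_
  exact (mul_le_mul' (min_le_left _ _) (min_le_left _ _)).trans (hfg x y)

theorem HasPrekopaLeindler.prod {E F : Type*} [Add E] [Add F] [MeasurableSpace E]
    [MeasurableSpace F] {μ : Measure E} {ν : Measure F} [SFinite μ] [SFinite ν] {c d : ℝ≥0∞}
    (hμ : HasPrekopaLeindler μ c) (hν : HasPrekopaLeindler ν d) :
    HasPrekopaLeindler (μ.prod ν) (c * d) := by
  intro f g h hf hg hh hfg
  rw [lintegral_prod _ hf.aemeasurable, lintegral_prod _ hg.aemeasurable,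
    lintegral_prod _ hh.aemeasurable]
  have := hμ (fun x => d * ∫⁻ y, f (x, y) ∂ν) (fun x => ∫⁻ y, g (x, y) ∂ν)
    (fun x => ∫⁻ y, h (x, y) ∂ν) (hf.lintegral_prod_right'.const_mul _)
    hg.lintegral_prod_right' hh.lintegral_prod_right' fun x x' =>
      hν (fun y => f (x, y)) (fun y => g (x', y)) (fun y => h (x + x', y)) (by fun_prop)
        (by fun_prop) (by fun_prop) fun y y' => hfg (x, y) (x', y')
  rwa [lintegral_const_mul _ hf.lintegral_prod_right', ← mul_assoc] at this

theorem HasPrekopaLeindler.of_measurePreserving {E F : Type*} [Add E] [Add F] [MeasurableSpace E]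
    [MeasurableSpace F] {μ : Measure E} {ν : Measure F} {c : ℝ≥0∞} (hμ : HasPrekopaLeindler μ c)
    (e : E → F) (he : MeasurePreserving e μ ν) (hadd : ∀ x y, e (x + y) = e x + e y) :
    HasPrekopaLeindler ν c := by
  intro f g h hf hg hh hfg
  rw [← he.lintegral_comp hf, ← he.lintegral_comp hg, ← he.lintegral_comp hh]
  exact hμ _ _ _ (hf.comp he.measurable) (hg.comp he.measurable) (hh.comp he.measurable)
    fun x y => by rw [hadd]; exact hfg _ _

theorem hasPrekopaLeindler_pi (n : ℕ) :
    HasPrekopaLeindler (volume : Measure (Fin n → ℝ)) (4 ^ n) := by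
  induction n with
  | zero =>
    intro f g h hf hg hh hfg
    have : (volume : Measure (Fin 0 → ℝ)) = Measure.dirac 0 := by
      exact Measure.volume_pi_eq_dirac 0
    simp only [this, lintegral_dirac, pow_zero, one_mul]
    simpa using hfg 0 0
  | succ n ih =>
    rw [pow_succ']
    refine (hasPrekopaLeindler_real.prod ih).of_measurePreserving
      (MeasurableEquiv.piFinSuccAbove (fun _ : Fin (n + 1) => ℝ) 0).symm
      (volume_preserving_piFinSuccAbove (fun _ : Fin (n + 1) => ℝ) 0).symm fun x y => ?_
    ext i
    refine Fin.cases ?_ (fun j => ?_) i <;> simp [MeasurableEquiv.piFinSuccAbove]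

/-- The midpoint Prékopa–Leindler inequality on Euclidean space. -/
theorem hasPrekopaLeindler_euclideanSpace (n : ℕ) :
    HasPrekopaLeindler (volume : Measure (EuclideanSpace ℝ (Fin n))) (4 ^ n) :=
  (hasPrekopaLeindler_pi n).of_measurePreserving _
    (PiLp.volume_preserving_toLp (Fin n)) fun _ _ => rfl

variable {n : ℕ}

/-- The measure with density `q` with respect to Lebesgue measure. -/
def densityMeasure (q : EuclideanSpace ℝ (Fin n) → ℝ) : Measure (EuclideanSpace ℝ (Fin n)) :=
  volume.withDensity fun x => ENNReal.ofReal (q x)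

theorem lintegral_densityMeasure {q : EuclideanSpace ℝ (Fin n) → ℝ} (hq : Measurable q)
    {g : EuclideanSpace ℝ (Fin n) → ℝ≥0∞} (hg : Measurable g) :
    ∫⁻ x, g x ∂densityMeasure q = ∫⁻ x, ENNReal.ofReal (q x) * g x := by
  rw [densityMeasure, lintegral_withDensity_eq_lintegral_mul _ (by fun_prop) hg]
  rfl

theorem integral_densityMeasure {F : Type*} [NormedAddCommGroup F] [NormedSpace ℝ F]
    {q : EuclideanSpace ℝ (Fin n) → ℝ} (hq : Measurable q) (hq0 : ∀ x, 0 ≤ q x)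
    (g : EuclideanSpace ℝ (Fin n) → F) :
    ∫ x, g x ∂densityMeasure q = ∫ x, q x • g x := by
  rw [densityMeasure, integral_withDensity_eq_integral_toReal_smul (by fun_prop)
    (ae_of_all _ fun _ => ENNReal.ofReal_lt_top)]
  simp only [ENNReal.toReal_ofReal (hq0 _)]

theorem integrable_densityMeasure_iff {F : Type*} [NormedAddCommGroup F] [NormedSpace ℝ F]
    {q : EuclideanSpace ℝ (Fin n) → ℝ} (hq : Measurable q) (hq0 : ∀ x, 0 ≤ q x)
    {g : EuclideanSpace ℝ (Fin n) → F} :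
    Integrable g (densityMeasure q) ↔ Integrable fun x => q x • g x := by
  rw [densityMeasure, integrable_withDensity_iff_integrable_smul' (by fun_prop)
    (ae_of_all _ fun _ => ENNReal.ofReal_lt_top)]
  simp only [ENNReal.toReal_ofReal (hq0 _)]

theorem IsDensity.isProbabilityMeasure {q : EuclideanSpace ℝ (Fin n) → ℝ} (hq : IsDensity q) :
    IsProbabilityMeasure (densityMeasure q) := by
  refine ⟨?_⟩
  rw [densityMeasure, withDensity_apply _ MeasurableSet.univ, Measure.restrict_univ,
    ← ofReal_integral_eq_lintegral_ofReal hq.2.1 (ae_of_all _ hq.1), hq.2.2, ENNReal.ofReal_one]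

theorem lintegral_comp_half_smul {f : EuclideanSpace ℝ (Fin n) → ℝ≥0∞} (hf : Measurable f) :
    ∫⁻ x, f ((1 / 2 : ℝ) • x) = 2 ^ n * ∫⁻ x, f x := by
  rw [← lintegral_map hf (measurable_const_smul (1 / 2 : ℝ)),
    Measure.map_addHaar_smul volume (by norm_num : (1 / 2 : ℝ) ≠ 0), lintegral_smul_measure]
  congr 1
  rw [finrank_euclideanSpace_fin, abs_of_nonneg (by positivity), ← inv_pow]
  norm_num [ENNReal.ofReal_pow]

theorem IsLogConcave.mul_le_sq {q : EuclideanSpace ℝ (Fin n) → ℝ} (hq0 : ∀ x, 0 ≤ q x)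
    (hq : IsLogConcave q) (x y : EuclideanSpace ℝ (Fin n)) :
    q x * q y ≤ q ((1 / 2 : ℝ) • (x + y)) ^ 2 := by
  have h := hq x y (1 / 2) (by norm_num) (by norm_num)
  rw [show (1 - 1 / 2 : ℝ) = 1 / 2 by norm_num, ← smul_add, ← Real.sqrt_eq_rpow,
    ← Real.sqrt_eq_rpow, ← Real.sqrt_mul (hq0 x)] at h
  rw [← Real.sq_sqrt (mul_nonneg (hq0 x) (hq0 y))]
  gcongr

/-- Borell's lemma for balls. -/
theorem IsLogConcave.measure_mul_measure_le {q : EuclideanSpace ℝ (Fin n) → ℝ}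
    (hq : Measurable q) (hq0 : ∀ x, 0 ≤ q x) (hlc : IsLogConcave q) (r : ℝ) :
    densityMeasure q {x | 3 * r ≤ ‖x‖} * densityMeasure q {x | ‖x‖ < r} ≤
      densityMeasure q {x | r ≤ ‖x‖} ^ 2 := by
  have hA : MeasurableSet {x : EuclideanSpace ℝ (Fin n) | 3 * r ≤ ‖x‖} :=
    measurableSet_le measurable_const measurable_norm
  have hB : MeasurableSet {x : EuclideanSpace ℝ (Fin n) | ‖x‖ < r} :=
    measurableSet_lt measurable_norm measurable_const
  have hC : MeasurableSet {x : EuclideanSpace ℝ (Fin n) | r ≤ ‖x‖} :=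
    measurableSet_le measurable_const measurable_norm
  have hqm : Measurable fun x => ENNReal.ofReal (q x) := by fun_prop
  have key := hasPrekopaLeindler_euclideanSpace n _ _ _ (hqm.indicator hA) (hqm.indicator hB)
    ((hqm.indicator hC).comp (measurable_const_smul (1 / 2 : ℝ))) (fun x y => by
      by_cases hx : x ∈ {x : EuclideanSpace ℝ (Fin n) | 3 * r ≤ ‖x‖}
      · by_cases hy : y ∈ {x : EuclideanSpace ℝ (Fin n) | ‖x‖ < r}
        · have hxy : (1 / 2 : ℝ) • (x + y) ∈ {x : EuclideanSpace ℝ (Fin n) | r ≤ ‖x‖} := by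
            simp only [Set.mem_ofPred_eq] at hx hy ⊢
            rw [norm_smul, Real.norm_of_nonneg (by norm_num)]
            have : ‖x‖ ≤ ‖x + y‖ + ‖y‖ := by simpa using norm_sub_le (x + y) y
            linarith
          simp only [Function.comp, Set.indicator_of_mem hx, Set.indicator_of_mem hy,
            Set.indicator_of_mem hxy]
          rw [← ENNReal.ofReal_mul (hq0 x), ← ENNReal.ofReal_pow (hq0 _)]
          exact ENNReal.ofReal_le_ofReal (hlc.mul_le_sq hq0 x y)
        · simp [Set.indicator_of_notMem hy]
      · simp [Set.indicator_of_notMem hx])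
  simp only [Function.comp] at key
  rw [lintegral_comp_half_smul (hqm.indicator hC), lintegral_indicator hA, lintegral_indicator hB,
    lintegral_indicator hC, mul_pow, ← pow_mul, mul_comm n 2, pow_mul, mul_assoc] at key
  norm_num at key
  rw [densityMeasure, withDensity_apply _ hA, withDensity_apply _ hB, withDensity_apply _ hC]
  exact (ENNReal.mul_le_mul_iff_right (by positivity) (ENNReal.pow_ne_top (by norm_num))).1 key

theorem IsIsotropic.integrable_mul_self {q : EuclideanSpace ℝ (Fin n) → ℝ} (hi : IsIsotropic q)
    (i : Fin n) : Integrable fun x => q x * (x i * x i) := by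
  by_contra h
  have := hi.2 i i
  rw [integral_undef h] at this
  simp at this

theorem mul_norm_sq_eq_sum (q : EuclideanSpace ℝ (Fin n) → ℝ) (x : EuclideanSpace ℝ (Fin n)) :
    q x * ‖x‖ ^ 2 = ∑ i, q x * (x i * x i) := by
  rw [EuclideanSpace.norm_sq_eq, Finset.mul_sum]
  simp [sq]

theorem IsIsotropic.integrable_mul_norm_sq {q : EuclideanSpace ℝ (Fin n) → ℝ}
    (hi : IsIsotropic q) : Integrable fun x => q x * ‖x‖ ^ 2 := by
  simp only [mul_norm_sq_eq_sum]
  exact integrable_finsetSum Finset.univ fun i _ => hi.integrable_mul_self i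

theorem IsIsotropic.integral_mul_norm_sq {q : EuclideanSpace ℝ (Fin n) → ℝ}
    (hi : IsIsotropic q) : ∫ x, q x * ‖x‖ ^ 2 = n := by
  simp only [mul_norm_sq_eq_sum]
  rw [integral_finsetSum _ fun i _ => hi.integrable_mul_self i]
  simp [hi.2]

theorem integrable_mul_norm_of_integrable_mul_norm_sq {q : EuclideanSpace ℝ (Fin n) → ℝ}
    (hq0 : ∀ x, 0 ≤ q x) (hq : Integrable q) (hqm : Measurable q)
    (h2 : Integrable fun x => q x * ‖x‖ ^ 2) : Integrable fun x => q x * ‖x‖ := by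
  refine (hq.add h2).mono' (by fun_prop) (ae_of_all _ fun x => ?_)
  rw [norm_mul, Real.norm_of_nonneg (hq0 x), Pi.add_apply, norm_norm]
  nlinarith [hq0 x, sq_nonneg (‖x‖ - 1), norm_nonneg x, mul_nonneg (hq0 x) (sq_nonneg (‖x‖ - 1)),
    mul_nonneg (hq0 x) (norm_nonneg x)]

theorem tail_recursion_bound {e : ℕ → ℝ} (he0 : ∀ k, 0 ≤ e k) (h0 : e 0 ≤ 1 / 4)
    (h : ∀ k, e k ≤ 1 / 4 → e (k + 1) * (3 / 4) ≤ e k ^ 2) (k : ℕ) :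
    e k * 3 ^ 2 ^ k ≤ 3 * e 0 ∧ e k ≤ 1 / 4 := by
  induction k with
  | zero => exact ⟨by simp [mul_comm], h0⟩
  | succ k ih =>
    obtain ⟨h1, h2⟩ := ih
    have h3 := h k h2
    refine ⟨?_, by nlinarith [he0 k]⟩
    have h4 : (e k * 3 ^ 2 ^ k) ^ 2 ≤ (3 * e 0) ^ 2 :=
      pow_le_pow_left₀ (mul_nonneg (he0 k) (by positivity)) h1 2
    have h5 : e (k + 1) * (3 / 4) * (3 ^ 2 ^ k) ^ 2 ≤ e k ^ 2 * (3 ^ 2 ^ k) ^ 2 := by gcongr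
    rw [pow_succ 2 k, pow_mul]
    nlinarith [he0 0]

theorem pow_mul_le_of_mul_pow_two_pow_le {e c : ℝ} {k : ℕ} (he : e * 3 ^ 2 ^ k ≤ c) (he0 : 0 ≤ e) :
    81 ^ (k + 1) * e ≤ 3 ^ 17 * c * (1 / 9) ^ k := by
  have hk : 6 * k ≤ 2 ^ k + 13 := by
    clear he
    induction k with
    | zero => norm_num
    | succ k ih =>
      rcases lt_or_ge k 3 with hk | hk
      · interval_cases k <;> norm_num
      · have : 2 ^ 3 ≤ 2 ^ k := Nat.pow_le_pow_right (by norm_num) hk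
        rw [pow_succ]; omega
  have h1 : (3 : ℝ) ^ (6 * k) ≤ 3 ^ (2 ^ k + 13) := pow_le_pow_right₀ (by norm_num) hk
  rw [pow_add] at h1
  have h9 : (9 : ℝ) ^ k = 3 ^ (2 * k) := by rw [pow_mul]; norm_num
  have h81 : (81 : ℝ) ^ (k + 1) = 3 ^ (4 * k) * 81 := by
    rw [pow_succ, show (81 : ℝ) = 3 ^ 4 by norm_num, ← pow_mul]
  rw [one_div, inv_pow, ← div_eq_mul_inv, le_div_iff₀ (by positivity), h9, h81]
  have h6 : (3 : ℝ) ^ (6 * k) = 3 ^ (4 * k) * 3 ^ (2 * k) := by rw [← pow_add]; ring_nf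
  calc 3 ^ (4 * k) * 81 * e * 3 ^ (2 * k) = 81 * e * 3 ^ (6 * k) := by rw [h6]; ring
    _ ≤ 81 * e * (3 ^ 2 ^ k * 3 ^ 13) := by gcongr
    _ = 3 ^ 17 * (e * 3 ^ 2 ^ k) := by ring
    _ ≤ 3 ^ 17 * c := by gcongr

/-- The constant in the comparison of `E (‖x‖² - n)²` with `n σ_q²`. -/
def momentConst : ℝ := 108 * 3 ^ 17 + 18

theorem momentConst_pos : 0 < momentConst := by unfold momentConst; positivity

section ThinShell

variable {q : EuclideanSpace ℝ (Fin n) → ℝ}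

theorem IsIsotropic.integrable_mul_norm (hq : IsDensity q) (hqm : Measurable q)
    (hi : IsIsotropic q) : Integrable fun x => q x * ‖x‖ :=
  integrable_mul_norm_of_integrable_mul_norm_sq hq.1 hq.2.1 hqm (hi.integrable_mul_norm_sq)

theorem IsIsotropic.integral_mul_norm_sub_sq (hq : IsDensity q) (hqm : Measurable q)
    (hi : IsIsotropic q) (c : ℝ) : Integrable (fun x => q x * (‖x‖ - c) ^ 2) ∧
      ∫ x, q x * (‖x‖ - c) ^ 2 = n - 2 * c * (∫ x, q x * ‖x‖) + c ^ 2 := by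
  have e : ∀ x, q x * (‖x‖ - c) ^ 2 = q x * ‖x‖ ^ 2 - 2 * c * (q x * ‖x‖) + c ^ 2 * q x :=
    fun x => by ring
  have i2 := hi.integrable_mul_norm_sq
  have i1 := (hi.integrable_mul_norm hq hqm).const_mul (2 * c)
  have i0 := hq.2.1.const_mul (c ^ 2)
  have i3 : Integrable fun x => q x * ‖x‖ ^ 2 - 2 * c * (q x * ‖x‖) := i2.sub i1
  simp only [e]
  refine ⟨i3.add i0, ?_⟩
  rw [integral_add i3 i0, integral_sub i2 i1, hi.integral_mul_norm_sq,
    integral_const_mul, integral_const_mul, hq.2.2, mul_one]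

theorem IsIsotropic.thinShellConst_sq (hq : IsDensity q) (hqm : Measurable q)
    (hi : IsIsotropic q) : thinShellConst q ^ 2 = n - (∫ x, q x * ‖x‖) ^ 2 := by
  rw [thinShellConst, hi.integral_mul_norm_sq, Real.sq_sqrt]
  have h := (hi.integral_mul_norm_sub_sq hq hqm (∫ x, q x * ‖x‖)).2
  have : 0 ≤ ∫ x, q x * (‖x‖ - ∫ x, q x * ‖x‖) ^ 2 :=
    integral_nonneg fun x => mul_nonneg (hq.1 x) (sq_nonneg _)
  nlinarith

theorem IsIsotropic.integral_mul_norm_sub_sqrt_sq_le (hq : IsDensity q) (hqm : Measurable q)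
    (hi : IsIsotropic q) :
    ∫ x, q x * (‖x‖ - √n) ^ 2 ≤ 2 * thinShellConst q ^ 2 := by
  have hT := hi.thinShellConst_sq hq hqm
  have hm0 : 0 ≤ ∫ x, q x * ‖x‖ :=
    integral_nonneg fun x => mul_nonneg (hq.1 x) (norm_nonneg _)
  have hm : (∫ x, q x * ‖x‖) ≤ √n := Real.le_sqrt_of_sq_le (by nlinarith [sq_nonneg (thinShellConst q)])
  rw [(hi.integral_mul_norm_sub_sq hq hqm _).2, hT, Real.sq_sqrt (Nat.cast_nonneg n)]
  nlinarith

theorem lintegral_densityMeasure_ofReal (hq : IsDensity q) (hqm : Measurable q)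
    {g : EuclideanSpace ℝ (Fin n) → ℝ} (hg : Measurable g) (hg0 : ∀ x, 0 ≤ g x)
    (hi : Integrable fun x => q x * g x) :
    ∫⁻ x, ENNReal.ofReal (g x) ∂densityMeasure q = ENNReal.ofReal (∫ x, q x * g x) := by
  rw [lintegral_densityMeasure hqm (by fun_prop), ofReal_integral_eq_lintegral_ofReal hi
    (ae_of_all _ fun x => mul_nonneg (hq.1 x) (hg0 x))]
  simp only [ENNReal.ofReal_mul (hq.1 _)]

theorem IsLogConcave.tail_step (hq : IsDensity q) (hqm : Measurable q) (hlc : IsLogConcave q)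
    (r : ℝ) (h : (densityMeasure q).real {x | r ≤ ‖x‖} ≤ 1 / 4) :
    (densityMeasure q).real {x | 3 * r ≤ ‖x‖} * (3 / 4) ≤
      (densityMeasure q).real {x | r ≤ ‖x‖} ^ 2 := by
  have := hq.isProbabilityMeasure
  have hB : MeasurableSet {x : EuclideanSpace ℝ (Fin n) | r ≤ ‖x‖} :=
    measurableSet_le measurable_const measurable_norm
  have hc : (densityMeasure q).real {x | ‖x‖ < r} = 1 - (densityMeasure q).real {x | r ≤ ‖x‖} := by
    rw [← probReal_compl_eq_one_sub hB]
    congr 1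
    ext x
    simp
  have key := hlc.measure_mul_measure_le hqm hq.1 r
  have key' := ENNReal.toReal_mono (by finiteness) key
  rw [ENNReal.toReal_mul, ENNReal.toReal_pow] at key'
  change (densityMeasure q).real _ * (densityMeasure q).real _ ≤ (densityMeasure q).real _ ^ 2 at key'
  rw [hc] at key'
  refine le_trans ?_ key'
  gcongr
  linarith

theorem indicator_norm_pow_four_le {r : ℝ} (hr : 0 < r) (x : EuclideanSpace ℝ (Fin n)) :
    {x : EuclideanSpace ℝ (Fin n) | r ≤ ‖x‖}.indicator (fun x => ENNReal.ofReal (‖x‖ ^ 4)) x ≤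
      ∑' k : ℕ, {x : EuclideanSpace ℝ (Fin n) | 3 ^ k * r ≤ ‖x‖}.indicator
        (fun _ => ENNReal.ofReal (r ^ 4 * 81 ^ (k + 1))) x := by
  by_cases hx : r ≤ ‖x‖
  · obtain ⟨k, hk1, hk2⟩ := exists_nat_pow_near ((one_le_div hr).2 hx) (by norm_num : (1 : ℝ) < 3)
    rw [le_div_iff₀ hr] at hk1
    rw [div_lt_iff₀ hr] at hk2
    refine le_trans ?_ (ENNReal.le_tsum k)
    rw [Set.indicator_of_mem (by exact hx), Set.indicator_of_mem (by exact hk1)]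
    refine ENNReal.ofReal_le_ofReal ?_
    calc ‖x‖ ^ 4 ≤ (3 ^ (k + 1) * r) ^ 4 := by gcongr
      _ = r ^ 4 * 81 ^ (k + 1) := by
        rw [mul_pow, ← pow_mul, mul_comm (k + 1), pow_mul]; norm_num; ring
  · rw [Set.indicator_of_notMem (by exact hx)]
    exact zero_le

theorem IsLogConcave.lintegral_tail_norm_pow_four_le (hq : IsDensity q) (hqm : Measurable q)
    (hlc : IsLogConcave q) {r : ℝ} (hr : 0 < r)
    (h : (densityMeasure q).real {x | r ≤ ‖x‖} ≤ 1 / 4) :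
    ∫⁻ x, {x : EuclideanSpace ℝ (Fin n) | r ≤ ‖x‖}.indicator
        (fun x => ENNReal.ofReal (‖x‖ ^ 4)) x ∂densityMeasure q ≤
      ENNReal.ofReal (r ^ 4 * (3 ^ 17 * (3 * (densityMeasure q).real {x | r ≤ ‖x‖}) * (9 / 8))) := by
  have := hq.isProbabilityMeasure
  have hM : ∀ s : ℝ, MeasurableSet {x : EuclideanSpace ℝ (Fin n) | s ≤ ‖x‖} := fun s =>
    measurableSet_le measurable_const measurable_norm
  set e : ℕ → ℝ := fun k => (densityMeasure q).real {x | 3 ^ k * r ≤ ‖x‖} with he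
  have e0 : e 0 = (densityMeasure q).real {x | r ≤ ‖x‖} := by simp [he]
  rw [← e0] at h ⊢
  have hrec := tail_recursion_bound (e := e) (fun k => measureReal_nonneg) h (fun k hk => by
    have := hlc.tail_step hq hqm _ hk
    simpa only [he, pow_succ', mul_assoc] using this)
  calc _ ≤ ∫⁻ x, ∑' k : ℕ, {x : EuclideanSpace ℝ (Fin n) | 3 ^ k * r ≤ ‖x‖}.indicator
        (fun _ => ENNReal.ofReal (r ^ 4 * 81 ^ (k + 1))) x ∂densityMeasure q :=
        lintegral_mono (indicator_norm_pow_four_le hr)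
    _ = ∑' k : ℕ, ENNReal.ofReal (r ^ 4 * (81 ^ (k + 1) * e k)) := by
        rw [lintegral_tsum fun k => (measurable_const.indicator (hM _)).aemeasurable]
        refine tsum_congr fun k => ?_
        rw [lintegral_indicator_const (hM _), ← mul_assoc,
          ENNReal.ofReal_mul (p := r ^ 4 * 81 ^ (k + 1)) (by positivity), ofReal_measureReal]
    _ ≤ ∑' k : ℕ, ENNReal.ofReal (r ^ 4 * (3 ^ 17 * (3 * e 0) * (1 / 9) ^ k)) := by
        refine ENNReal.tsum_le_tsum fun k => ENNReal.ofReal_le_ofReal ?_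
        have := pow_mul_le_of_mul_pow_two_pow_le (hrec k).1 measureReal_nonneg
        gcongr
    _ = _ := by
        have hs : Summable fun k : ℕ => ((1 : ℝ) / 9) ^ k :=
          summable_geometric_of_lt_one (by norm_num) (by norm_num)
        have he0 : 0 ≤ e 0 := measureReal_nonneg
        rw [← ENNReal.ofReal_tsum_of_nonneg (fun k => by positivity)
          ((hs.mul_left _).mul_left _), tsum_mul_left, tsum_mul_left,
          tsum_geometric_of_lt_one (by norm_num) (by norm_num)]
        norm_num

/-- The fourth-moment form of the thin-shell estimate. -/
theorem IsIsotropic.lintegral_norm_sq_sub_sq_le (hn : 1 ≤ n) (hq : IsDensity q)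
    (hqm : Measurable q) (hlc : IsLogConcave q) (hi : IsIsotropic q) :
    ∫⁻ x, ENNReal.ofReal ((‖x‖ ^ 2 - n) ^ 2) ∂densityMeasure q ≤
      ENNReal.ofReal (momentConst * n * thinShellConst q ^ 2) := by
  have := hq.isProbabilityMeasure
  have hn' : (0 : ℝ) < n := by exact_mod_cast hn
  have hs : 0 < √(n : ℝ) := Real.sqrt_pos.2 hn'
  have hss : √(n : ℝ) ^ 2 = n := Real.sq_sqrt hn'.le
  have hM : MeasurableSet {x : EuclideanSpace ℝ (Fin n) | 2 * √n ≤ ‖x‖} :=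
    measurableSet_le measurable_const measurable_norm
  set e0 := (densityMeasure q).real {x | 2 * √n ≤ ‖x‖} with he0
  have hV := hi.integral_mul_norm_sub_sqrt_sq_le hq hqm
  set V := thinShellConst q ^ 2 with hVdef
  have hV0 : 0 ≤ V := sq_nonneg _
  have h1 : e0 ≤ 1 / 4 := by
    have h := mul_meas_ge_le_integral_of_nonneg (μ := densityMeasure q) (f := fun x => ‖x‖ ^ 2)
      (ae_of_all _ fun x => sq_nonneg _)
      ((integrable_densityMeasure_iff hqm hq.1).2 (hi.integrable_mul_norm_sq)) (4 * n)
    rw [integral_densityMeasure hqm hq.1] at h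
    simp only [smul_eq_mul] at h
    rw [hi.integral_mul_norm_sq] at h
    have h' : e0 ≤ (densityMeasure q).real {x | 4 * n ≤ ‖x‖ ^ 2} := by
      refine measureReal_mono fun x hx => ?_
      simp only [Set.mem_ofPred_eq] at hx ⊢
      nlinarith
    have : 4 * n * e0 ≤ n := le_trans (by gcongr) h
    nlinarith
  have h2 : n * e0 ≤ 2 * V := by
    have h := mul_meas_ge_le_integral_of_nonneg (μ := densityMeasure q)
      (f := fun x => (‖x‖ - √n) ^ 2) (ae_of_all _ fun x => sq_nonneg _)
      ((integrable_densityMeasure_iff hqm hq.1).2 (hi.integral_mul_norm_sub_sq hq hqm _).1) n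
    rw [integral_densityMeasure hqm hq.1] at h
    simp only [smul_eq_mul] at h
    have h' : e0 ≤ (densityMeasure q).real {x | n ≤ (‖x‖ - √n) ^ 2} := by
      refine measureReal_mono fun x hx => ?_
      simp only [Set.mem_ofPred_eq] at hx ⊢
      nlinarith
    exact le_trans (by gcongr) (h.trans hV)
  have hpt : ∀ x : EuclideanSpace ℝ (Fin n), ENNReal.ofReal ((‖x‖ ^ 2 - n) ^ 2) ≤
      ENNReal.ofReal (9 * n * (‖x‖ - √n) ^ 2) +
        {x : EuclideanSpace ℝ (Fin n) | 2 * √n ≤ ‖x‖}.indicator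
          (fun x => ENNReal.ofReal (‖x‖ ^ 4)) x := fun x => by
    have hx0 := norm_nonneg x
    by_cases hx : 2 * √n ≤ ‖x‖
    · rw [Set.indicator_of_mem (by exact hx)]
      refine le_trans (ENNReal.ofReal_le_ofReal ?_) le_add_self
      have : (n : ℝ) ≤ ‖x‖ ^ 2 := by nlinarith
      rw [show ‖x‖ ^ 4 = (‖x‖ ^ 2) ^ 2 by ring]
      exact pow_le_pow_left₀ (by linarith) (by linarith) 2
    · rw [Set.indicator_of_notMem (by exact hx), add_zero]
      refine ENNReal.ofReal_le_ofReal ?_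
      have : (‖x‖ ^ 2 - n) ^ 2 = (‖x‖ + √n) ^ 2 * (‖x‖ - √n) ^ 2 := by
        nth_rw 1 [← hss]; ring
      rw [this]
      gcongr
      nlinarith
  calc _ ≤ (∫⁻ x, ENNReal.ofReal (9 * n * (‖x‖ - √n) ^ 2) ∂densityMeasure q) +
        ∫⁻ x, {x : EuclideanSpace ℝ (Fin n) | 2 * √n ≤ ‖x‖}.indicator
          (fun x => ENNReal.ofReal (‖x‖ ^ 4)) x ∂densityMeasure q := by
        rw [← lintegral_add_left (by fun_prop)]
        exact lintegral_mono hpt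
    _ ≤ ENNReal.ofReal (9 * n * (2 * V)) + ENNReal.ofReal
          ((2 * √n) ^ 4 * (3 ^ 17 * (3 * e0) * (9 / 8))) := by
        gcongr
        · simp only [ENNReal.ofReal_mul (by positivity : (0 : ℝ) ≤ 9 * n)]
          rw [lintegral_const_mul _ (by fun_prop), lintegral_densityMeasure_ofReal hq hqm
            (by fun_prop) (fun x => sq_nonneg _) (hi.integral_mul_norm_sub_sq hq hqm _).1]
          gcongr
        · exact hlc.lintegral_tail_norm_pow_four_le hq hqm (by positivity) h1
    _ ≤ _ := by
        have : 0 ≤ e0 := measureReal_nonneg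
        rw [← ENNReal.ofReal_add (by positivity) (by positivity)]
        refine ENNReal.ofReal_le_ofReal ?_
        have h4 : (2 * √(n : ℝ)) ^ 4 = 16 * n * n := by
          rw [mul_pow, show √(n : ℝ) ^ 4 = (√(n : ℝ) ^ 2) ^ 2 by ring, hss]; ring
        rw [h4, momentConst]
        nlinarith [mul_le_mul_of_nonneg_left h2 hn'.le]

end ThinShell

theorem IsIsotropic.thinShellConst_le {q : EuclideanSpace ℝ (Fin n) → ℝ} (hi : IsIsotropic q) :
    thinShellConst q ≤ √n := by
  rw [thinShellConst, hi.integral_mul_norm_sq]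
  exact Real.sqrt_le_sqrt (by nlinarith [sq_nonneg (∫ x, q x * ‖x‖)])

theorem thinShellConst_le_sigmaSup {q : EuclideanSpace ℝ (Fin n) → ℝ} (hq : IsDensity q)
    (hlc : IsLogConcave q) (hi : IsIsotropic q) : thinShellConst q ≤ sigmaSup n :=
  le_csSup ⟨√n, by rintro _ ⟨q, -, -, h, rfl⟩; exact h.thinShellConst_le⟩ ⟨q, hq, hlc, hi, rfl⟩

theorem sigmaSup_nonneg (n : ℕ) : 0 ≤ sigmaSup n :=
  Real.sSup_nonneg (by rintro _ ⟨q, -, -, -, rfl⟩; exact Real.sqrt_nonneg _)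

/-- The barycenter of the density `g`. -/
def densityMean (g : EuclideanSpace ℝ (Fin n) → ℝ) : EuclideanSpace ℝ (Fin n) := ∫ x, g x • x

/-- The covariance matrix of the density `g`. -/
def densityCov (g : EuclideanSpace ℝ (Fin n) → ℝ) : Matrix (Fin n) (Fin n) ℝ :=
  Matrix.of fun i j => ∫ x, g x * ((x i - densityMean g i) * (x j - densityMean g j))

/-- The squared Mahalanobis norm associated with the density `g`. -/
def mahalanobisSq (g : EuclideanSpace ℝ (Fin n) → ℝ) (x : EuclideanSpace ℝ (Fin n)) : ℝ :=
  ∑ i, ∑ j, (densityCov g)⁻¹ i j * ((x i - densityMean g i) * (x j - densityMean g j))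

open scoped MatrixOrder Matrix.Norms.L2Operator in
theorem Matrix.PosDef.exists_transpose_mul_self_eq_inv {A : Matrix (Fin n) (Fin n) ℝ}
    (hA : A.PosDef) : ∃ N : Matrix (Fin n) (Fin n) ℝ, N.transpose * N = A⁻¹ ∧
      N * A * N.transpose = 1 := by
  obtain ⟨N, hN⟩ := CStarAlgebra.nonneg_iff_eq_star_mul_self.1
    (Matrix.nonneg_iff_posSemidef.2 hA.inv.posSemidef)
  have hN' : N.transpose * N = A⁻¹ := by rw [hN]; rfl
  refine ⟨N, hN', ?_⟩
  rw [Matrix.mul_assoc, mul_eq_one_comm, Matrix.mul_assoc, hN']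
  exact Matrix.mul_nonsing_inv _ ((Matrix.isUnit_iff_isUnit_det _).1 hA.isUnit)

section ChangeOfVariables

variable {T : Matrix (Fin n) (Fin n) ℝ} (a : EuclideanSpace ℝ (Fin n))

theorem measurable_toEuclideanLin_add (T : Matrix (Fin n) (Fin n) ℝ) :
    Measurable fun y => Matrix.toEuclideanLin T y + a :=
  (LinearMap.continuous_of_finiteDimensional _).measurable.add_const a

theorem map_toEuclideanLin_add (hT : T.det ≠ 0) :
    Measure.map (fun y => Matrix.toEuclideanLin T y + a)
      (volume : Measure (EuclideanSpace ℝ (Fin n))) = ENNReal.ofReal |T.det⁻¹| • volume := by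
  have hd : LinearMap.det (Matrix.toEuclideanLin T) = T.det := by
    rw [Matrix.toEuclideanLin_eq_toLin_orthonormal, LinearMap.det_toLin]
  have h1 := Measure.map_linearMap_addHaar_eq_smul_addHaar
    (volume : Measure (EuclideanSpace ℝ (Fin n))) (f := Matrix.toEuclideanLin T) (by rwa [hd])
  have hL : Measurable (Matrix.toEuclideanLin T) :=
    (LinearMap.continuous_of_finiteDimensional _).measurable
  rw [← Function.comp_def (fun z => z + a) (Matrix.toEuclideanLin T),
    ← Measure.map_map (measurable_add_const a) hL, h1, Measure.map_smul, map_add_right_eq_self, hd]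

theorem lintegral_toEuclideanLin_add (hT : T.det ≠ 0) {h : EuclideanSpace ℝ (Fin n) → ℝ≥0∞}
    (hh : Measurable h) :
    ∫⁻ y, ENNReal.ofReal |T.det| * h (Matrix.toEuclideanLin T y + a) = ∫⁻ x, h x := by
  rw [lintegral_const_mul' _ _ ENNReal.ofReal_ne_top,
    ← lintegral_map hh (measurable_toEuclideanLin_add a T), map_toEuclideanLin_add a hT,
    lintegral_smul_measure, smul_eq_mul, ← mul_assoc, ← ENNReal.ofReal_mul (abs_nonneg _), ← abs_mul,
    mul_inv_cancel₀ hT]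
  simp

theorem integral_toEuclideanLin_add {F : Type*} [NormedAddCommGroup F] [NormedSpace ℝ F]
    (hT : T.det ≠ 0) {h : EuclideanSpace ℝ (Fin n) → F} (hh : AEStronglyMeasurable h) :
    ∫ y, |T.det| • h (Matrix.toEuclideanLin T y + a) = ∫ x, h x := by
  have hm := map_toEuclideanLin_add a hT
  rw [integral_smul, ← integral_map (measurable_toEuclideanLin_add a T).aemeasurable
    (by rw [hm]; exact hh.smul_measure _), hm, integral_smul_measure,
    ENNReal.toReal_ofReal (abs_nonneg _), smul_smul, ← abs_mul, mul_inv_cancel₀ hT]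
  simp

end ChangeOfVariables

theorem IsLogConcave.comp_affine {g : EuclideanSpace ℝ (Fin n) → ℝ} (hg0 : ∀ x, 0 ≤ g x)
    (hg : IsLogConcave g) {c : ℝ} (hc : 0 < c)
    (L : EuclideanSpace ℝ (Fin n) →ₗ[ℝ] EuclideanSpace ℝ (Fin n)) (a : EuclideanSpace ℝ (Fin n)) :
    IsLogConcave fun y => c * g (L y + a) := fun x y l hl0 hl1 => by
  have h := hg (L x + a) (L y + a) l hl0 hl1
  have e : L (l • x + (1 - l) • y) + a = l • (L x + a) + (1 - l) • (L y + a) := by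
    simp only [map_add, map_smul, smul_add]; module
  beta_reduce
  rw [e, Real.mul_rpow hc.le (hg0 _), Real.mul_rpow hc.le (hg0 _)]
  calc _ = c ^ l * c ^ (1 - l) * (g (L x + a) ^ l * g (L y + a) ^ (1 - l)) := by ring
    _ = c * (g (L x + a) ^ l * g (L y + a) ^ (1 - l)) := by
      rw [← Real.rpow_add hc]; simp
    _ ≤ _ := by gcongr

section Normalize

variable {g : EuclideanSpace ℝ (Fin n) → ℝ}

theorem integrable_mul_sub_mul_sub (hg : IsDensity g) (hgm : Measurable g)
    (h2 : Integrable fun x => g x * ‖x‖ ^ 2) (b : EuclideanSpace ℝ (Fin n)) (i j : Fin n) :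
    Integrable fun x => g x * ((x i - b i) * (x j - b j)) := by
  refine ((h2.const_mul 2).add (hg.2.1.const_mul (2 * ‖b‖ ^ 2))).mono' (by fun_prop)
    (ae_of_all _ fun x => ?_)
  have h : ∀ i, |x i - b i| ≤ ‖x‖ + ‖b‖ := fun i =>
    (PiLp.norm_apply_le (x - b) i).trans (norm_sub_le x b)
  rw [norm_mul, Real.norm_of_nonneg (hg.1 x), norm_mul, Real.norm_eq_abs, Real.norm_eq_abs,
    Pi.add_apply]
  calc g x * (|x i - b i| * |x j - b j|) ≤ g x * ((‖x‖ + ‖b‖) * (‖x‖ + ‖b‖)) := by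
        have := hg.1 x
        gcongr <;> exact h _
    _ ≤ g x * (2 * ‖x‖ ^ 2 + 2 * ‖b‖ ^ 2) := by
        have := hg.1 x
        gcongr
        nlinarith [sq_nonneg (‖x‖ - ‖b‖)]
    _ = _ := by ring

theorem integrable_smul_self (hg : IsDensity g) (hgm : Measurable g)
    (h2 : Integrable fun x => g x * ‖x‖ ^ 2) : Integrable fun x => g x • x := by
  refine (integrable_mul_norm_of_integrable_mul_norm_sq hg.1 hg.2.1 hgm h2).mono' (by fun_prop)
    (ae_of_all _ fun x => ?_)
  rw [norm_smul, Real.norm_of_nonneg (hg.1 x)]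

theorem lintegral_mahalanobisSq_sub_sq_le (hn : 1 ≤ n) (hg : IsDensity g) (hgm : Measurable g)
    (hlc : IsLogConcave g) (h2 : Integrable fun x => g x * ‖x‖ ^ 2) (hA : (densityCov g).PosDef) :
    ∫⁻ x, ENNReal.ofReal ((mahalanobisSq g x - n) ^ 2) ∂densityMeasure g ≤
      ENNReal.ofReal (momentConst * n * sigmaSup n ^ 2) := by
  obtain ⟨N, hN, hNA⟩ := hA.exists_transpose_mul_self_eq_inv
  set a := densityMean g with ha
  have hNdet : N.det ≠ 0 := fun h => by simpa [Matrix.det_mul, h] using congrArg Matrix.det hNA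
  set T := N⁻¹ with hT
  have hNu : IsUnit N.det := hNdet.isUnit
  have hTdet : T.det ≠ 0 := by
    rw [hT, Matrix.det_nonsing_inv, Ring.inverse_eq_inv']; exact inv_ne_zero hNdet
  set S : EuclideanSpace ℝ (Fin n) → EuclideanSpace ℝ (Fin n) :=
    fun y => Matrix.toEuclideanLin T y + a with hS
  have hSm : Measurable S := measurable_toEuclideanLin_add a T
  have hinv : ∀ y, Matrix.toEuclideanLin N (S y - a) = y := fun y => by
    ext i
    simp [hS, hT, Matrix.toLpLin_apply, Matrix.mulVec_mulVec, Matrix.mul_nonsing_inv _ hNu]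
  have hNc : Continuous (Matrix.toEuclideanLin N) := LinearMap.continuous_of_finiteDimensional _
  set q : EuclideanSpace ℝ (Fin n) → ℝ := fun y => |T.det| * g (S y) with hq
  have hc : 0 < |T.det| := abs_pos.2 hTdet
  have hqm : Measurable q := (hgm.comp hSm).const_mul _
  have hq0 : ∀ y, 0 ≤ q y := fun y => mul_nonneg hc.le (hg.1 _)
  have hqint : ∫ y, q y = 1 := by
    rw [← hg.2.2]
    exact integral_toEuclideanLin_add a hTdet hgm.aestronglyMeasurable
  have hqd : IsDensity q :=
    ⟨hq0, by_contra fun h => by rw [integral_undef h] at hqint; simp at hqint, hqint⟩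
  have hqlc : IsLogConcave q := hlc.comp_affine hg.1 hc (Matrix.toEuclideanLin T) a
  have hcoord : ∀ x i, (Matrix.toEuclideanLin N (x - a)) i = ∑ k, N i k * (x k - a k) :=
    fun x i => by simp [Matrix.toLpLin_apply, Matrix.mulVec, dotProduct]
  have hqi : IsIsotropic q := by
    constructor
    · have h := integral_toEuclideanLin_add a hTdet
        (h := fun x => g x • Matrix.toEuclideanLin N (x - a)) (by fun_prop)
      have h' : ∀ y, q y • y = |T.det| • g (S y) • Matrix.toEuclideanLin N (S y - a) := fun y => by
        rw [hinv, smul_smul]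
      simp only [h']
      refine h.trans ?_
      have e : ∀ x, g x • Matrix.toEuclideanLin N (x - a) =
          (LinearMap.toContinuousLinearMap (Matrix.toEuclideanLin N)) (g x • x - g x • a) :=
        fun x => by simp [smul_sub]
      have i1 := integrable_smul_self hg hgm h2
      have i2 : Integrable fun x => g x • x - g x • a := i1.sub (hg.2.1.smul_const a)
      simp only [e]
      rw [ContinuousLinearMap.integral_comp_comm _ i2, integral_sub i1 (hg.2.1.smul_const a), integral_smul_const, hg.2.2, one_smul, ha,
        densityMean, sub_self, map_zero]
    · intro i j
      have h := integral_toEuclideanLin_add a hTdet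
        (h := fun x => g x * ((Matrix.toEuclideanLin N (x - a)) i *
          (Matrix.toEuclideanLin N (x - a)) j)) (by fun_prop)
      have h' : ∀ y : EuclideanSpace ℝ (Fin n), q y * (y i * y j) = |T.det| • (g (S y) *
          ((Matrix.toEuclideanLin N (S y - a)) i * (Matrix.toEuclideanLin N (S y - a)) j)) :=
        fun y => by rw [hinv, smul_eq_mul, mul_assoc]
      simp only [h']
      refine h.trans ?_
      have e : ∀ x, g x * ((Matrix.toEuclideanLin N (x - a)) i *
          (Matrix.toEuclideanLin N (x - a)) j) =
          ∑ k, ∑ l, N i k * N j l * (g x * ((x k - a k) * (x l - a l))) := fun x => by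
        rw [hcoord, hcoord, Finset.sum_mul_sum, Finset.mul_sum]
        refine Finset.sum_congr rfl fun k _ => ?_
        rw [Finset.mul_sum]
        exact Finset.sum_congr rfl fun l _ => by ring
      have hI := integrable_mul_sub_mul_sub hg hgm h2 a
      simp only [e]
      rw [integral_finsetSum _ fun k _ => integrable_finsetSum _ fun l _ => (hI k l).const_mul _]
      have e2 : ∀ k, ∫ x, ∑ l, N i k * N j l * (g x * ((x k - a k) * (x l - a l))) =
          ∑ l, N i k * N j l * densityCov g k l := fun k => by
        rw [integral_finsetSum _ fun l _ => (hI k l).const_mul _]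
        exact Finset.sum_congr rfl fun l _ => by rw [integral_const_mul]; rfl
      simp only [e2]
      have := congrFun (congrFun hNA i) j
      rw [Matrix.one_apply] at this
      rw [← this, Matrix.mul_apply, Finset.sum_comm]
      refine Finset.sum_congr rfl fun l _ => ?_
      rw [Matrix.mul_apply, Finset.sum_mul]
      exact Finset.sum_congr rfl fun k _ => by simp [Matrix.transpose_apply]; ring
  have hmah : ∀ x, mahalanobisSq g x = ‖Matrix.toEuclideanLin N (x - a)‖ ^ 2 := fun x => by
    rw [EuclideanSpace.norm_sq_eq, mahalanobisSq, ← hN, ← ha]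
    have e : ∀ k, (∑ i, N k i * (x i - a i)) ^ 2 =
        ∑ i, ∑ j, N k i * N k j * ((x i - a i) * (x j - a j)) := fun k => by
      rw [sq, Finset.sum_mul_sum]
      exact Finset.sum_congr rfl fun i _ => Finset.sum_congr rfl fun j _ => by ring
    simp only [Real.norm_eq_abs, sq_abs, hcoord, e]
    symm
    rw [Finset.sum_comm]
    refine Finset.sum_congr rfl fun i _ => ?_
    rw [Finset.sum_comm]
    refine Finset.sum_congr rfl fun j _ => ?_
    rw [Matrix.mul_apply, Finset.sum_mul]
    rfl
  have hfin := hqi.lintegral_norm_sq_sub_sq_le hn hqd hqm hqlc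
  rw [lintegral_densityMeasure hqm (by fun_prop)] at hfin
  rw [lintegral_densityMeasure hgm (by simp only [hmah]; fun_prop),
    ← lintegral_toEuclideanLin_add a hTdet (by simp only [hmah]; fun_prop)]
  have e3 : ∀ y, ENNReal.ofReal |T.det| * (ENNReal.ofReal (g (S y)) *
      ENNReal.ofReal ((mahalanobisSq g (S y) - n) ^ 2)) =
      ENNReal.ofReal (q y) * ENNReal.ofReal ((‖y‖ ^ 2 - n) ^ 2) := fun y => by
    rw [hmah, hinv, ← mul_assoc, ← ENNReal.ofReal_mul hc.le]
  refine le_trans (le_of_eq (lintegral_congr e3)) (hfin.trans (ENNReal.ofReal_le_ofReal ?_))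
  have := momentConst_pos
  have h0 : 0 ≤ thinShellConst q := Real.sqrt_nonneg _
  gcongr
  exact thinShellConst_le_sigmaSup hqd hqlc hqi

end Normalize

section Tilt

variable {Ω : Type*} [MeasurableSpace Ω] {μ : Measure Ω} {f h : Ω → ℝ} {M : ℝ}

theorem abs_mul_exp_le {y t0 t1 t : ℝ} (hM0 : 0 ≤ M) (hy : y ≤ M) (ht0 : 0 < t0) (h0 : t0 ≤ t)
    (h1 : t ≤ t1) : |y| * rexp (t * y) ≤ M * rexp (t1 * M) + 1 / t0 := by
  rcases le_total 0 y with hy0 | hy0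
  · rw [abs_of_nonneg hy0]
    have : t * y ≤ t1 * M := mul_le_mul h1 hy hy0 (by linarith)
    have h2 : y * rexp (t * y) ≤ M * rexp (t1 * M) := by gcongr
    have : 0 < 1 / t0 := by positivity
    linarith
  · rw [abs_of_nonpos hy0]
    have h2 : -y * rexp (t * y) ≤ 1 / t0 := by
      have h3 := Real.add_one_le_exp (-(t * y))
      have h4 : rexp (-(t * y)) * rexp (t * y) = 1 := by rw [← Real.exp_add]; simp
      rw [le_div_iff₀ ht0]
      have h5 : t0 * -y ≤ t * -y := by gcongr; linarith
      have h6 := Real.exp_pos (t * y)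
      nlinarith
    have : 0 ≤ M * rexp (t1 * M) := by positivity
    linarith

theorem exp_mul_le {y t t1 : ℝ} (hM0 : 0 ≤ M) (hy : y ≤ M) (h0 : 0 ≤ t) (h1 : t ≤ t1) :
    rexp (t * y) ≤ rexp (t1 * M) := by
  refine Real.exp_le_exp.2 ?_
  calc t * y ≤ t * M := by gcongr
    _ ≤ t1 * M := by gcongr

theorem integrable_exp_mul_mul (hf : Measurable f) (hM0 : 0 ≤ M) (hM : ∀ x, f x ≤ M)
    (hh : Integrable h μ) {t : ℝ} (ht : 0 ≤ t) : Integrable (fun x => rexp (t * f x) * h x) μ :=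
  hh.bdd_mul (by fun_prop) (ae_of_all _ fun x => by
    rw [Real.norm_of_nonneg (Real.exp_pos _).le]
    exact exp_mul_le hM0 (hM x) ht le_rfl)

theorem continuousOn_integral_exp_mul (hf : Measurable f) (hM0 : 0 ≤ M) (hM : ∀ x, f x ≤ M)
    (hh : Integrable h μ) (t1 : ℝ) :
    ContinuousOn (fun t => ∫ x, rexp (t * f x) * h x ∂μ) (Set.Icc 0 t1) := by
  refine continuousOn_of_dominated (bound := fun x => rexp (t1 * M) * |h x|)
    (fun t _ => (AEStronglyMeasurable.mul (by fun_prop) hh.1))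
    (fun t ht => ae_of_all _ fun x => ?_) (hh.abs.const_mul _) (ae_of_all _ fun x => by fun_prop)
  rw [norm_mul, Real.norm_of_nonneg (Real.exp_pos _).le, Real.norm_eq_abs]
  exact mul_le_mul_of_nonneg_right (exp_mul_le hM0 (hM x) ht.1 ht.2) (abs_nonneg _)

theorem hasDerivAt_integral_exp_mul (hf : Measurable f) (hM0 : 0 ≤ M) (hM : ∀ x, f x ≤ M)
    (hh : Integrable h μ) {t : ℝ} (ht : 0 < t) :
    Integrable (fun x => rexp (t * f x) * (f x * h x)) μ ∧
      HasDerivAt (fun t => ∫ x, rexp (t * f x) * h x ∂μ)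
        (∫ x, rexp (t * f x) * (f x * h x) ∂μ) t := by
  refine hasDerivAt_integral_of_dominated_loc_of_deriv_le (s := Set.Icc (t / 2) (2 * t))
    (F := fun t x => rexp (t * f x) * h x) (F' := fun t x => rexp (t * f x) * (f x * h x))
    (bound := fun x => (M * rexp (2 * t * M) + 1 / (t / 2)) * |h x|)
    (Icc_mem_nhds (by linarith) (by linarith))
    (Eventually.of_forall fun t => AEStronglyMeasurable.mul (by fun_prop) hh.1)
    (integrable_exp_mul_mul hf hM0 hM hh ht.le)
    (AEStronglyMeasurable.mul (by fun_prop) (AEStronglyMeasurable.mul (by fun_prop) hh.1))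
    (ae_of_all _ fun x s hs => ?_) (hh.abs.const_mul _) (ae_of_all _ fun x s _ => ?_)
  · rw [norm_mul, norm_mul, Real.norm_of_nonneg (Real.exp_pos _).le, Real.norm_eq_abs,
      Real.norm_eq_abs, ← mul_assoc, mul_comm (rexp _)]
    exact mul_le_mul_of_nonneg_right
      (abs_mul_exp_le hM0 (hM x) (by positivity) hs.1 hs.2) (abs_nonneg _)
  · have := (((hasDerivAt_id s).mul_const (f x)).exp).mul_const (h x)
    exact this.congr_deriv (by simp only [id]; ring)

theorem integral_tilted_mul_eq_div (t : ℝ) (h : Ω → ℝ) :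
    ∫ x, h x ∂μ.tilted (fun x => t * f x) =
      (∫ x, rexp (t * f x) * h x ∂μ) / ∫ x, rexp (t * f x) * 1 ∂μ := by
  rw [integral_tilted, ← integral_div]
  simp only [smul_eq_mul, mul_one]
  exact integral_congr_ae (ae_of_all _ fun x => by ring)

variable [IsProbabilityMeasure μ]

theorem integrable_exp_mul (hf : Measurable f) (hM0 : 0 ≤ M) (hM : ∀ x, f x ≤ M) {t : ℝ}
    (ht : 0 ≤ t) : Integrable (fun x => rexp (t * f x)) μ := by
  simpa using integrable_exp_mul_mul hf hM0 hM (integrable_const (1 : ℝ)) ht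

theorem integral_exp_mul_one_pos (hf : Measurable f) (hM0 : 0 ≤ M) (hM : ∀ x, f x ≤ M) {t : ℝ}
    (ht : 0 ≤ t) : 0 < ∫ x, rexp (t * f x) * 1 ∂μ := by
  simpa using integral_exp_pos (integrable_exp_mul hf hM0 hM ht)

theorem integrable_tilted_mul (hf : Measurable f) (hM0 : 0 ≤ M) (hM : ∀ x, f x ≤ M)
    (hh : Integrable h μ) {t : ℝ} (ht : 0 ≤ t) : Integrable h (μ.tilted fun x => t * f x) :=
  (integrable_tilted_iff (integrable_exp_mul hf hM0 hM ht) _).2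
    (integrable_exp_mul_mul hf hM0 hM hh ht)

theorem integrable_tilted_mul_mul (hf : Measurable f) (hM0 : 0 ≤ M) (hM : ∀ x, f x ≤ M)
    (hh : Integrable h μ) {t : ℝ} (ht : 0 < t) :
    Integrable (fun x => f x * h x) (μ.tilted fun x => t * f x) :=
  (integrable_tilted_iff (integrable_exp_mul hf hM0 hM ht.le) _).2
    (hasDerivAt_integral_exp_mul hf hM0 hM hh ht).1

theorem continuousOn_integral_tilted_mul (hf : Measurable f) (hM0 : 0 ≤ M) (hM : ∀ x, f x ≤ M)
    (hh : Integrable h μ) (t1 : ℝ) :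
    ContinuousOn (fun t => ∫ x, h x ∂μ.tilted fun x => t * f x) (Set.Icc 0 t1) := by
  simp only [integral_tilted_mul_eq_div]
  exact (continuousOn_integral_exp_mul hf hM0 hM hh t1).div
    (continuousOn_integral_exp_mul hf hM0 hM (integrable_const 1) t1)
    fun t ht => (integral_exp_mul_one_pos hf hM0 hM ht.1).ne'

theorem hasDerivAt_integral_tilted_mul (hf : Measurable f) (hM0 : 0 ≤ M) (hM : ∀ x, f x ≤ M)
    (hh : Integrable h μ) {t : ℝ} (ht : 0 < t) :
    HasDerivAt (fun t => ∫ x, h x ∂μ.tilted fun x => t * f x)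
      ((∫ x, f x * h x ∂μ.tilted fun x => t * f x) -
        (∫ x, f x ∂μ.tilted fun x => t * f x) * ∫ x, h x ∂μ.tilted fun x => t * f x) t := by
  have hZ := (integral_exp_mul_one_pos (μ := μ) hf hM0 hM ht.le).ne'
  have hd := (hasDerivAt_integral_exp_mul hf hM0 hM hh ht).2.div
    (hasDerivAt_integral_exp_mul (μ := μ) hf hM0 hM (integrable_const 1) ht).2 hZ
  simp only [integral_tilted_mul_eq_div]
  refine HasDerivAt.congr_deriv hd ?_
  simp only [mul_one] at hZ ⊢
  field_simp

end Tilt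

section Jacobi

variable {ι : Type*} [Fintype ι] [DecidableEq ι]

theorem Matrix.differentiable_det_of :
    Differentiable ℝ fun B : ι → ι → ℝ => (Matrix.of B).det := by
  simp only [Matrix.det_apply, Matrix.of_apply]
  fun_prop

/-- Jacobi's formula. -/
theorem Matrix.hasDerivAt_det {A : ℝ → Matrix ι ι ℝ} {A' : Matrix ι ι ℝ} {t : ℝ}
    (hA : ∀ i j, HasDerivAt (fun t => A t i j) (A' i j) t) (h0 : IsUnit (A t).det) :
    HasDerivAt (fun t => (A t).det) ((A t).det * ((A t)⁻¹ * A').trace) t := by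
  have hA1 : HasDerivAt (fun t i j => A t i j) (fun i j => A' i j) t :=
    hasDerivAt_pi.2 fun i => hasDerivAt_pi.2 fun j => hA i j
  have hd := (Matrix.differentiable_det_of (ι := ι)).differentiableAt (x := fun i j => A t i j)
  have h1 := hd.hasFDerivAt.comp_hasDerivAt t hA1
  have hline : HasDerivAt (fun r : ℝ => (fun i j => A t i j) + r • fun i j => A' i j)
      (fun i j => A' i j) 0 := by
    simpa using ((hasDerivAt_id (0 : ℝ)).smul_const (fun i j => A' i j)).const_add
      (fun i j => A t i j)
  have h2 := (show HasFDerivAt _ _ _ by simpa using hd.hasFDerivAt).comp_hasDerivAt (0 : ℝ)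
    (f := fun r : ℝ => (fun i j => A t i j) + r • fun i j => A' i j) (hline)
  set P := (Matrix.det (1 + (Polynomial.X : Polynomial ℝ) •
    ((A t)⁻¹ * A').map Polynomial.C)).divX.divX
  have h3 : HasDerivAt (fun r : ℝ => (A t).det * (1 + ((A t)⁻¹ * A').trace * r +
      P.eval r * r ^ 2)) ((A t).det * ((A t)⁻¹ * A').trace) 0 := by
    have := ((((hasDerivAt_id (0 : ℝ)).const_mul ((A t)⁻¹ * A').trace).const_add 1).add
      ((P.hasDerivAt 0).mul ((hasDerivAt_id (0 : ℝ)).pow 2))).const_mul (A t).det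
    simpa using this
  have e : (fun r : ℝ => (A t).det * (1 + ((A t)⁻¹ * A').trace * r + P.eval r * r ^ 2)) =
      (fun B : ι → ι → ℝ => (Matrix.of B).det) ∘
        fun r : ℝ => (fun i j => A t i j) + r • fun i j => A' i j := by
    funext r
    rw [← Matrix.det_one_add_smul, ← Matrix.det_mul, Matrix.mul_add, Matrix.mul_one,
      Matrix.mul_smul, Matrix.mul_nonsing_inv_cancel_left _ _ h0]
    rfl
  rw [e] at h3
  have h4 := h3.unique h2
  rw [h4]
  exact h1

end Jacobi

section TiltCov

variable {Ω ι : Type*} [MeasurableSpace Ω] {μ : Measure Ω}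
  {f : Ω → ℝ} {X : ι → Ω → ℝ} {M : ℝ}

/-- The covariance matrix of the random vector `X` under the tilted measure. -/
def tiltCov (μ : Measure Ω) (f : Ω → ℝ) (X : ι → Ω → ℝ) (t : ℝ) : Matrix ι ι ℝ :=
  Matrix.of fun i j => (∫ x, X i x * X j x ∂μ.tilted fun x => t * f x) -
    (∫ x, X i x ∂μ.tilted fun x => t * f x) * ∫ x, X j x ∂μ.tilted fun x => t * f x

/-- The squared Mahalanobis norm of the random vector `X` under the tilted measure. -/
def tiltMahalanobisSq [Fintype ι] [DecidableEq ι] (μ : Measure Ω) (f : Ω → ℝ) (X : ι → Ω → ℝ) (t : ℝ) (x : Ω) : ℝ :=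
  ∑ i, ∑ j, (tiltCov μ f X t)⁻¹ i j * ((X i x - ∫ x, X i x ∂μ.tilted fun x => t * f x) *
    (X j x - ∫ x, X j x ∂μ.tilted fun x => t * f x))

theorem integral_mul_mul_sub {ν : Measure Ω} [IsProbabilityMeasure ν] {g u v : Ω → ℝ}
    (a b : ℝ) (hg : Integrable g ν) (hu : Integrable u ν) (hv : Integrable v ν)
    (huv : Integrable (fun x => u x * v x) ν)
    (hgu : Integrable (fun x => g x * u x) ν) (hgv : Integrable (fun x => g x * v x) ν)
    (hguv : Integrable (fun x => g x * (u x * v x)) ν) :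
    Integrable (fun x => (u x - a) * (v x - b) * (g x - ∫ x, g x ∂ν)) ν ∧
    ∫ x, (u x - a) * (v x - b) * (g x - ∫ x, g x ∂ν) ∂ν =
      ((∫ x, g x * (u x * v x) ∂ν) - (∫ x, g x ∂ν) * ∫ x, u x * v x ∂ν) -
      b * ((∫ x, g x * u x ∂ν) - (∫ x, g x ∂ν) * ∫ x, u x ∂ν) -
      a * ((∫ x, g x * v x ∂ν) - (∫ x, g x ∂ν) * ∫ x, v x ∂ν) := by
  set m := ∫ x, g x ∂ν with hm
  have e : (fun x => (u x - a) * (v x - b) * (g x - m)) = fun x =>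
      ((((g x * (u x * v x) - m * (u x * v x)) - b * (g x * u x - m * u x)) -
        a * (g x * v x - m * v x)) + a * b * (g x - m)) := by funext x; ring
  have i1 : Integrable (fun x => g x * (u x * v x) - m * (u x * v x)) ν :=
    hguv.sub (huv.const_mul m)
  have i2 : Integrable (fun x => g x * u x - m * u x) ν := hgu.sub (hu.const_mul m)
  have i3 : Integrable (fun x => g x * v x - m * v x) ν := hgv.sub (hv.const_mul m)
  have i4 : Integrable (fun x => g x - m) ν := hg.sub (integrable_const m)
  have i5 : Integrable (fun x => (g x * (u x * v x) - m * (u x * v x)) -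
      b * (g x * u x - m * u x)) ν := i1.sub (i2.const_mul b)
  have i6 : Integrable (fun x => ((g x * (u x * v x) - m * (u x * v x)) -
      b * (g x * u x - m * u x)) - a * (g x * v x - m * v x)) ν := i5.sub (i3.const_mul a)
  have z : ∫ x, (g x - m) ∂ν = 0 := by
    rw [integral_sub hg (integrable_const m)]; simp [hm]
  rw [e]
  refine ⟨i6.add (i4.const_mul _), ?_⟩
  rw [integral_add i6 (i4.const_mul _), integral_sub i5 (i3.const_mul a),
    integral_sub i1 (i2.const_mul b), integral_sub hguv (huv.const_mul m), integral_const_mul,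
    integral_const_mul, integral_const_mul, integral_const_mul, z,
    integral_sub hgu (hu.const_mul m), integral_sub hgv (hv.const_mul m), integral_const_mul,
    integral_const_mul]
  ring

theorem integral_sub_integral_sq {ν : Measure Ω} [IsProbabilityMeasure ν] {g : Ω → ℝ}
    (hg : Integrable g ν) (hgg : Integrable (fun x => g x * g x) ν) :
    Integrable (fun x => (g x - ∫ x, g x ∂ν) ^ 2) ν ∧
    ∫ x, (g x - ∫ x, g x ∂ν) ^ 2 ∂ν = (∫ x, g x * g x ∂ν) - (∫ x, g x ∂ν) * ∫ x, g x ∂ν := by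
  set a := ∫ x, g x ∂ν with ha
  have e2 : (fun x => (g x - a) ^ 2) = fun x => (g x * g x - 2 * a * g x) + a ^ 2 := by
    funext x; ring
  have i2 : Integrable (fun x => g x * g x - 2 * a * g x) ν := hgg.sub (hg.const_mul _)
  rw [e2]
  refine ⟨i2.add (integrable_const _), ?_⟩
  rw [integral_add i2 (integrable_const _), integral_sub hgg (hg.const_mul _),
    integral_const_mul, ← ha]
  simp
  ring

variable [IsProbabilityMeasure μ]

theorem continuousOn_tiltCov (hf : Measurable f) (hM0 : 0 ≤ M) (hM : ∀ x, f x ≤ M)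
    (hX : ∀ i, Integrable (X i) μ) (hXX : ∀ i j, Integrable (fun x => X i x * X j x) μ)
    (i j : ι) (t1 : ℝ) : ContinuousOn (fun t => tiltCov μ f X t i j) (Set.Icc 0 t1) :=
  (continuousOn_integral_tilted_mul hf hM0 hM (hXX i j) t1).sub
    ((continuousOn_integral_tilted_mul hf hM0 hM (hX i) t1).mul
      (continuousOn_integral_tilted_mul hf hM0 hM (hX j) t1))

variable [Fintype ι] [DecidableEq ι]

theorem continuousOn_det_tiltCov (hf : Measurable f) (hM0 : 0 ≤ M) (hM : ∀ x, f x ≤ M)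
    (hX : ∀ i, Integrable (X i) μ) (hXX : ∀ i j, Integrable (fun x => X i x * X j x) μ)
    (t1 : ℝ) : ContinuousOn (fun t => (tiltCov μ f X t).det) (Set.Icc 0 t1) :=
  ((Matrix.differentiable_det_of (ι := ι)).continuous.comp_continuousOn
    (continuousOn_pi.2 fun i => continuousOn_pi.2 fun j =>
      continuousOn_tiltCov hf hM0 hM hX hXX i j t1))

/-- The derivative of `log det` of the tilted covariance. -/
theorem hasDerivAt_log_det_tiltCov (hf : Measurable f) (hM0 : 0 ≤ M) (hM : ∀ x, f x ≤ M)
    (hfi : Integrable f μ)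
    (hX : ∀ i, Integrable (X i) μ) (hXX : ∀ i j, Integrable (fun x => X i x * X j x) μ)
    {t : ℝ} (ht : 0 < t) (hdet : 0 < (tiltCov μ f X t).det) :
    Integrable (fun x => tiltMahalanobisSq μ f X t x *
      (f x - ∫ x, f x ∂μ.tilted fun x => t * f x)) (μ.tilted fun x => t * f x) ∧
    HasDerivAt (fun t => Real.log (tiltCov μ f X t).det)
      (∫ x, tiltMahalanobisSq μ f X t x * (f x - ∫ x, f x ∂μ.tilted fun x => t * f x)
        ∂μ.tilted fun x => t * f x) t := by
  set ν := μ.tilted fun x => t * f x with hν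
  have : IsProbabilityMeasure ν :=
    isProbabilityMeasure_tilted (integrable_exp_mul hf hM0 hM ht.le)
  have key := fun i j => integral_mul_mul_sub (ν := ν) (∫ x, X i x ∂ν) (∫ x, X j x ∂ν)
    (integrable_tilted_mul hf hM0 hM hfi ht.le) (integrable_tilted_mul hf hM0 hM (hX i) ht.le)
    (integrable_tilted_mul hf hM0 hM (hX j) ht.le)
    (integrable_tilted_mul hf hM0 hM (hXX i j) ht.le)
    (integrable_tilted_mul_mul hf hM0 hM (hX i) ht)
    (integrable_tilted_mul_mul hf hM0 hM (hX j) ht)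
    (integrable_tilted_mul_mul hf hM0 hM (hXX i j) ht)
  have hd : ∀ i j, HasDerivAt (fun t => tiltCov μ f X t i j)
      ((Matrix.of fun i j => ∫ x, (X i x - ∫ x, X i x ∂ν) * (X j x - ∫ x, X j x ∂ν) *
        (f x - ∫ x, f x ∂ν) ∂ν : Matrix ι ι ℝ) i j) t := by
    intro i j
    have h1 := (hasDerivAt_integral_tilted_mul hf hM0 hM (hXX i j) ht).sub
      ((hasDerivAt_integral_tilted_mul hf hM0 hM (hX i) ht).mul
        (hasDerivAt_integral_tilted_mul hf hM0 hM (hX j) ht))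
    refine HasDerivAt.congr_deriv h1 ?_
    rw [Matrix.of_apply, (key i j).2]
    ring
  have hi : ∀ i j, Integrable (fun x => (tiltCov μ f X t)⁻¹ i j *
      ((X i x - ∫ x, X i x ∂ν) * (X j x - ∫ x, X j x ∂ν) * (f x - ∫ x, f x ∂ν))) ν :=
    fun i j => (key i j).1.const_mul _
  have e : (fun x => tiltMahalanobisSq μ f X t x * (f x - ∫ x, f x ∂ν)) = fun x =>
      ∑ i, ∑ j, (tiltCov μ f X t)⁻¹ i j *
      ((X i x - ∫ x, X i x ∂ν) * (X j x - ∫ x, X j x ∂ν) * (f x - ∫ x, f x ∂ν)) := by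
    funext x
    simp only [tiltMahalanobisSq, Finset.sum_mul, ← hν, mul_assoc]
  refine ⟨?_, ?_⟩
  · rw [e]
    exact integrable_finsetSum _ fun i _ => integrable_finsetSum _ fun j _ => hi i j
  · have h2 := (Matrix.hasDerivAt_det hd hdet.ne'.isUnit).log hdet.ne'
    refine h2.congr_deriv ?_
    rw [mul_div_cancel_left₀ _ hdet.ne', e,
      integral_finsetSum _ fun i _ => integrable_finsetSum _ fun j _ => hi i j, Matrix.trace]
    refine Finset.sum_congr rfl fun i _ => ?_
    rw [integral_finsetSum _ fun j _ => hi i j, Matrix.diag_apply, Matrix.mul_apply]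
    refine Finset.sum_congr rfl fun j _ => ?_
    rw [integral_const_mul, Matrix.of_apply]
    congr 1
    refine integral_congr_ae (ae_of_all _ fun x => ?_)
    beta_reduce
    ring

/-- Along the tilting path the determinant of the covariance cannot decrease too fast. -/
theorem neg_le_log_det_tiltCov (hf : Measurable f) (hM0 : 0 ≤ M) (hM : ∀ x, f x ≤ M)
    (hfi : Integrable f μ)
    (hX : ∀ i, Integrable (X i) μ) (hXX : ∀ i j, Integrable (fun x => X i x * X j x) μ)
    (hdet : ∀ t ∈ Set.Icc (0 : ℝ) 1, 0 < (tiltCov μ f X t).det)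
    (h0 : tiltCov μ f X 0 = 1) {N K κ : ℝ} (hκ : 0 < κ)
    (hQ : ∀ t ∈ Set.Ioo (0 : ℝ) 1,
      Integrable (fun x => (tiltMahalanobisSq μ f X t x - N) ^ 2) (μ.tilted fun x => t * f x) ∧
      ∫ x, (tiltMahalanobisSq μ f X t x - N) ^ 2 ∂μ.tilted (fun x => t * f x) ≤ K) :
    -(1 / 2 * (κ * K + ((∫ x, f x ∂μ.tilted f) - ∫ x, f x ∂μ) / κ)) ≤
      Real.log (tiltCov μ f X 1).det := by
  set m : ℝ → ℝ := fun t => ∫ x, f x ∂μ.tilted fun x => t * f x with hm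
  set G : ℝ → ℝ := fun t => Real.log (tiltCov μ f X t).det + 1 / 2 * (κ * K * t + m t / κ) with hG
  have hcont : ContinuousOn G (Set.Icc 0 1) := by
    refine ((continuousOn_det_tiltCov hf hM0 hM hX hXX 1).log fun t ht => (hdet t ht).ne').add
      (continuousOn_const.mul ((continuousOn_const.mul continuousOn_id).add
        ((continuousOn_integral_tilted_mul hf hM0 hM hfi 1).div_const κ)))
  have hder : ∀ t ∈ Set.Ioo (0 : ℝ) 1, ∃ d, 0 ≤ d ∧ HasDerivAt G d t := by
    intro t ht
    obtain ⟨hi, hD⟩ := hasDerivAt_log_det_tiltCov hf hM0 hM hfi hX hXX ht.1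
      (hdet t ⟨ht.1.le, ht.2.le⟩)
    have hm' := hasDerivAt_integral_tilted_mul hf hM0 hM hfi ht.1
    refine ⟨_, ?_, hD.add (((((hasDerivAt_id t).const_mul (κ * K)).add
      (hm'.div_const κ))).const_mul (1 / 2))⟩
    obtain ⟨hq, hqK⟩ := hQ t ht
    set ν := μ.tilted fun x => t * f x with hν
    have : IsProbabilityMeasure ν :=
      isProbabilityMeasure_tilted (integrable_exp_mul hf hM0 hM ht.1.le)
    have hfν : Integrable f ν := integrable_tilted_mul hf hM0 hM hfi ht.1.le
    have hffν : Integrable (fun x => f x * f x) ν := integrable_tilted_mul_mul hf hM0 hM hfi ht.1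
    set a := ∫ x, f x ∂ν with ha
    obtain ⟨i3, v2⟩ := integral_sub_integral_sq hfν hffν
    rw [← ha] at i3 v2
    have i4 : Integrable (fun x => N * (f x - a)) ν := (hfν.sub (integrable_const a)).const_mul _
    have z : ∫ x, N * (f x - a) ∂ν = 0 := by
      rw [integral_const_mul, integral_sub hfν (integrable_const a)]; simp [ha]
    have i5 : Integrable (fun x => κ * (tiltMahalanobisSq μ f X t x - N) ^ 2 +
        (f x - a) ^ 2 / κ) ν := (hq.const_mul κ).add (i3.div_const κ)
    have i6 : Integrable (fun x => tiltMahalanobisSq μ f X t x * (f x - a) - N * (f x - a)) ν :=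
      hi.sub i4
    have key : 0 ≤ ∫ x, (tiltMahalanobisSq μ f X t x * (f x - a) - N * (f x - a)) +
        1 / 2 * (κ * (tiltMahalanobisSq μ f X t x - N) ^ 2 + (f x - a) ^ 2 / κ) ∂ν := by
      refine integral_nonneg fun x => ?_
      have : (tiltMahalanobisSq μ f X t x * (f x - a) - N * (f x - a)) +
        1 / 2 * (κ * (tiltMahalanobisSq μ f X t x - N) ^ 2 + (f x - a) ^ 2 / κ) =
        1 / (2 * κ) * (κ * (tiltMahalanobisSq μ f X t x - N) + (f x - a)) ^ 2 := by
        field_simp; ring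
      simp only [Pi.zero_apply]
      rw [this]
      positivity
    rw [integral_add i6 (i5.const_mul _), integral_sub hi i4, z, integral_const_mul,
      integral_add (hq.const_mul κ) (i3.div_const κ), integral_const_mul, integral_div, v2] at key
    have : κ * ∫ x, (tiltMahalanobisSq μ f X t x - N) ^ 2 ∂ν ≤ κ * K := by gcongr
    simp only [mul_one]
    linarith
  have hmono : MonotoneOn G (Set.Icc 0 1) := by
    refine monotoneOn_of_deriv_nonneg (convex_Icc 0 1) hcont ?_ ?_
    · rw [interior_Icc]
      exact fun t ht => (hder t ht).choose_spec.2.differentiableAt.differentiableWithinAt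
    · rw [interior_Icc]
      intro t ht
      obtain ⟨d, hd0, hd⟩ := hder t ht
      rwa [hd.deriv]
  have h := hmono (Set.left_mem_Icc.2 zero_le_one) (Set.right_mem_Icc.2 zero_le_one) zero_le_one
  have m0 : m 0 = ∫ x, f x ∂μ := by
    simp only [hm, zero_mul]
    have : μ.tilted (fun _ => (0 : ℝ)) = μ := by simp
    rw [this]
  have m1 : m 1 = ∫ x, f x ∂μ.tilted f := by simp only [hm, one_mul]
  simp only [hG, h0, m0, m1, Matrix.det_one, Real.log_one] at h
  rw [sub_div]
  linarith

theorem integral_le_integral_tilted (hf : Measurable f) (hM0 : 0 ≤ M) (hM : ∀ x, f x ≤ M)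
    (hfi : Integrable f μ) : ∫ x, f x ∂μ ≤ ∫ x, f x ∂μ.tilted f := by
  have : MonotoneOn (fun t => ∫ x, f x ∂μ.tilted fun x => t * f x) (Set.Icc 0 1) := by
    refine monotoneOn_of_deriv_nonneg (convex_Icc 0 1)
      (continuousOn_integral_tilted_mul hf hM0 hM hfi 1) ?_ ?_
    · rw [interior_Icc]
      exact fun t ht => (hasDerivAt_integral_tilted_mul hf hM0 hM hfi
        ht.1).differentiableAt.differentiableWithinAt
    · rw [interior_Icc]
      intro t ht
      rw [(hasDerivAt_integral_tilted_mul hf hM0 hM hfi ht.1).deriv]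
      have : IsProbabilityMeasure (μ.tilted fun x => t * f x) :=
        isProbabilityMeasure_tilted (integrable_exp_mul hf hM0 hM ht.1.le)
      rw [← (integral_sub_integral_sq (integrable_tilted_mul hf hM0 hM hfi ht.1.le)
        (integrable_tilted_mul_mul hf hM0 hM hfi ht.1)).2]
      exact integral_nonneg fun x => sq_nonneg _
  have h := this (Set.left_mem_Icc.2 zero_le_one) (Set.right_mem_Icc.2 zero_le_one) zero_le_one
  simp only [zero_mul, one_mul] at h
  have e : μ.tilted (fun _ => (0 : ℝ)) = μ := by simp
  rwa [e] at h

end TiltCov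

section DensityCov

variable {g : EuclideanSpace ℝ (Fin n) → ℝ}

theorem integrable_densityMeasure_coord (hg : IsDensity g) (hgm : Measurable g)
    (h2 : Integrable fun x => g x * ‖x‖ ^ 2) (i : Fin n) :
    Integrable (fun x => x i) (densityMeasure g) := by
  rw [integrable_densityMeasure_iff hgm hg.1]
  refine (integrable_smul_self hg hgm h2).norm.mono' (by fun_prop) (ae_of_all _ fun x => ?_)
  rw [norm_smul, norm_smul]
  exact mul_le_mul_of_nonneg_left (PiLp.norm_apply_le x i) (norm_nonneg _)

theorem integrable_densityMeasure_coord_mul (hg : IsDensity g) (hgm : Measurable g)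
    (h2 : Integrable fun x => g x * ‖x‖ ^ 2) (i j : Fin n) :
    Integrable (fun x => x i * x j) (densityMeasure g) := by
  rw [integrable_densityMeasure_iff hgm hg.1]
  simpa using integrable_mul_sub_mul_sub hg hgm h2 0 i j

theorem densityMean_apply (hg : IsDensity g) (hgm : Measurable g)
    (h2 : Integrable fun x => g x * ‖x‖ ^ 2) (i : Fin n) :
    densityMean g i = ∫ x, x i ∂densityMeasure g := by
  rw [integral_densityMeasure hgm hg.1, densityMean]
  exact ((EuclideanSpace.proj i : EuclideanSpace ℝ (Fin n) →L[ℝ] ℝ).integral_comp_comm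
    (integrable_smul_self hg hgm h2)).symm

theorem densityCov_apply (hg : IsDensity g) (hgm : Measurable g)
    (h2 : Integrable fun x => g x * ‖x‖ ^ 2) (i j : Fin n) :
    densityCov g i j = (∫ x, x i * x j ∂densityMeasure g) -
      (∫ x, x i ∂densityMeasure g) * ∫ x, x j ∂densityMeasure g := by
  have := hg.isProbabilityMeasure
  have hi := integrable_densityMeasure_coord hg hgm h2
  have hij := integrable_densityMeasure_coord_mul hg hgm h2 i j
  have e : densityCov g i j =
      ∫ x, (x i - densityMean g i) * (x j - densityMean g j) ∂densityMeasure g := by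
    rw [integral_densityMeasure hgm hg.1]; rfl
  rw [e, densityMean_apply hg hgm h2, densityMean_apply hg hgm h2]
  set a := ∫ x, x i ∂densityMeasure g with ha
  set b := ∫ x, x j ∂densityMeasure g with hb
  have e2 : (fun x : EuclideanSpace ℝ (Fin n) => (x i - a) * (x j - b)) =
      fun x => (x i * x j - b * x i) - a * (x j - b) := by funext x; ring
  have i1 : Integrable (fun x : EuclideanSpace ℝ (Fin n) => x i * x j - b * x i)
    (densityMeasure g) := hij.sub ((hi i).const_mul b)
  have i2 : Integrable (fun x : EuclideanSpace ℝ (Fin n) => x j - b)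
    (densityMeasure g) := (hi j).sub (integrable_const b)
  rw [e2, integral_sub i1 (i2.const_mul a), integral_sub hij ((hi i).const_mul b),
    integral_const_mul, integral_const_mul, integral_sub (hi j) (integrable_const b), ← ha, ← hb]
  simp
  ring

theorem volume_sum_mul_sub_eq_zero {v : Fin n → ℝ} (hv : v ≠ 0) (a : EuclideanSpace ℝ (Fin n)) :
    volume {x : EuclideanSpace ℝ (Fin n) | ∑ i, v i * (x i - a i) = 0} = 0 := by
  let φ : EuclideanSpace ℝ (Fin n) →ₗ[ℝ] ℝ := (innerSL ℝ (WithLp.toLp 2 v)).toLinearMap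
  have hφ : ∀ x, φ x = ∑ i, v i * x i := fun x => by
    simp [φ, PiLp.inner_apply, mul_comm]
  have h := Measure.addHaar_affineSubspace (volume : Measure (EuclideanSpace ℝ (Fin n)))
    (AffineSubspace.mk' a (LinearMap.ker φ)) (fun htop => hv ?_)
  · refine measure_mono_null (fun x hx => ?_) h
    have : φ (x - a) = 0 := by rw [hφ]; exact hx
    exact this
  · have h1 : a + WithLp.toLp 2 v ∈ AffineSubspace.mk' a (LinearMap.ker φ) := by
      rw [htop]; trivial
    have h2 : φ (a + WithLp.toLp 2 v - a) = 0 := h1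
    rw [hφ] at h2
    simp only [add_sub_cancel_left] at h2
    funext i
    exact mul_self_eq_zero.1 ((Finset.sum_eq_zero_iff_of_nonneg
      (fun i _ => mul_self_nonneg (v i))).1 h2 i (Finset.mem_univ i))

theorem densityCov_posDef (hg : IsDensity g) (hgm : Measurable g)
    (h2 : Integrable fun x => g x * ‖x‖ ^ 2) : (densityCov g).PosDef := by
  refine Matrix.PosDef.of_dotProduct_mulVec_pos ?_ fun v hv => ?_
  · ext i j
    simp [densityCov, mul_comm]
  set a := densityMean g
  have hi : ∀ i j, Integrable fun x => v i * v j * (g x * ((x i - a i) * (x j - a j))) :=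
    fun i j => (integrable_mul_sub_mul_sub hg hgm h2 a i j).const_mul _
  have e : ∀ x : EuclideanSpace ℝ (Fin n), g x * (∑ i, v i * (x i - a i)) ^ 2 =
      ∑ i, ∑ j, v i * v j * (g x * ((x i - a i) * (x j - a j))) := by
    intro x
    rw [sq, Finset.sum_mul_sum, Finset.mul_sum]
    refine Finset.sum_congr rfl fun i _ => ?_
    rw [Finset.mul_sum]
    exact Finset.sum_congr rfl fun j _ => by ring
  have hint : Integrable fun x => g x * (∑ i, v i * (x i - a i)) ^ 2 := by
    simp only [e]
    exact integrable_finsetSum _ fun i _ => integrable_finsetSum _ fun j _ => hi i j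
  have hval : star v ⬝ᵥ (densityCov g).mulVec v =
      ∫ x, g x * (∑ i, v i * (x i - a i)) ^ 2 := by
    simp only [e]
    rw [integral_finsetSum _ fun i _ => integrable_finsetSum _ fun j _ => hi i j]
    simp only [dotProduct, Matrix.mulVec, Finset.mul_sum]
    refine Finset.sum_congr rfl fun i _ => ?_
    rw [integral_finsetSum _ fun j _ => hi i j]
    refine Finset.sum_congr rfl fun j _ => ?_
    rw [integral_const_mul]
    simp only [densityCov, Matrix.of_apply, Pi.star_apply, star_trivial]
    ring
  have hnn : ∀ x : EuclideanSpace ℝ (Fin n), 0 ≤ g x * (∑ i, v i * (x i - a i)) ^ 2 :=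
    fun x => mul_nonneg (hg.1 x) (sq_nonneg _)
  rw [hval]
  refine lt_of_le_of_ne (integral_nonneg hnn) fun h0 => ?_
  have hz := (integral_eq_zero_iff_of_nonneg hnn hint).1 h0.symm
  have hne : ∀ᵐ x : EuclideanSpace ℝ (Fin n), ∑ i, v i * (x i - a i) ≠ 0 := by
    rw [ae_iff]
    simpa using volume_sum_mul_sub_eq_zero hv a
  have hg0 : g =ᵐ[volume] 0 := by
    filter_upwards [hz, hne] with x h1 h3
    simpa [h3] using h1
  have := hg.2.2
  rw [integral_congr_ae hg0] at this
  simp at this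

end DensityCov

section TiltDensity

/-- The density of the exponential tilt by `F` of the measure with density `p`. -/
def tiltDensity (p F : EuclideanSpace ℝ (Fin n) → ℝ) (x : EuclideanSpace ℝ (Fin n)) : ℝ :=
  p x * (rexp (F x) / ∫ y, rexp (F y) ∂densityMeasure p)

variable {p F : EuclideanSpace ℝ (Fin n) → ℝ} {M : ℝ}

theorem measurable_tiltDensity (hpm : Measurable p) (hF : Measurable F) :
    Measurable (tiltDensity p F) := by
  unfold tiltDensity; fun_prop

theorem densityMeasure_tiltDensity (hp0 : ∀ x, 0 ≤ p x) (hpm : Measurable p) (hF : Measurable F) :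
    densityMeasure (tiltDensity p F) = (densityMeasure p).tilted F := by
  unfold Measure.tilted
  conv_rhs => rw [densityMeasure, ← withDensity_mul _ (by fun_prop) (by fun_prop)]
  rw [densityMeasure]
  congr 1
  funext x
  simp only [Pi.mul_apply, tiltDensity]
  rw [ENNReal.ofReal_mul (hp0 x)]
  rfl

theorem integrable_exp_densityMeasure (hp : IsDensity p) (hF : Measurable F) (hM : ∀ x, F x ≤ M) :
    Integrable (fun x => rexp (F x)) (densityMeasure p) := by
  have := hp.isProbabilityMeasure
  simpa using integrable_exp_mul (μ := densityMeasure p) hF (le_max_right M 0)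
    (fun x => (hM x).trans (le_max_left M 0)) zero_le_one

theorem integral_exp_densityMeasure_pos (hp : IsDensity p) (hF : Measurable F)
    (hM : ∀ x, F x ≤ M) : 0 < ∫ x, rexp (F x) ∂densityMeasure p := by
  have := hp.isProbabilityMeasure
  exact integral_exp_pos (integrable_exp_densityMeasure hp hF hM)

theorem integrable_tiltDensity_mul_norm_sq (hp : IsDensity p) (hF : Measurable F)
    (hM : ∀ x, F x ≤ M) (h2 : Integrable fun x => p x * ‖x‖ ^ 2) :
    Integrable fun x => tiltDensity p F x * ‖x‖ ^ 2 := by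
  set Z := ∫ y, rexp (F y) ∂densityMeasure p with hZ
  have hb : Integrable fun x => (rexp (F x) / Z) * (p x * ‖x‖ ^ 2) := by
    refine h2.bdd_mul (c := rexp M / Z) (by fun_prop) (ae_of_all _ fun x => ?_)
    have : 0 < Z := integral_exp_densityMeasure_pos hp hF hM
    rw [Real.norm_of_nonneg (by positivity)]
    gcongr
    exact hM x
  exact hb.congr (ae_of_all _ fun x => by simp only [tiltDensity, ← hZ]; ring)

theorem isDensity_tiltDensity (hp : IsDensity p) (hpm : Measurable p) (hF : Measurable F)
    (hM : ∀ x, F x ≤ M) : IsDensity (tiltDensity p F) := by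
  have hZ := integral_exp_densityMeasure_pos hp hF hM
  have := hp.isProbabilityMeasure
  have hprob : IsProbabilityMeasure ((densityMeasure p).tilted F) :=
    isProbabilityMeasure_tilted (integrable_exp_densityMeasure hp hF hM)
  have h0 : ∀ x, 0 ≤ tiltDensity p F x := fun x =>
    mul_nonneg (hp.1 x) (div_nonneg (Real.exp_pos _).le hZ.le)
  have hm := measurable_tiltDensity hpm hF
  rw [← densityMeasure_tiltDensity hp.1 hpm hF] at hprob
  refine ⟨h0, ?_, ?_⟩
  · simpa using (integrable_densityMeasure_iff hm h0).1 (integrable_const (1 : ℝ))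
  · simpa using (integral_densityMeasure hm h0 fun _ => (1 : ℝ)).symm

theorem IsLogConcave.tiltDensity (hp : IsDensity p) (hlc : IsLogConcave p) (hF : Measurable F)
    (hM : ∀ x, F x ≤ M) (hFc : ConcaveOn ℝ Set.univ F) : IsLogConcave (tiltDensity p F) := by
  have hZ := integral_exp_densityMeasure_pos hp hF hM
  intro x y l h0 h1
  unfold _root_.tiltDensity
  set Z := ∫ y, rexp (F y) ∂densityMeasure p
  have hE : ∀ x, 0 ≤ rexp (F x) / Z := fun x => div_nonneg (Real.exp_pos _).le hZ.le
  have hc := hFc.2 (Set.mem_univ x) (Set.mem_univ y) h0 (sub_nonneg.2 h1) (by ring)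
  rw [Real.mul_rpow (hp.1 x) (hE x), Real.mul_rpow (hp.1 y) (hE y)]
  have e : (rexp (F x) / Z) ^ l * (rexp (F y) / Z) ^ (1 - l) ≤
      rexp (F (l • x + (1 - l) • y)) / Z := by
    rw [Real.div_rpow (Real.exp_pos _).le hZ.le, Real.div_rpow (Real.exp_pos _).le hZ.le,
      div_mul_div_comm, ← Real.rpow_add hZ, ← Real.exp_mul, ← Real.exp_mul, ← Real.exp_add]
    simp only [add_sub_cancel, Real.rpow_one]
    gcongr
    simp only [smul_eq_mul] at hc
    linarith
  calc _ = (p x ^ l * p y ^ (1 - l)) * ((rexp (F x) / Z) ^ l * (rexp (F y) / Z) ^ (1 - l)) := by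
        ring
    _ ≤ _ := mul_le_mul (hlc x y l h0 h1) e
        (mul_nonneg (Real.rpow_nonneg (hE _) _) (Real.rpow_nonneg (hE _) _)) (hp.1 _)

end TiltDensity

section GaussTilt

/-- The exponent of the Gaussian tilts. -/
def gaussTilt (s : ℝ) (ξ x : EuclideanSpace ℝ (Fin n)) : ℝ := inner ℝ ξ x - s / 2 * ‖x‖ ^ 2

theorem continuous_gaussTilt (s : ℝ) (ξ : EuclideanSpace ℝ (Fin n)) :
    Continuous (gaussTilt s ξ) := by
  unfold gaussTilt; fun_prop

theorem gaussTilt_le {s : ℝ} (hs : 0 < s) (ξ x : EuclideanSpace ℝ (Fin n)) :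
    gaussTilt s ξ x ≤ ‖ξ‖ ^ 2 / (2 * s) := by
  have h := real_inner_le_norm ξ x
  rw [gaussTilt, le_div_iff₀ (by positivity)]
  nlinarith [sq_nonneg (‖ξ‖ - s * ‖x‖)]

theorem concaveOn_gaussTilt {s : ℝ} (hs : 0 < s) (ξ : EuclideanSpace ℝ (Fin n)) :
    ConcaveOn ℝ Set.univ (gaussTilt s ξ) := by
  refine ⟨convex_univ, fun x _ y _ a b ha hb hab => ?_⟩
  have h : ‖a • x + b • y‖ ^ 2 ≤ a * ‖x‖ ^ 2 + b * ‖y‖ ^ 2 := by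
    have h1 := ((convexOn_norm convex_univ).pow (fun _ _ => norm_nonneg _) 2).2
      (Set.mem_univ x) (Set.mem_univ y) ha hb hab
    simpa using h1
  simp only [gaussTilt, smul_eq_mul, inner_add_right, inner_smul_right]
  nlinarith

variable {p : EuclideanSpace ℝ (Fin n) → ℝ} {s : ℝ}

/-- Lower bound for the determinant of the covariance along the Gaussian tilts. -/
theorem neg_le_log_det_densityCov_tiltDensity (hn : 1 ≤ n) (hp : IsDensity p) (hpm : Measurable p)
    (hlc : IsLogConcave p) (hi : IsIsotropic p) (hs : 0 < s) (ξ : EuclideanSpace ℝ (Fin n))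
    {σ κ : ℝ} (hσ : sigmaSup n ≤ σ) (hκ : 0 < κ) :
    -(1 / 2 * (κ * (momentConst * n * σ ^ 2) +
      ((∫ x, gaussTilt s ξ x ∂densityMeasure (tiltDensity p (gaussTilt s ξ))) -
        ∫ x, gaussTilt s ξ x ∂densityMeasure p) / κ)) ≤
      Real.log (densityCov (tiltDensity p (gaussTilt s ξ))).det := by
  have hprob := hp.isProbabilityMeasure
  have h2 := hi.integrable_mul_norm_sq
  set f := gaussTilt s ξ with hf
  set M := ‖ξ‖ ^ 2 / (2 * s)
  have hM0 : 0 ≤ M := by positivity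
  have hM : ∀ x, f x ≤ M := gaussTilt_le hs ξ
  have hfm : Measurable f := (continuous_gaussTilt s ξ).measurable
  have htm : ∀ t : ℝ, Measurable fun x => t * f x := fun t => hfm.const_mul t
  have htM : ∀ t : ℝ, 0 ≤ t → ∀ x, t * f x ≤ t * M := fun t ht x =>
    mul_le_mul_of_nonneg_left (hM x) ht
  have hgd := fun (t : ℝ) (ht : 0 ≤ t) => isDensity_tiltDensity hp hpm (htm t) (htM t ht)
  have hgm := fun (t : ℝ) => measurable_tiltDensity hpm (htm t)
  have hg2 := fun (t : ℝ) (ht : 0 ≤ t) => integrable_tiltDensity_mul_norm_sq hp (htm t) (htM t ht) h2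
  have hν := fun (t : ℝ) => densityMeasure_tiltDensity hp.1 hpm (htm t)
  set X : Fin n → EuclideanSpace ℝ (Fin n) → ℝ := fun i x => x i with hX
  have hcov : ∀ t : ℝ, 0 ≤ t → tiltCov (densityMeasure p) f X t =
      densityCov (tiltDensity p fun x => t * f x) := fun t ht => by
    ext i j
    rw [densityCov_apply (hgd t ht) (hgm t) (hg2 t ht), hν]
    rfl
  have hmah : ∀ t : ℝ, 0 ≤ t → tiltMahalanobisSq (densityMeasure p) f X t =
      mahalanobisSq (tiltDensity p fun x => t * f x) := fun t ht => by
    funext x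
    rw [tiltMahalanobisSq, hcov t ht]
    simp only [mahalanobisSq,
      densityMean_apply (hgd t ht) (hgm t) (hg2 t ht), hν, hX]
  have hpd := fun (t : ℝ) (ht : 0 ≤ t) => densityCov_posDef (hgd t ht) (hgm t) (hg2 t ht)
  have hXi := integrable_densityMeasure_coord hp hpm h2
  have hXX := integrable_densityMeasure_coord_mul hp hpm h2
  have hfi : Integrable f (densityMeasure p) := by
    have h3 : Integrable (fun x => ‖x‖ ^ 2) (densityMeasure p) :=
      (integrable_densityMeasure_iff hpm hp.1).2 h2
    have h4 : Integrable (fun x => x) (densityMeasure p) :=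
      (integrable_densityMeasure_iff hpm hp.1).2 (integrable_smul_self hp hpm h2)
    exact (h4.const_inner ξ).sub (h3.const_mul (s / 2))
  have h0 : tiltCov (densityMeasure p) f X 0 = 1 := by
    ext i j
    have e : (densityMeasure p).tilted (fun _ => (0 : ℝ)) = densityMeasure p := by simp
    have hmean : densityMean p = 0 := hi.1
    have hz : ∀ i, ∫ x, x i ∂densityMeasure p = 0 := fun i => by
      rw [← densityMean_apply hp hpm h2, hmean]; rfl
    simp only [tiltCov, Matrix.of_apply, zero_mul, hX, e, hz]
    rw [integral_densityMeasure hpm hp.1, Matrix.one_apply]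
    simpa using hi.2 i j
  have h := neg_le_log_det_tiltCov (N := n) (K := momentConst * n * σ ^ 2) hfm hM0 hM hfi hXi hXX
    (fun t ht => by rw [hcov t ht.1]; exact (hpd t ht.1).det_pos) h0 hκ (fun t ht => ?_)
  · have e1 : (fun x => 1 * f x) = f := by simp
    rw [hcov 1 zero_le_one, e1] at h
    rwa [densityMeasure_tiltDensity hp.1 hpm hfm]
  · have hFc : ConcaveOn ℝ Set.univ fun x => t * f x := by
      simpa using (concaveOn_gaussTilt hs ξ).smul ht.1.le
    have hb := lintegral_mahalanobisSq_sub_sq_le hn (hgd t ht.1.le) (hgm t)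
      (hlc.tiltDensity hp (htm t) (htM t ht.1.le) hFc) (hg2 t ht.1.le) (hpd t ht.1.le)
    rw [hmah t ht.1.le, ← hν]
    have hmm : Measurable (mahalanobisSq (tiltDensity p fun x => t * f x)) := by
      unfold mahalanobisSq
      fun_prop
    have hnn : 0 ≤ᵐ[densityMeasure (tiltDensity p fun x => t * f x)]
      fun x => (mahalanobisSq (tiltDensity p fun x => t * f x) x - n) ^ 2 :=
        ae_of_all _ fun x => sq_nonneg _
    refine ⟨⟨by fun_prop, ?_⟩, ?_⟩
    · rw [hasFiniteIntegral_iff_ofReal hnn]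
      exact hb.trans_lt ENNReal.ofReal_lt_top
    · rw [integral_eq_lintegral_of_nonneg_ae hnn (by fun_prop)]
      have h5 := ENNReal.toReal_mono ENNReal.ofReal_ne_top hb
      have := momentConst_pos
      rw [ENNReal.toReal_ofReal (by positivity)] at h5
      refine h5.trans ?_
      have := sigmaSup_nonneg n
      gcongr

end GaussTilt

/-- The mean of a random vector lying in an open convex set lies in this set. -/
theorem Convex.integral_mem_of_isOpen {Ω E : Type*} [MeasurableSpace Ω] {μ : Measure Ω}
    [IsProbabilityMeasure μ] [NormedAddCommGroup E] [NormedSpace ℝ E] [CompleteSpace E] {O : Set E}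
    (hc : Convex ℝ O) (ho : IsOpen O) {X : Ω → E} (hX : Integrable X μ)
    (hXO : ∀ᵐ x ∂μ, X x ∈ O) : ∫ x, X x ∂μ ∈ O := by
  by_contra h
  obtain ⟨φ, hφ⟩ := geometric_hahn_banach_open_point hc ho h
  have hi : Integrable (fun x => φ (∫ x, X x ∂μ) - φ (X x)) μ :=
    (integrable_const _).sub (φ.integrable_comp hX)
  have hpos : ∀ᵐ x ∂μ, 0 < φ (∫ x, X x ∂μ) - φ (X x) := by
    filter_upwards [hXO] with x hx
    exact sub_pos.2 (hφ _ hx)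
  have hz : ∫ x, (φ (∫ x, X x ∂μ) - φ (X x)) ∂μ = 0 := by
    rw [integral_sub (integrable_const _) (φ.integrable_comp hX), φ.integral_comp_comm hX]
    simp
  have h0 := (integral_eq_zero_iff_of_nonneg_ae (hpos.mono fun x hx => hx.le) hi).1 hz
  obtain ⟨x, hx1, hx2⟩ := (h0.and hpos).exists
  exact hx2.ne' hx1

section Support

variable {p : EuclideanSpace ℝ (Fin n) → ℝ}

theorem IsLogConcave.convex_setOf_pos (hlc : IsLogConcave p) : Convex ℝ {x | 0 < p x} := by
  intro x hx y hy a b ha hb hab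
  obtain rfl : b = 1 - a := by linarith
  exact (mul_pos (Real.rpow_pos_of_pos hx _) (Real.rpow_pos_of_pos hy _)).trans_le
    (hlc x y a ha (by linarith))

theorem IsLogConcave.continuousOn_interior (hlc : IsLogConcave p) :
    ContinuousOn p (interior {x | 0 < p x}) := by
  have hc : ConcaveOn ℝ {x | 0 < p x} fun x => Real.log (p x) := by
    refine ⟨hlc.convex_setOf_pos, fun x hx y hy a b ha hb hab => ?_⟩
    obtain rfl : b = 1 - a := by linarith
    have hx' : 0 < p x := hx
    have hy' : 0 < p y := hy
    have h := Real.log_le_log (mul_pos (Real.rpow_pos_of_pos hx' _) (Real.rpow_pos_of_pos hy' _))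
      (hlc x y a ha (by linarith))
    rwa [Real.log_mul (Real.rpow_pos_of_pos hx' _).ne' (Real.rpow_pos_of_pos hy' _).ne',
      Real.log_rpow hx', Real.log_rpow hy'] at h
  refine hc.continuousOn_interior.rexp.congr fun x hx => ?_
  have hx' : x ∈ {x | 0 < p x} := interior_subset hx
  exact (Real.exp_log hx').symm

theorem IsLogConcave.indicator_interior (hp0 : ∀ x, 0 ≤ p x) (hlc : IsLogConcave p) :
    IsLogConcave ((interior {x | 0 < p x}).indicator p) := by
  classical
  intro x y l h0 h1
  set O := interior {x | 0 < p x}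
  have hO : Convex ℝ O := hlc.convex_setOf_pos.interior
  have hnn : ∀ z, 0 ≤ O.indicator p z := fun z => Set.indicator_nonneg (fun z _ => hp0 z) z
  rcases h0.eq_or_lt with rfl | h0
  · simp
  rcases h1.eq_or_lt with rfl | h1
  · simp
  by_cases hx : x ∈ O
  · by_cases hy : y ∈ O
    · rw [Set.indicator_of_mem hx, Set.indicator_of_mem hy, Set.indicator_of_mem
        (hO hx hy h0.le (sub_pos.2 h1).le (by ring))]
      exact hlc x y l h0.le h1.le
    · rw [Set.indicator_of_notMem hy, Real.zero_rpow (sub_pos.2 h1).ne', mul_zero]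
      exact hnn _
  · rw [Set.indicator_of_notMem hx, Real.zero_rpow h0.ne', zero_mul]
    exact hnn _

theorem IsLogConcave.measurable_indicator_interior (hlc : IsLogConcave p) :
    Measurable ((interior {x | 0 < p x}).indicator p) := by
  classical
  rw [← Set.piecewise_eq_indicator]
  exact hlc.continuousOn_interior.measurable_piecewise continuousOn_const
    isOpen_interior.measurableSet

theorem IsLogConcave.indicator_interior_ae_eq (hp0 : ∀ x, 0 ≤ p x) (hlc : IsLogConcave p) :
    (interior {x | 0 < p x}).indicator p =ᵐ[volume] p := by
  have h := hlc.convex_setOf_pos.addHaar_frontier (volume : Measure (EuclideanSpace ℝ (Fin n)))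
  have h' : ∀ᵐ x, x ∉ frontier {x | 0 < p x} := by rw [ae_iff]; simpa using h
  filter_upwards [h'] with x hx
  by_cases hxi : x ∈ interior {x | 0 < p x}
  · rw [Set.indicator_of_mem hxi]
  · rw [Set.indicator_of_notMem hxi]
    by_contra hne
    exact hx ⟨subset_closure ((hp0 x).lt_of_ne hne), hxi⟩

theorem setOf_indicator_interior_pos :
    {x | 0 < (interior {x | 0 < p x}).indicator p x} = interior {x | 0 < p x} := by
  ext x
  by_cases hxi : x ∈ interior {x | 0 < p x}
  · simp only [Set.mem_ofPred_eq, Set.indicator_of_mem hxi, hxi, iff_true]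
    have hx' : x ∈ {x | 0 < p x} := interior_subset hxi
    exact hx'
  · simp [hxi]

theorem ae_densityMeasure_pos (hpm : Measurable p) :
    ∀ᵐ x ∂densityMeasure p, 0 < p x := by
  rw [densityMeasure, ae_withDensity_iff (by fun_prop)]
  refine ae_of_all _ fun x hx => ?_
  by_contra h
  exact hx (ENNReal.ofReal_of_nonpos (not_lt.1 h))

/-- An isotropic log-concave density may be assumed measurable with open support. -/
theorem IsIsotropic.exists_regularization (hp : IsDensity p) (hlc : IsLogConcave p)
    (hi : IsIsotropic p) : ∃ q : EuclideanSpace ℝ (Fin n) → ℝ, IsDensity q ∧ IsLogConcave q ∧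
      IsIsotropic q ∧ Measurable q ∧ IsOpen {x | 0 < q x} ∧ 0 < q 0 ∧ q 0 = p 0 := by
  set O := interior {x | 0 < p x} with hO
  set q := O.indicator p with hq
  have hae : q =ᵐ[volume] p := hlc.indicator_interior_ae_eq hp.1
  have hqm : Measurable q := hlc.measurable_indicator_interior
  have hqd : IsDensity q := ⟨fun z => Set.indicator_nonneg (fun z _ => hp.1 z) z,
    hp.2.1.congr hae.symm, by rw [integral_congr_ae hae, hp.2.2]⟩
  have hqi : IsIsotropic q := by
    refine ⟨?_, fun i j => ?_⟩
    · rw [← hi.1]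
      exact integral_congr_ae (hae.mono fun x hx => by simp only [hx])
    · rw [← hi.2 i j]
      exact integral_congr_ae (hae.mono fun x hx => by simp only [hx])
  have := hqd.isProbabilityMeasure
  have hsupp : {x | 0 < q x} = O := setOf_indicator_interior_pos
  have h0 : (0 : EuclideanSpace ℝ (Fin n)) ∈ O := by
    have h1 : ∫ x, x ∂densityMeasure q = 0 := by
      rw [integral_densityMeasure hqm hqd.1, hqi.1]
    rw [← h1]
    refine hlc.convex_setOf_pos.interior.integral_mem_of_isOpen isOpen_interior
      ((integrable_densityMeasure_iff hqm hqd.1).2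
        (integrable_smul_self hqd hqm hqi.integrable_mul_norm_sq)) ?_
    filter_upwards [ae_densityMeasure_pos hqm] with x hx
    have hx' : x ∈ {x | 0 < q x} := hx
    rwa [hsupp] at hx'
  refine ⟨q, hqd, hlc.indicator_interior hp.1, hqi, hqm, hsupp ▸ isOpen_interior, ?_,
    Set.indicator_of_mem h0 p⟩
  have h0' : (0 : EuclideanSpace ℝ (Fin n)) ∈ {x | 0 < q x} := by rwa [hsupp]
  exact h0'

end Support

section Jensen

variable {p F : EuclideanSpace ℝ (Fin n) → ℝ} {M : ℝ}

theorem IsLogConcave.convexOn_inv_sqrt (hlc : IsLogConcave p) :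
    ConvexOn ℝ {x | 0 < p x} fun x => (√(p x))⁻¹ := by
  refine ⟨hlc.convex_setOf_pos, fun x hx y hy a b ha hb hab => ?_⟩
  obtain rfl : b = 1 - a := by linarith
  have hx' : 0 < p x := hx
  have hy' : 0 < p y := hy
  have hx2 : 0 < √(p x) := Real.sqrt_pos.2 hx'
  have hy2 : 0 < √(p y) := Real.sqrt_pos.2 hy'
  have h := Real.sqrt_le_sqrt (hlc x y a ha (by linarith))
  have e : √(p x ^ a * p y ^ (1 - a)) = √(p x) ^ a * √(p y) ^ (1 - a) := by
    rw [Real.sqrt_mul (Real.rpow_nonneg hx'.le _)]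
    simp only [Real.sqrt_eq_rpow, ← Real.rpow_mul hx'.le, ← Real.rpow_mul hy'.le, mul_comm]
  rw [e] at h
  have hgm := Real.geom_mean_le_arith_mean2_weighted ha hb (inv_pos.2 hx2).le (inv_pos.2 hy2).le hab
  rw [Real.inv_rpow hx2.le, Real.inv_rpow hy2.le, ← mul_inv] at hgm
  exact (inv_anti₀ (mul_pos (Real.rpow_pos_of_pos hx2 _) (Real.rpow_pos_of_pos hy2 _)) h).trans hgm

theorem inv_sqrt_integral_le {Ω : Type*} [MeasurableSpace Ω] {ν : Measure Ω}
    [IsProbabilityMeasure ν] (hlc : IsLogConcave p) (ho : IsOpen {x | 0 < p x})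
    {X : Ω → EuclideanSpace ℝ (Fin n)} (hX : Integrable X ν) (hXp : ∀ᵐ x ∂ν, 0 < p (X x))
    (hψ : Integrable (fun x => (√(p (X x)))⁻¹) ν) :
    0 < p (∫ x, X x ∂ν) ∧ (√(p (∫ x, X x ∂ν)))⁻¹ ≤ ∫ x, (√(p (X x)))⁻¹ ∂ν := by
  refine ⟨hlc.convex_setOf_pos.integral_mem_of_isOpen ho hX hXp, ?_⟩
  have hcont : ContinuousOn (fun x => (√(p x))⁻¹) {x | 0 < p x} := by
    have h := hlc.continuousOn_interior
    rw [ho.interior_eq] at h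
    exact h.sqrt.inv₀ fun x hx => (Real.sqrt_pos.2 hx).ne'
  refine le_of_forall_pos_lt_add fun δ hδ => ?_
  set O : Set (EuclideanSpace ℝ (Fin n) × ℝ) := {z | z.1 ∈ {x | 0 < p x} ∧ (√(p z.1))⁻¹ < z.2}
  have hOc : Convex ℝ O := hlc.convexOn_inv_sqrt.convex_strict_epigraph
  have hOo : IsOpen O := by
    have h1 : ContinuousOn (fun z : EuclideanSpace ℝ (Fin n) × ℝ => z.2 - (√(p z.1))⁻¹)
        (Prod.fst ⁻¹' {x | 0 < p x}) :=
      continuous_snd.continuousOn.sub (hcont.comp continuous_fst.continuousOn fun z hz => hz)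
    have h2 := h1.isOpen_inter_preimage (ho.preimage continuous_fst) isOpen_Ioi (t := Set.Ioi 0)
    convert h2 using 1
    ext z
    simp [O]
  have hψδ : Integrable (fun x => (√(p (X x)))⁻¹ + δ) ν := hψ.add (integrable_const δ)
  have hint : Integrable (fun x => (X x, (√(p (X x)))⁻¹ + δ)) ν :=
    hX.prodMk hψδ
  have h := hOc.integral_mem_of_isOpen hOo hint (by
    filter_upwards [hXp] with x hx
    exact ⟨hx, by simpa using hδ⟩)
  have h2 := h.2
  rw [integral_pair hX hψδ, integral_add hψ (integrable_const δ)] at h2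
  simpa using h2

theorem sqrt_le_of_isLogConcave (hp0 : ∀ x, 0 ≤ p x) (hlc : IsLogConcave p) (h0 : 0 < p 0)
    (x : EuclideanSpace ℝ (Fin n)) : √(p x) ≤ p ((1 / 2 : ℝ) • x) / √(p 0) := by
  have h := hlc.mul_le_sq hp0 x 0
  rw [add_zero] at h
  rw [le_div_iff₀ (Real.sqrt_pos.2 h0), ← Real.sqrt_mul (hp0 x)]
  exact Real.sqrt_le_iff.2 ⟨hp0 _, h⟩

theorem integrable_sqrt_and_integral_le (hp : IsDensity p) (hpm : Measurable p)
    (hlc : IsLogConcave p) (h0 : 0 < p 0) :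
    Integrable (fun x => √(p x)) ∧ ∫ x, √(p x) ≤ 2 ^ n / √(p 0) := by
  have hi : Integrable fun x => p ((1 / 2 : ℝ) • x) / √(p 0) :=
    (hp.2.1.comp_smul (by norm_num)).div_const _
  have hle := sqrt_le_of_isLogConcave hp.1 hlc h0
  have hs : Integrable fun x => √(p x) := hi.mono' (by fun_prop) (ae_of_all _ fun x => by
    rw [Real.norm_of_nonneg (Real.sqrt_nonneg _)]; exact hle x)
  refine ⟨hs, (integral_mono hs hi hle).trans_eq ?_⟩
  rw [integral_div, Measure.integral_comp_smul, hp.2.2]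
  simp [finrank_euclideanSpace]

theorem inv_sqrt_densityMean_tiltDensity_le (hp : IsDensity p) (hpm : Measurable p)
    (hlc : IsLogConcave p) (h2 : Integrable fun x => p x * ‖x‖ ^ 2) (ho : IsOpen {x | 0 < p x})
    (h0 : 0 < p 0) (hF : Measurable F) (hM : ∀ x, F x ≤ M) :
    0 < p (densityMean (tiltDensity p F)) ∧
    (√(p (densityMean (tiltDensity p F))))⁻¹ ≤
      (∫ x, √(p x) * rexp (F x)) / ∫ x, rexp (F x) ∂densityMeasure p := by
  set Z := ∫ x, rexp (F x) ∂densityMeasure p with hZ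
  have hZ0 : 0 < Z := integral_exp_densityMeasure_pos hp hF hM
  set g := tiltDensity p F with hg
  have hgd : IsDensity g := isDensity_tiltDensity hp hpm hF hM
  have hgm : Measurable g := measurable_tiltDensity hpm hF
  have hg2 := integrable_tiltDensity_mul_norm_sq hp hF hM h2
  have := hgd.isProbabilityMeasure
  have e : ∀ x, g x • (√(p x))⁻¹ = rexp (F x) * √(p x) / Z := by
    intro x
    rw [hg, tiltDensity, smul_eq_mul, ← hZ]
    rcases (hp.1 x).eq_or_lt with h | h
    · simp [← h]
    · have h3 : 0 < √(p x) := Real.sqrt_pos.2 h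
      have h4 : p x = √(p x) * √(p x) := (Real.mul_self_sqrt h.le).symm
      rw [h4, Real.sqrt_mul_self h3.le]
      field_simp
  have hI : Integrable fun x => rexp (F x) * √(p x) := by
    refine (integrable_sqrt_and_integral_le hp hpm hlc h0).1.bdd_mul (c := rexp M) (by fun_prop)
      (ae_of_all _ fun x => ?_)
    rw [Real.norm_of_nonneg (Real.exp_pos _).le]
    exact Real.exp_le_exp.2 (hM x)
  have h := inv_sqrt_integral_le (ν := densityMeasure g) (X := fun x => x) hlc ho
    ((integrable_densityMeasure_iff hgm hgd.1).2 (integrable_smul_self hgd hgm hg2))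
    ((ae_densityMeasure_pos hgm).mono fun x hx => by
      by_contra hn
      have : p x = 0 := le_antisymm (not_lt.1 hn) (hp.1 x)
      simp [hg, tiltDensity, this] at hx)
    ((integrable_densityMeasure_iff hgm hgd.1).2 (by simp only [e]; exact hI.div_const Z))
  rw [integral_densityMeasure hgm hgd.1, integral_densityMeasure hgm hgd.1] at h
  simp only [e] at h
  rw [integral_div] at h
  simpa only [mul_comm, densityMean] using h

end Jensen

section GaussTiltMean

theorem integral_densityMeasure_tiltDensity {p F : EuclideanSpace ℝ (Fin n) → ℝ}
    (hp0 : ∀ x, 0 ≤ p x) (hpm : Measurable p) (hF : Measurable F)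
    (h : EuclideanSpace ℝ (Fin n) → ℝ) :
    ∫ x, h x ∂densityMeasure (tiltDensity p F) =
      (∫ x, rexp (F x) * h x ∂densityMeasure p) / ∫ x, rexp (F x) ∂densityMeasure p := by
  rw [densityMeasure_tiltDensity hp0 hpm hF, integral_tilted, ← integral_div]
  exact integral_congr_ae (ae_of_all _ fun x => by simp only [smul_eq_mul]; ring)

theorem hasFDerivAt_integral_exp_gaussTilt_mul {μ : Measure (EuclideanSpace ℝ (Fin n))}
    {h : EuclideanSpace ℝ (Fin n) → ℝ} {s : ℝ} (hs : 0 < s) (hh : Integrable h μ)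
    (hxh : Integrable (fun x => ‖x‖ * |h x|) μ) (ξ : EuclideanSpace ℝ (Fin n)) :
    Integrable (fun x => (rexp (gaussTilt s ξ x) * h x) • innerSL ℝ x) μ ∧
    HasFDerivAt (fun ξ => ∫ x, rexp (gaussTilt s ξ x) * h x ∂μ)
      (∫ x, (rexp (gaussTilt s ξ x) * h x) • innerSL ℝ x ∂μ) ξ := by
  have hc : ∀ ξ : EuclideanSpace ℝ (Fin n), Continuous (gaussTilt s ξ) := fun ξ => continuous_gaussTilt s ξ
  have hb : ∀ η ∈ Metric.ball ξ 1, ∀ x, rexp (gaussTilt s η x) ≤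
      rexp ((‖ξ‖ + 1) ^ 2 / (2 * s)) := fun η hη x => by
    refine Real.exp_le_exp.2 ((gaussTilt_le hs η x).trans ?_)
    have h1 : ‖η‖ ≤ ‖ξ‖ + 1 := by
      have := norm_le_norm_add_norm_sub' η ξ
      have h2 : ‖η - ξ‖ < 1 := by simpa [dist_eq_norm] using hη
      linarith
    gcongr
  have hm : ∀ η, AEStronglyMeasurable (fun x => rexp (gaussTilt s η x) * h x) μ := fun η =>
    AEStronglyMeasurable.mul (Real.continuous_exp.comp (hc η)).aestronglyMeasurable hh.1
  have hm' : AEStronglyMeasurable (fun x => (rexp (gaussTilt s ξ x) * h x) • innerSL ℝ x) μ :=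
    (hm ξ).smul (innerSL ℝ (E := EuclideanSpace ℝ (Fin n))).continuous.aestronglyMeasurable
  have hbd : ∀ η ∈ Metric.ball ξ 1, ∀ x, ‖(rexp (gaussTilt s η x) * h x) • innerSL ℝ x‖ ≤
      rexp ((‖ξ‖ + 1) ^ 2 / (2 * s)) * (‖x‖ * |h x|) := fun η hη x => by
    rw [norm_smul, norm_mul, Real.norm_of_nonneg (Real.exp_pos _).le, innerSL_apply_norm,
      Real.norm_eq_abs, mul_assoc, mul_comm |h x|]
    exact mul_le_mul_of_nonneg_right (hb η hη x) (by positivity)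
  refine ⟨(hxh.const_mul _).mono' hm' (ae_of_all _ (hbd ξ (Metric.mem_ball_self one_pos))), ?_⟩
  refine hasFDerivAt_integral_of_dominated_of_fderiv_le
    (F := fun ξ x => rexp (gaussTilt s ξ x) * h x)
    (F' := fun ξ x => (rexp (gaussTilt s ξ x) * h x) • innerSL ℝ x)
    (bound := fun x => rexp ((‖ξ‖ + 1) ^ 2 / (2 * s)) * (‖x‖ * |h x|))
    (Metric.ball_mem_nhds ξ one_pos) (Eventually.of_forall hm) ?_ hm'
    (ae_of_all _ fun x η hη => hbd η hη x) (hxh.const_mul _) (ae_of_all _ fun x η _ => ?_)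
  · refine hh.bdd_mul (Real.continuous_exp.comp (hc ξ)).aestronglyMeasurable
      (ae_of_all _ fun x => ?_) (c := rexp ((‖ξ‖ + 1) ^ 2 / (2 * s)))
    rw [Real.norm_of_nonneg (Real.exp_pos _).le]
    exact hb ξ (Metric.mem_ball_self one_pos) x
  · have h1 : HasFDerivAt (fun η => gaussTilt s η x) (innerSL ℝ x) η := by
      have h2 := ((innerSL ℝ x).hasFDerivAt (x := η)).sub_const (s / 2 * ‖x‖ ^ 2)
      have e : (fun η => gaussTilt s η x) = fun η => innerSL ℝ x η - s / 2 * ‖x‖ ^ 2 := by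
        funext η
        simp [gaussTilt, real_inner_comm]
      rwa [e]
    refine (h1.exp.mul_const (h x)).congr_fderiv ?_
    rw [smul_smul, mul_comm]

variable {p : EuclideanSpace ℝ (Fin n) → ℝ} {s : ℝ}

theorem hasFDerivAt_densityMean_tiltDensity (hp : IsDensity p) (hpm : Measurable p)
    (h2 : Integrable fun x => p x * ‖x‖ ^ 2) (hs : 0 < s) (ξ : EuclideanSpace ℝ (Fin n)) :
    HasFDerivAt (fun ξ => densityMean (tiltDensity p (gaussTilt s ξ)))
      (Matrix.toEuclideanCLM (𝕜 := ℝ) (densityCov (tiltDensity p (gaussTilt s ξ)))) ξ := by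
  have hprob := hp.isProbabilityMeasure
  have hfm : ∀ ξ : EuclideanSpace ℝ (Fin n), Measurable (gaussTilt s ξ) :=
    fun ξ => (continuous_gaussTilt s ξ).measurable
  have hgd := fun ξ => isDensity_tiltDensity hp hpm (hfm ξ) (gaussTilt_le hs ξ)
  have hgm := fun ξ => measurable_tiltDensity hpm (hfm ξ)
  have hg2 := fun ξ => integrable_tiltDensity_mul_norm_sq hp (hfm ξ) (gaussTilt_le hs ξ) h2
  have hmean : ∀ ξ i, densityMean (tiltDensity p (gaussTilt s ξ)) i =
      (∫ x, rexp (gaussTilt s ξ x) * x i ∂densityMeasure p) /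
        ∫ x, rexp (gaussTilt s ξ x) * 1 ∂densityMeasure p := fun ξ i => by
    simp only [densityMean_apply (hgd ξ) (hgm ξ) (hg2 ξ),
      integral_densityMeasure_tiltDensity hp.1 hpm (hfm ξ), mul_one]
  have hZ : (∫ x, rexp (gaussTilt s ξ x) * 1 ∂densityMeasure p) ≠ 0 := by
    simpa using (integral_exp_densityMeasure_pos hp (hfm ξ) (gaussTilt_le hs ξ)).ne'
  have hn1 : Integrable (fun x => ‖x‖ * |(1 : ℝ)|) (densityMeasure p) := by
    rw [integrable_densityMeasure_iff hpm hp.1]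
    simpa using integrable_mul_norm_of_integrable_mul_norm_sq hp.1 hp.2.1 hpm h2
  have hn2 : ∀ i, Integrable (fun x => ‖x‖ * |x i|) (densityMeasure p) := fun i => by
    have h3 : Integrable (fun x => ‖x‖ ^ 2) (densityMeasure p) :=
      (integrable_densityMeasure_iff hpm hp.1).2 h2
    refine h3.mono' (by fun_prop) (ae_of_all _ fun x => ?_)
    rw [Real.norm_of_nonneg (by positivity), sq]
    exact mul_le_mul_of_nonneg_left (PiLp.norm_apply_le x i) (norm_nonneg _)
  obtain ⟨iZ, dZ⟩ := hasFDerivAt_integral_exp_gaussTilt_mul hs (integrable_const (1 : ℝ)) hn1 ξ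
  rw [← hasFDerivWithinAt_univ, hasFDerivWithinAt_euclidean]
  intro i
  rw [hasFDerivWithinAt_univ]
  obtain ⟨iN, dN⟩ := hasFDerivAt_integral_exp_gaussTilt_mul hs
    (integrable_densityMeasure_coord hp hpm h2 i) (hn2 i) ξ
  have dI := (hasDerivAt_inv hZ).comp_hasFDerivAt ξ dZ
  simp only [hmean, div_eq_mul_inv]
  refine (dN.mul dI).congr_fderiv ?_
  refine ContinuousLinearMap.coe_injective
    ((EuclideanSpace.basisFun (Fin n) ℝ).toBasis.ext fun j => ?_)
  have e1 : ∀ x : EuclideanSpace ℝ (Fin n), innerSL ℝ x (EuclideanSpace.single j 1) = x j :=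
    fun x => by simp [EuclideanSpace.inner_single_right]
  have e2 : (Matrix.toEuclideanCLM (𝕜 := ℝ) (densityCov (tiltDensity p (gaussTilt s ξ)))
      (EuclideanSpace.single j 1)) i = densityCov (tiltDensity p (gaussTilt s ξ)) i j := by
    simp
  have v1 : (∫ x, (rexp (gaussTilt s ξ x) * x i) • innerSL ℝ x ∂densityMeasure p)
      (EuclideanSpace.single j 1) =
      ∫ x, rexp (gaussTilt s ξ x) * (x i * x j) ∂densityMeasure p := by
    rw [ContinuousLinearMap.integral_apply iN]
    refine integral_congr_ae (ae_of_all _ fun x => ?_)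
    simp only [_root_.smul_apply, e1, smul_eq_mul, mul_assoc]
  have v2 : (∫ x, (rexp (gaussTilt s ξ x) * 1) • innerSL ℝ x ∂densityMeasure p)
      (EuclideanSpace.single j 1) = ∫ x, rexp (gaussTilt s ξ x) * x j ∂densityMeasure p := by
    rw [ContinuousLinearMap.integral_apply iZ]
    refine integral_congr_ae (ae_of_all _ fun x => ?_)
    simp only [_root_.smul_apply, e1, smul_eq_mul, mul_one]
  have hcov := densityCov_apply (hgd ξ) (hgm ξ) (hg2 ξ) i j
  simp only [integral_densityMeasure_tiltDensity hp.1 hpm (hfm ξ)] at hcov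
  simp only [OrthonormalBasis.coe_toBasis, EuclideanSpace.basisFun_apply,
    ContinuousLinearMap.coe_coe, ContinuousLinearMap.comp_apply, PiLp.proj_apply, e2,
    hcov, _root_.smul_apply, _root_.add_apply, v1, v2, smul_eq_mul]
  simp only [Function.comp_apply, mul_one] at hZ ⊢
  field_simp
  ring

theorem injective_densityMean_tiltDensity (hp : IsDensity p) (hpm : Measurable p)
    (h2 : Integrable fun x => p x * ‖x‖ ^ 2) (hs : 0 < s) :
    Function.Injective fun ξ => densityMean (tiltDensity p (gaussTilt s ξ)) := by
  intro ξ η h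
  by_contra hne
  set v := η - ξ with hv
  have hv0 : v ≠ 0 := sub_ne_zero.2 (Ne.symm hne)
  have hd : ∀ t : ℝ, HasDerivAt
      (fun t : ℝ => inner ℝ v (densityMean (tiltDensity p (gaussTilt s (ξ + t • v)))))
      (inner ℝ v (Matrix.toEuclideanCLM (𝕜 := ℝ)
        (densityCov (tiltDensity p (gaussTilt s (ξ + t • v)))) v)) t := fun t => by
    have hl : HasDerivAt (fun t : ℝ => ξ + t • v) v t := by
      simpa using ((hasDerivAt_id t).smul_const v).const_add ξ
    have h1 := (hasFDerivAt_densityMean_tiltDensity hp hpm h2 hs (ξ + t • v)).comp_hasDerivAt t hl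
    exact ((innerSL ℝ v).hasFDerivAt).comp_hasDerivAt t h1
  have hpos : ∀ t : ℝ, 0 < deriv
      (fun t : ℝ => inner ℝ v (densityMean (tiltDensity p (gaussTilt s (ξ + t • v))))) t :=
    fun t => by
    rw [(hd t).deriv]
    have hfm := (continuous_gaussTilt s (ξ + t • v)).measurable
    have hle := gaussTilt_le hs (ξ + t • v)
    have hA := densityCov_posDef (isDensity_tiltDensity hp hpm hfm hle)
      (measurable_tiltDensity hpm hfm) (integrable_tiltDensity_mul_norm_sq hp hfm hle h2)
    have hw : v.ofLp ≠ 0 := fun h0 => hv0 (by ext i; exact congrFun h0 i)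
    have h3 := hA.dotProduct_mulVec_pos hw
    rw [Matrix.inner_toEuclideanCLM]
    simpa using h3
  have h4 := strictMono_of_deriv_pos hpos (zero_lt_one' ℝ)
  simp only [zero_smul, add_zero, one_smul, hv, add_sub_cancel] at h4
  simp only at h
  rw [h] at h4
  exact lt_irrefl _ h4

/-- The change of variables by the mean of the Gaussian tilts. -/
theorem lintegral_density_densityMean_mul_det_le (hp : IsDensity p) (hpm : Measurable p)
    (h2 : Integrable fun x => p x * ‖x‖ ^ 2) (hs : 0 < s) :
    ∫⁻ ξ, ENNReal.ofReal ((densityCov (tiltDensity p (gaussTilt s ξ))).det) *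
      ENNReal.ofReal (p (densityMean (tiltDensity p (gaussTilt s ξ)))) ≤ 1 := by
  have h := lintegral_image_eq_lintegral_abs_det_fderiv_mul
    (volume : Measure (EuclideanSpace ℝ (Fin n))) MeasurableSet.univ
    (fun ξ _ => (hasFDerivAt_densityMean_tiltDensity hp hpm h2 hs ξ).hasFDerivWithinAt)
    (injective_densityMean_tiltDensity hp hpm h2 hs).injOn (fun x => ENNReal.ofReal (p x))
  have e : ∀ ξ : EuclideanSpace ℝ (Fin n), |(Matrix.toEuclideanCLM (𝕜 := ℝ)
      (densityCov (tiltDensity p (gaussTilt s ξ)))).det| =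
      (densityCov (tiltDensity p (gaussTilt s ξ))).det := fun ξ => by
    have hfm := (continuous_gaussTilt s ξ).measurable
    have hle := gaussTilt_le hs ξ
    have hA := densityCov_posDef (isDensity_tiltDensity hp hpm hfm hle)
      (measurable_tiltDensity hpm hfm) (integrable_tiltDensity_mul_norm_sq hp hfm hle h2)
    rw [ContinuousLinearMap.det, Matrix.coe_toEuclideanCLM_eq_toEuclideanLin,
      Matrix.toEuclideanLin_eq_toLin_orthonormal, LinearMap.det_toLin, abs_of_pos hA.det_pos]
  simp only [e, Measure.restrict_univ] at h
  rw [← h]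
  refine (setLIntegral_le_lintegral _ _).trans_eq ?_
  rw [← ofReal_integral_eq_lintegral_ofReal hp.2.1 (ae_of_all _ hp.1), hp.2.2, ENNReal.ofReal_one]

end GaussTiltMean

section GaussWeight

/-- The density of the centred Gaussian with covariance `s • 1`. -/
def gaussWeight (s : ℝ) (ξ : EuclideanSpace ℝ (Fin n)) : ℝ :=
  ((2 * π * s) ^ (n / 2 : ℝ))⁻¹ * rexp (-(2 * s)⁻¹ * ‖ξ‖ ^ 2)

theorem continuous_gaussWeight (s : ℝ) :
    Continuous (gaussWeight s : EuclideanSpace ℝ (Fin n) → ℝ) := by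
  unfold gaussWeight; fun_prop

theorem integrable_exp_neg_mul_norm_sq {b : ℝ} (hb : 0 < b) :
    Integrable fun x : EuclideanSpace ℝ (Fin n) => rexp (-b * ‖x‖ ^ 2) := by
  refine not_imp_comm.1 integral_undef ?_
  rw [GaussianFourier.integral_rexp_neg_mul_sq_norm hb]
  positivity

variable {s : ℝ}

theorem gaussWeight_nonneg (hs : 0 < s) (ξ : EuclideanSpace ℝ (Fin n)) : 0 ≤ gaussWeight s ξ := by
  unfold gaussWeight; positivity

theorem integrable_gaussWeight (hs : 0 < s) :
    Integrable (gaussWeight s : EuclideanSpace ℝ (Fin n) → ℝ) :=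
  (integrable_exp_neg_mul_norm_sq (by positivity)).const_mul _

theorem integral_gaussWeight (hs : 0 < s) :
    ∫ ξ : EuclideanSpace ℝ (Fin n), gaussWeight s ξ = 1 := by
  simp only [gaussWeight]
  rw [integral_const_mul, GaussianFourier.integral_rexp_neg_mul_sq_norm (by positivity),
    finrank_euclideanSpace, Fintype.card_fin, div_inv_eq_mul]
  have : 0 < (2 * π * s) ^ (n / 2 : ℝ) := by positivity
  rw [show π * (2 * s) = 2 * π * s by ring]
  exact inv_mul_cancel₀ this.ne'

theorem integrable_gaussWeight_mul_norm (hs : 0 < s) :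
    Integrable fun ξ : EuclideanSpace ℝ (Fin n) => gaussWeight s ξ * ‖ξ‖ := by
  set b := (2 * s)⁻¹ with hb
  have hb0 : 0 < b := by positivity
  refine ((integrable_exp_neg_mul_norm_sq (n := n) (half_pos hb0)).const_mul
    (((2 * π * s) ^ (n / 2 : ℝ))⁻¹ * rexp (1 / (2 * b)))).mono'
    ((continuous_gaussWeight (n := n) s).mul continuous_norm).aestronglyMeasurable
    (ae_of_all _ fun ξ => ?_)
  rw [norm_mul, norm_norm, Real.norm_of_nonneg (gaussWeight_nonneg hs ξ), gaussWeight,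
    mul_assoc _ (rexp _) ‖ξ‖, mul_assoc _ (rexp _) (rexp _), ← hb]
  have hc : 0 ≤ ((2 * π * s) ^ (n / 2 : ℝ))⁻¹ := by positivity
  refine mul_le_mul_of_nonneg_left ?_ hc
  have h1 : ‖ξ‖ ≤ rexp (1 / (2 * b) + b / 2 * ‖ξ‖ ^ 2) := by
    refine le_trans ?_ (Real.add_one_le_exp _)
    have h2 : 1 / (2 * b) + b / 2 * ‖ξ‖ ^ 2 - ‖ξ‖ = (b * ‖ξ‖ - 1) ^ 2 / (2 * b) := by
      field_simp
      ring
    have h3 : 0 ≤ (b * ‖ξ‖ - 1) ^ 2 / (2 * b) := by positivity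
    linarith
  calc rexp (-b * ‖ξ‖ ^ 2) * ‖ξ‖
      ≤ rexp (-b * ‖ξ‖ ^ 2) * rexp (1 / (2 * b) + b / 2 * ‖ξ‖ ^ 2) := by gcongr
    _ = rexp (1 / (2 * b)) * rexp (-(b / 2) * ‖ξ‖ ^ 2) := by
      rw [← Real.exp_add, ← Real.exp_add]
      congr 1
      ring

theorem gaussWeight_mul_exp_gaussTilt (hs : 0 < s) (ξ x : EuclideanSpace ℝ (Fin n)) :
    gaussWeight s ξ * rexp (gaussTilt s ξ x) = gaussWeight s (ξ - s • x) := by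
  rw [gaussWeight, gaussWeight, mul_assoc, ← Real.exp_add, gaussTilt, norm_sub_sq_real, norm_smul,
    inner_smul_right, Real.norm_of_nonneg hs.le]
  congr 2
  field_simp
  ring

theorem gaussTilt_eq (s : ℝ) (ξ x : EuclideanSpace ℝ (Fin n)) :
    gaussTilt s ξ x = inner ℝ (ξ - s • x) x + s / 2 * ‖x‖ ^ 2 := by
  rw [gaussTilt, inner_sub_left, real_inner_smul_left, real_inner_self_eq_norm_sq]
  ring

theorem integral_integral_shear {ν : Measure (EuclideanSpace ℝ (Fin n))} [SFinite ν]
    {k : EuclideanSpace ℝ (Fin n) × EuclideanSpace ℝ (Fin n) → ℝ} (s : ℝ)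
    (hk : Integrable k (ν.prod volume)) :
    Integrable (fun ξ => ∫ x, k (x, ξ - s • x) ∂ν) ∧
      ∫ ξ, ∫ x, k (x, ξ - s • x) ∂ν = ∫ x, (∫ y, k (x, y)) ∂ν := by
  have hT : MeasurePreserving (fun z : EuclideanSpace ℝ (Fin n) × EuclideanSpace ℝ (Fin n) =>
      (z.1, z.2 - s • z.1)) (ν.prod volume) (ν.prod volume) :=
    (MeasurePreserving.id ν).skew_product (g := fun x ξ => ξ - s • x)
      (by unfold Function.uncurry; fun_prop)
      (ae_of_all _ fun x => (measurePreserving_sub_right volume (s • x)).map_eq)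
  have h1 : Integrable (fun z : EuclideanSpace ℝ (Fin n) × EuclideanSpace ℝ (Fin n) =>
      k (z.1, z.2 - s • z.1)) (ν.prod volume) := hT.integrable_comp_of_integrable hk
  refine ⟨h1.integral_prod_right, ?_⟩
  rw [← integral_integral_swap (f := fun x ξ => k (x, ξ - s • x)) h1]
  exact integral_congr_ae (ae_of_all _ fun x =>
    integral_sub_right_eq_self (μ := volume) (fun ξ => k (x, ξ)) (s • x))

/-- Averaging a Gaussian tilt against the Gaussian weight recovers the original integral. -/
theorem integral_gaussWeight_mul_integral_exp_gaussTilt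
    {ν : Measure (EuclideanSpace ℝ (Fin n))} [SFinite ν] (hs : 0 < s)
    {h : EuclideanSpace ℝ (Fin n) → ℝ} (hh : Integrable h ν) :
    Integrable (fun ξ => gaussWeight s ξ * ∫ x, rexp (gaussTilt s ξ x) * h x ∂ν) ∧
      ∫ ξ, gaussWeight s ξ * ∫ x, rexp (gaussTilt s ξ x) * h x ∂ν = ∫ x, h x ∂ν := by
  have h1 := integral_integral_shear s (hh.mul_prod (integrable_gaussWeight (n := n) hs))
  have e : ∀ ξ, ∫ x, h x * gaussWeight s (ξ - s • x) ∂ν =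
      gaussWeight s ξ * ∫ x, rexp (gaussTilt s ξ x) * h x ∂ν := fun ξ => by
    rw [← integral_const_mul]
    refine integral_congr_ae (ae_of_all _ fun x => ?_)
    simp only [← gaussWeight_mul_exp_gaussTilt hs]
    ring
  simp only [e, integral_const_mul, integral_gaussWeight hs, mul_one] at h1
  exact h1

theorem integral_gaussWeight_mul_inner (s : ℝ) (x : EuclideanSpace ℝ (Fin n)) :
    ∫ y, gaussWeight s y * inner ℝ y x = 0 := by
  have h := integral_neg_eq_self (fun y : EuclideanSpace ℝ (Fin n) => gaussWeight s y * inner ℝ y x)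
    volume
  have e : ∀ y : EuclideanSpace ℝ (Fin n), gaussWeight s (-y) * inner ℝ (-y) x =
      -(gaussWeight s y * inner ℝ y x) := fun y => by
    simp [gaussWeight]
  simp only [e, integral_neg] at h
  linarith

/-- The Gaussian average of the tilted means of the tilting functions. -/
theorem integral_gaussWeight_mul_integral_exp_gaussTilt_mul_gaussTilt
    {ν : Measure (EuclideanSpace ℝ (Fin n))} [IsFiniteMeasure ν] (hs : 0 < s)
    (h2 : Integrable (fun x => ‖x‖ ^ 2) ν) :
    Integrable (fun ξ => gaussWeight s ξ * ∫ x, rexp (gaussTilt s ξ x) * gaussTilt s ξ x ∂ν) ∧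
      ∫ ξ, gaussWeight s ξ * ∫ x, rexp (gaussTilt s ξ x) * gaussTilt s ξ x ∂ν =
        s / 2 * ∫ x, ‖x‖ ^ 2 ∂ν := by
  have h1 : Integrable (fun x => ‖x‖) ν := by
    refine ((integrable_const (1 : ℝ)).add h2).mono' (by fun_prop) (ae_of_all _ fun x => ?_)
    simp only [norm_norm, Pi.add_apply]
    nlinarith [sq_nonneg (‖x‖ - 1), norm_nonneg x]
  have hk1 : Integrable (fun z : EuclideanSpace ℝ (Fin n) × EuclideanSpace ℝ (Fin n) =>
      gaussWeight s z.2 * inner ℝ z.2 z.1) (ν.prod volume) := by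
    refine (h1.mul_prod (integrable_gaussWeight_mul_norm (n := n) hs)).mono' ?_
      (ae_of_all _ fun z => ?_)
    · have := continuous_gaussWeight (n := n) s
      exact Continuous.aestronglyMeasurable (by fun_prop)
    · rw [norm_mul, Real.norm_of_nonneg (gaussWeight_nonneg hs _)]
      have := norm_inner_le_norm (𝕜 := ℝ) z.2 z.1
      have h3 := gaussWeight_nonneg hs z.2
      calc _ ≤ gaussWeight s z.2 * (‖z.2‖ * ‖z.1‖) := by gcongr
        _ = _ := by ring
  have hk2 : Integrable (fun z : EuclideanSpace ℝ (Fin n) × EuclideanSpace ℝ (Fin n) =>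
      s / 2 * ‖z.1‖ ^ 2 * gaussWeight s z.2) (ν.prod volume) :=
    (h2.const_mul (s / 2)).mul_prod (integrable_gaussWeight (n := n) hs)
  have hk : Integrable (fun z : EuclideanSpace ℝ (Fin n) × EuclideanSpace ℝ (Fin n) =>
      gaussWeight s z.2 * inner ℝ z.2 z.1 + s / 2 * ‖z.1‖ ^ 2 * gaussWeight s z.2)
        (ν.prod volume) := hk1.add hk2
  obtain ⟨i1, v1⟩ := integral_integral_shear s hk
  have e : ∀ ξ, ∫ x, (gaussWeight s (ξ - s • x) * inner ℝ (ξ - s • x) x +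
      s / 2 * ‖x‖ ^ 2 * gaussWeight s (ξ - s • x)) ∂ν =
      gaussWeight s ξ * ∫ x, rexp (gaussTilt s ξ x) * gaussTilt s ξ x ∂ν := fun ξ => by
    rw [← integral_const_mul]
    refine integral_congr_ae (ae_of_all _ fun x => ?_)
    beta_reduce
    rw [← mul_assoc, gaussWeight_mul_exp_gaussTilt hs, gaussTilt_eq]
    ring
  simp only [e] at i1 v1
  refine ⟨i1, v1.trans ?_⟩
  rw [← integral_const_mul]
  refine integral_congr_ae ?_
  filter_upwards [hk1.prod_right_ae, hk2.prod_right_ae] with x hx1 hx2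
  rw [integral_add hx1 hx2, integral_gaussWeight_mul_inner, integral_const_mul,
    integral_gaussWeight hs]
  ring

end GaussWeight

section Selection

variable {p : EuclideanSpace ℝ (Fin n) → ℝ} {s : ℝ}

/-- Some Gaussian tilt is simultaneously controlled in the three quantities used below. -/
theorem exists_gaussTilt_le (hn : 1 ≤ n) (hp : IsDensity p) (hpm : Measurable p)
    (hlc : IsLogConcave p) (hi : IsIsotropic p) (h0 : 0 < p 0) (hs : 0 < s) :
    ∃ ξ : EuclideanSpace ℝ (Fin n),
      (∫ x, √(p x) * rexp (gaussTilt s ξ x)) / ∫ x, rexp (gaussTilt s ξ x) ∂densityMeasure p ≤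
        4 * (2 ^ n / √(p 0)) ∧
      (∫ x, gaussTilt s ξ x ∂densityMeasure (tiltDensity p (gaussTilt s ξ))) -
        ∫ x, gaussTilt s ξ x ∂densityMeasure p ≤ 4 * (s * n) ∧
      (densityCov (tiltDensity p (gaussTilt s ξ))).det *
        p (densityMean (tiltDensity p (gaussTilt s ξ))) ≤
          4 * ((2 * π * s) ^ (n / 2 : ℝ))⁻¹ := by
  by_contra! hcon
  have hprob := hp.isProbabilityMeasure
  set μ := densityMeasure p with hμ
  set c := ((2 * π * s) ^ (n / 2 : ℝ))⁻¹ with hc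
  have hc0 : 0 < c := by positivity
  have hn0 : (0 : ℝ) < n := by exact_mod_cast hn
  set B := 2 ^ n / √(p 0) with hB
  have hB0 : 0 < B := by positivity
  set Z : EuclideanSpace ℝ (Fin n) → ℝ := fun ξ => ∫ x, rexp (gaussTilt s ξ x) ∂μ with hZ
  have hfm : ∀ ξ : EuclideanSpace ℝ (Fin n), Measurable (gaussTilt s ξ) :=
    fun ξ => (continuous_gaussTilt s ξ).measurable
  have hZ0 : ∀ ξ, 0 < Z ξ := fun ξ =>
    integral_exp_densityMeasure_pos hp (hfm ξ) (gaussTilt_le hs ξ)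
  set w : EuclideanSpace ℝ (Fin n) → ℝ := gaussWeight s with hw
  have hw0 : ∀ ξ, 0 < w ξ := fun ξ => by simp only [hw, gaussWeight]; positivity
  have hw1 : ∀ ξ, w ξ * Z ξ ≤ c := fun ξ => by
    have hle : Z ξ ≤ rexp (‖ξ‖ ^ 2 / (2 * s)) := by
      have h := integral_mono (integrable_exp_densityMeasure hp (hfm ξ) (gaussTilt_le hs ξ))
        (integrable_const (rexp (‖ξ‖ ^ 2 / (2 * s))))
        (fun x => Real.exp_le_exp.2 (gaussTilt_le hs ξ x))
      simpa using h
    calc w ξ * Z ξ ≤ w ξ * rexp (‖ξ‖ ^ 2 / (2 * s)) := by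
          have := (hw0 ξ).le
          gcongr
      _ = c := by
          simp only [hw, gaussWeight]
          rw [mul_assoc, ← Real.exp_add, show -(2 * s)⁻¹ * ‖ξ‖ ^ 2 + ‖ξ‖ ^ 2 / (2 * s) = 0 by ring,
            Real.exp_zero, mul_one]
  have h2 := hi.integrable_mul_norm_sq
  have h2' : Integrable (fun x => ‖x‖ ^ 2) μ := (integrable_densityMeasure_iff hpm hp.1).2 h2
  have hsec : ∫ x, ‖x‖ ^ 2 ∂μ = n := by
    rw [hμ, integral_densityMeasure hpm hp.1]
    exact hi.integral_mul_norm_sq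
  obtain ⟨iW, vW⟩ := integral_gaussWeight_mul_integral_exp_gaussTilt (ν := μ) hs
    (integrable_const (1 : ℝ))
  obtain ⟨hsq, hsqB⟩ := integrable_sqrt_and_integral_le hp hpm hlc h0
  obtain ⟨iJ, vJ⟩ := integral_gaussWeight_mul_integral_exp_gaussTilt hs hsq
  obtain ⟨iM, vM⟩ := integral_gaussWeight_mul_integral_exp_gaussTilt_mul_gaussTilt hs h2'
  rw [hsec] at vM
  simp only [mul_one] at iW vW
  have vW' : ∫ ξ, w ξ * Z ξ = 1 := by simpa using vW
  have hx : Integrable (fun x => x) μ := by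
    refine ((integrable_const (1 : ℝ)).add h2').mono' (by fun_prop) (ae_of_all _ fun x => ?_)
    simp only [Pi.add_apply]
    nlinarith [sq_nonneg (‖x‖ - 1), norm_nonneg x]
  have hm0 : ∀ ξ, ∫ x, gaussTilt s ξ x ∂μ = -(s / 2 * n) := fun ξ => by
    have hmean : ∫ x, x ∂μ = 0 := by
      rw [hμ, integral_densityMeasure hpm hp.1]
      exact hi.1
    simp only [gaussTilt]
    rw [integral_sub (hx.const_inner ξ) (h2'.const_mul _), integral_inner hx, hmean,
      integral_const_mul, hsec]
    simp
  have hm1 : ∀ ξ, ∫ x, gaussTilt s ξ x ∂densityMeasure (tiltDensity p (gaussTilt s ξ)) =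
      (∫ x, rexp (gaussTilt s ξ x) * gaussTilt s ξ x ∂μ) / Z ξ := fun ξ =>
    integral_densityMeasure_tiltDensity hp.1 hpm (hfm ξ) _
  set R : EuclideanSpace ℝ (Fin n) → ℝ := fun ξ =>
    B⁻¹ * (w ξ * ∫ x, rexp (gaussTilt s ξ x) * √(p x)) +
      (s * n)⁻¹ * (w ξ * ∫ x, rexp (gaussTilt s ξ x) * gaussTilt s ξ x ∂μ +
        s / 2 * n * (w ξ * Z ξ)) with hR
  have iR : Integrable R :=
    (iJ.const_mul _).add ((iM.add (iW.const_mul _)).const_mul _)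
  have vR : ∫ ξ, R ξ ≤ 2 := by
    have i1 : Integrable fun ξ => w ξ * ∫ x, rexp (gaussTilt s ξ x) * gaussTilt s ξ x ∂μ +
        s / 2 * n * (w ξ * Z ξ) := iM.add (iW.const_mul _)
    simp only [hR]
    rw [integral_add (iJ.const_mul _) (i1.const_mul _), integral_const_mul, integral_const_mul,
      integral_add iM (iW.const_mul _), integral_const_mul, vJ, vM, vW']
    have e1 : B⁻¹ * ∫ x, √(p x) ≤ 1 := by
      rw [inv_mul_le_iff₀ hB0, mul_one]
      exact hsqB
    have e2 : (s * n)⁻¹ * (s / 2 * n + s / 2 * n * 1) = 1 := by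
      field_simp
      norm_num
    linarith
  set G : EuclideanSpace ℝ (Fin n) → ℝ := fun ξ =>
    (densityCov (tiltDensity p (gaussTilt s ξ))).det *
        p (densityMean (tiltDensity p (gaussTilt s ξ))) with hG
  have hdet : ∀ ξ, 0 < (densityCov (tiltDensity p (gaussTilt s ξ))).det := fun ξ =>
    (densityCov_posDef (isDensity_tiltDensity hp hpm (hfm ξ) (gaussTilt_le hs ξ))
      (measurable_tiltDensity hpm (hfm ξ))
      (integrable_tiltDensity_mul_norm_sq hp (hfm ξ) (gaussTilt_le hs ξ) h2)).det_pos
  have hG0 : ∀ ξ, 0 ≤ G ξ := fun ξ => mul_nonneg (hdet ξ).le (hp.1 _)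
  have hJ0 : ∀ ξ, 0 ≤ B⁻¹ * (w ξ * ∫ x, rexp (gaussTilt s ξ x) * √(p x)) := fun ξ => by
    have h3 : 0 ≤ ∫ x, rexp (gaussTilt s ξ x) * √(p x) :=
      integral_nonneg fun x => by positivity
    have := (hw0 ξ).le
    positivity
  have hexp : ∀ ξ, w ξ * Z ξ * ((∫ x, rexp (gaussTilt s ξ x) * gaussTilt s ξ x ∂μ) / Z ξ -
      -(s / 2 * n)) = w ξ * ∫ x, rexp (gaussTilt s ξ x) * gaussTilt s ξ x ∂μ +
        s / 2 * n * (w ξ * Z ξ) := fun ξ => by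
    have := (hZ0 ξ).ne'
    field_simp
    ring
  have hM0 : ∀ ξ, 0 ≤ w ξ * ∫ x, rexp (gaussTilt s ξ x) * gaussTilt s ξ x ∂μ +
      s / 2 * n * (w ξ * Z ξ) := fun ξ => by
    have hint : Integrable (gaussTilt s ξ) μ := by
      have h3 := (hx.const_inner (𝕜 := ℝ) ξ).sub (h2'.const_mul (s / 2))
      exact h3
    have h3 := integral_le_integral_tilted (hfm ξ) (by positivity) (gaussTilt_le hs ξ) hint
    rw [hμ, ← densityMeasure_tiltDensity hp.1 hpm (hfm ξ), ← hμ, hm0, hm1] at h3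
    rw [← hexp]
    exact mul_nonneg (mul_pos (hw0 ξ) (hZ0 ξ)).le (by linarith)
  have hpt : ∀ ξ, 4 * (w ξ * Z ξ) ≤ R ξ + G ξ := fun ξ => by
    have h3 := hJ0 ξ
    have h4 := mul_nonneg (inv_nonneg.2 (mul_pos hs hn0).le) (hM0 ξ)
    have hwZ := mul_pos (hw0 ξ) (hZ0 ξ)
    by_cases hJ : (∫ x, √(p x) * rexp (gaussTilt s ξ x)) / Z ξ ≤ 4 * B
    · by_cases hM : (∫ x, gaussTilt s ξ x ∂densityMeasure (tiltDensity p (gaussTilt s ξ))) -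
          ∫ x, gaussTilt s ξ x ∂μ ≤ 4 * (s * n)
      · have h5 := hcon ξ hJ hM
        have h6 : 4 * (w ξ * Z ξ) ≤ 4 * c := by linarith [hw1 ξ]
        have h7 : 4 * c < G ξ := h5
        simp only [hR]
        linarith
      · push Not at hM
        rw [hm0, hm1] at hM
        have h5 : 4 * (w ξ * Z ξ) ≤ (s * n)⁻¹ *
            (w ξ * ∫ x, rexp (gaussTilt s ξ x) * gaussTilt s ξ x ∂μ + s / 2 * n * (w ξ * Z ξ)) := by
          rw [le_inv_mul_iff₀ (mul_pos hs hn0)]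
          have h6 := mul_le_mul_of_nonneg_left hM.le hwZ.le
          rw [hexp] at h6
          linarith
        have := hG0 ξ
        simp only [hR]
        linarith
    · push Not at hJ
      have h5 : 4 * (w ξ * Z ξ) ≤ B⁻¹ * (w ξ * ∫ x, rexp (gaussTilt s ξ x) * √(p x)) := by
        rw [le_inv_mul_iff₀ hB0]
        rw [lt_div_iff₀ (hZ0 ξ)] at hJ
        simp only [mul_comm (√(p _))] at hJ
        have h6 := mul_le_mul_of_nonneg_left hJ.le (hw0 ξ).le
        linarith
      have := hG0 ξ
      simp only [hR]
      linarith
  have hR0 : ∀ ξ, 0 ≤ R ξ := fun ξ =>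
    add_nonneg (hJ0 ξ) (mul_nonneg (inv_nonneg.2 (mul_pos hs hn0).le) (hM0 ξ))
  have hfin : ENNReal.ofReal 4 ≤ ENNReal.ofReal 3 := by
    calc ENNReal.ofReal 4 = ENNReal.ofReal (∫ ξ, 4 * (w ξ * Z ξ)) := by
          rw [integral_const_mul, vW', mul_one]
      _ = ∫⁻ ξ, ENNReal.ofReal (4 * (w ξ * Z ξ)) :=
          ofReal_integral_eq_lintegral_ofReal (iW.const_mul _)
            (ae_of_all _ fun ξ => mul_nonneg (by norm_num) (mul_pos (hw0 ξ) (hZ0 ξ)).le)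
      _ ≤ ∫⁻ ξ, (ENNReal.ofReal (R ξ) + ENNReal.ofReal (G ξ)) := lintegral_mono fun ξ => by
          rw [← ENNReal.ofReal_add (hR0 ξ) (hG0 ξ)]
          exact ENNReal.ofReal_le_ofReal (hpt ξ)
      _ = (∫⁻ ξ, ENNReal.ofReal (R ξ)) + ∫⁻ ξ, ENNReal.ofReal (G ξ) :=
          lintegral_add_left' iR.1.aemeasurable.ennreal_ofReal _
      _ ≤ ENNReal.ofReal 2 + 1 := by
          refine add_le_add ?_ ?_
          · rw [← ofReal_integral_eq_lintegral_ofReal iR (ae_of_all _ hR0)]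
            exact ENNReal.ofReal_le_ofReal vR
          · refine le_of_eq_of_le ?_ (lintegral_density_densityMean_mul_det_le hp hpm h2 hs)
            simp only [hG, ENNReal.ofReal_mul (hdet _).le]
      _ = ENNReal.ofReal 3 := by
          rw [← ENNReal.ofReal_one, ← ENNReal.ofReal_add (by norm_num) (by norm_num)]
          norm_num
  rw [ENNReal.ofReal_le_ofReal_iff (by norm_num)] at hfin
  norm_num at hfin

end Selection

theorem density_zero_le_of_sigmaSup_le {p : EuclideanSpace ℝ (Fin n) → ℝ} {σ : ℝ}
    (hn : 1 ≤ n) (hp : IsDensity p) (hpm : Measurable p) (hlc : IsLogConcave p)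
    (hi : IsIsotropic p) (ho : IsOpen {x | 0 < p x}) (h0 : 0 < p 0) (hσ0 : 0 < σ)
    (hσ : sigmaSup n ≤ σ) : p 0 ≤ (256 * rexp ((momentConst + 4) / 2) * σ) ^ n := by
  have hs : 0 < (σ ^ 2)⁻¹ := by positivity
  obtain ⟨ξ, h1, h3, h4⟩ := exists_gaussTilt_le hn hp hpm hlc hi h0 hs
  have h2 := hi.integrable_mul_norm_sq
  obtain ⟨ha, h5⟩ := inv_sqrt_densityMean_tiltDensity_le hp hpm hlc h2 ho h0
    (continuous_gaussTilt (σ ^ 2)⁻¹ ξ).measurable (gaussTilt_le hs ξ)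
  have h6 := neg_le_log_det_densityCov_tiltDensity hn hp hpm hlc hi hs ξ hσ hs
  have hdet := (densityCov_posDef
    (isDensity_tiltDensity hp hpm (continuous_gaussTilt (σ ^ 2)⁻¹ ξ).measurable (gaussTilt_le hs ξ))
    (measurable_tiltDensity hpm (continuous_gaussTilt (σ ^ 2)⁻¹ ξ).measurable)
    (integrable_tiltDensity_mul_norm_sq hp (continuous_gaussTilt (σ ^ 2)⁻¹ ξ).measurable
      (gaussTilt_le hs ξ) h2)).det_pos
  set a := densityMean (tiltDensity p (gaussTilt (σ ^ 2)⁻¹ ξ))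
  set D := (densityCov (tiltDensity p (gaussTilt (σ ^ 2)⁻¹ ξ))).det
  set Δ := (∫ x, gaussTilt (σ ^ 2)⁻¹ ξ x ∂densityMeasure (tiltDensity p (gaussTilt (σ ^ 2)⁻¹ ξ))) -
    ∫ x, gaussTilt (σ ^ 2)⁻¹ ξ x ∂densityMeasure p
  have hpa : p 0 ≤ 16 * 4 ^ n * p a := by
    have h7 : √(p 0) ≤ 4 * 2 ^ n * √(p a) := by
      have h8 := h5.trans h1
      have h9 := Real.sqrt_pos.2 ha
      have h10 := Real.sqrt_pos.2 h0
      rw [← mul_div_assoc, le_div_iff₀ h10, inv_mul_le_iff₀ h9] at h8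
      linarith
    calc p 0 = √(p 0) ^ 2 := (Real.sq_sqrt h0.le).symm
      _ ≤ (4 * 2 ^ n * √(p a)) ^ 2 := by gcongr
      _ = 16 * 4 ^ n * p a := by
        rw [mul_pow, mul_pow, Real.sq_sqrt ha.le, ← pow_mul, mul_comm n 2, pow_mul]
        norm_num
  have hD : rexp (-((momentConst + 4) / 2 * n)) ≤ D := by
    rw [← Real.exp_log hdet]
    refine Real.exp_le_exp.2 (le_trans ?_ h6)
    have h7 : Δ / (σ ^ 2)⁻¹ ≤ 4 * n := by
      rw [div_le_iff₀ hs]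
      linarith
    have h8 : (σ ^ 2)⁻¹ * (momentConst * n * σ ^ 2) = momentConst * n := by
      field_simp
    linarith
  have hc : ((2 * π * (σ ^ 2)⁻¹) ^ (n / 2 : ℝ))⁻¹ ≤ σ ^ n := by
    have h7 : (σ ^ n)⁻¹ ≤ (2 * π * (σ ^ 2)⁻¹) ^ (n / 2 : ℝ) := by
      calc (σ ^ n)⁻¹ = ((σ⁻¹) ^ 2) ^ (n / 2 : ℝ) := by
            rw [← Real.rpow_natCast_mul (by positivity), Nat.cast_ofNat, mul_div_cancel₀ _ two_ne_zero,
              Real.rpow_natCast, inv_pow]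
        _ ≤ _ := by
            have := Real.pi_gt_three
            rw [inv_pow]
            gcongr
            nlinarith
    exact inv_le_of_inv_le₀ (by positivity) h7
  have hfin : p 0 * rexp (-((momentConst + 4) / 2 * n)) ≤ 64 * 4 ^ n * σ ^ n := by
    calc p 0 * rexp (-((momentConst + 4) / 2 * n)) ≤ 16 * 4 ^ n * p a * D := by gcongr
      _ = 16 * 4 ^ n * (D * p a) := by ring
      _ ≤ 16 * 4 ^ n * (4 * σ ^ n) := by
        have : D * p a ≤ 4 * σ ^ n := h4.trans (by gcongr)
        gcongr
      _ = 64 * 4 ^ n * σ ^ n := by ring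
  rw [Real.exp_neg, ← div_eq_mul_inv, div_le_iff₀ (Real.exp_pos _)] at hfin
  calc p 0 ≤ 64 * 4 ^ n * σ ^ n * rexp ((momentConst + 4) / 2 * n) := hfin
    _ ≤ 64 ^ n * 4 ^ n * σ ^ n * rexp ((momentConst + 4) / 2 * n) := by
      gcongr
      exact le_self_pow₀ (by norm_num) (by lia)
    _ = (256 * rexp ((momentConst + 4) / 2) * σ) ^ n := by
      rw [mul_comm ((momentConst + 4) / 2) (n : ℝ), Real.exp_nat_mul, mul_pow, mul_pow, ← mul_pow]
      norm_num
      ring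

end

/-- Eldan–Klartag: there is a universal constant `C > 0` such that every
isotropic logconcave density `p` on `ℝⁿ` (`n ≥ 1`) has slicing constant
`L_p = p(0)^{1/n} ≤ C σ(n)`. -/
theorem slicing_le_thin_shell :
    ∃ C : ℝ, 0 < C ∧
      ∀ (n : ℕ) (p : EuclideanSpace ℝ (Fin n) → ℝ),
        1 ≤ n → IsDensity p → IsLogConcave p → IsIsotropic p →
        p 0 ^ ((1 : ℝ) / n) ≤ C * sigmaSup n := by
  refine ⟨256 * rexp ((momentConst + 4) / 2), by positivity, fun n p hn hp hlc hi => ?_⟩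
  obtain ⟨q, hq, hqlc, hqi, hqm, hqo, hq0, hqp⟩ := hi.exists_regularization hp hlc
  rw [← hqp]
  set C := 256 * rexp ((momentConst + 4) / 2) with hC
  have hC0 : 0 < C := by positivity
  have key : ∀ ε > 0, q 0 ^ ((1 : ℝ) / n) ≤ C * sigmaSup n + ε := fun ε hε => by
    have hσ := sigmaSup_nonneg n
    have h1 := density_zero_le_of_sigmaSup_le hn hq hqm hqlc hqi hqo hq0
      (σ := sigmaSup n + ε / C) (by positivity) (by linarith [div_pos hε hC0])
    calc q 0 ^ ((1 : ℝ) / n) ≤ ((C * (sigmaSup n + ε / C)) ^ n) ^ ((1 : ℝ) / n) :=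
          Real.rpow_le_rpow hq0.le h1 (by positivity)
      _ = C * (sigmaSup n + ε / C) := by
          rw [one_div, Real.pow_rpow_inv_natCast (by positivity) (by lia)]
      _ = C * sigmaSup n + ε := by
          field_simp
  exact le_of_forall_pos_le_add key
end
end

section
/- Suppose the slicing conjecture holds with constant L, i.e., every isotropic logconcave probability density q on ℝⁿ (for every n) satisfies q(0)^{1/n} ≤ L. Then there exist constants C, c > 0 depending only on L such that for every isotropic logconcave density p on ℝⁿ and every t with 0 ≤ t ≤ c, the small-ball probability satisfies P_{x∼p}(‖x‖₂ ≤ t·√n) ≤ (C·t)ⁿ. -/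
open MeasureTheory Real Filter

noncomputable section

/-- The first moment of a density with finite second moments is integrable. -/
lemma IsIsotropic.integrable_smul_self {n : ℕ} {p : EuclideanSpace ℝ (Fin n) → ℝ}
    (hd : IsDensity p) (hi : IsIsotropic p) : Integrable fun x => p x • x := by
  have h2 : ∀ i : Fin n, Integrable fun x : EuclideanSpace ℝ (Fin n) => p x * (x i * x i) := by
    intro i
    by_contra hcon
    have := hi.2 i i
    rw [integral_undef hcon] at this
    simp at this
  have hsum : Integrable fun x => p x + ∑ i : Fin n, p x * (x i * x i) :=
    hd.2.1.add (integrable_finsetSum _ fun i _ => h2 i)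
  refine hsum.mono' (hd.2.1.1.smul continuous_id.aestronglyMeasurable) (ae_of_all _ fun x => ?_)
  have hx : ‖x‖ ^ 2 = ∑ i, x i * x i := by
    rw [EuclideanSpace.real_norm_sq_eq]
    exact Finset.sum_congr rfl fun i _ => sq (x i)
  rw [norm_smul, Real.norm_of_nonneg (hd.1 x), ← Finset.mul_sum, ← hx]
  nlinarith [mul_nonneg (hd.1 x) (sq_nonneg (‖x‖ - 1)), mul_nonneg (hd.1 x) (sq_nonneg ‖x‖), hd.1 x]

/-- Linear functionals have mean zero under an isotropic density. -/
lemma IsIsotropic.integral_mul_clm {n : ℕ} {p : EuclideanSpace ℝ (Fin n) → ℝ}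
    (hd : IsDensity p) (hi : IsIsotropic p) (g : StrongDual ℝ (EuclideanSpace ℝ (Fin n))) :
    (Integrable fun x => p x * g x) ∧ ∫ x, p x * g x = 0 := by
  have hintegrable := hi.integrable_smul_self hd
  have h1 := g.integrable_comp hintegrable
  have h2 := g.integral_comp_comm hintegrable
  rw [hi.1, map_zero] at h2
  simp only [map_smul, smul_eq_mul] at h1 h2
  exact ⟨h1, h2⟩

/-- The support of a logconcave function is convex. -/
lemma IsLogConcave.convex_pos {n : ℕ} {p : EuclideanSpace ℝ (Fin n) → ℝ}
    (hlc : IsLogConcave p) : Convex ℝ {x | 0 < p x} := by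
  intro x hx y hy a b ha hb hab
  obtain rfl : b = 1 - a := by linarith
  exact (mul_pos (rpow_pos_of_pos hx _) (rpow_pos_of_pos hy _)).trans_le
    (hlc x y a ha (by linarith))

/-- The logarithm of a logconcave function is concave on its support. -/
lemma IsLogConcave.concaveOn_log {n : ℕ} {p : EuclideanSpace ℝ (Fin n) → ℝ}
    (hlc : IsLogConcave p) : ConcaveOn ℝ {x | 0 < p x} fun x => log (p x) := by
  refine ⟨hlc.convex_pos, fun x hx y hy a b ha hb hab => ?_⟩
  obtain rfl : b = 1 - a := by linarith
  have hx' := rpow_pos_of_pos (show 0 < p x from hx) a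
  have hy' := rpow_pos_of_pos (show 0 < p y from hy) (1 - a)
  have h := log_le_log (mul_pos hx' hy') (hlc x y a ha (by linarith))
  rwa [log_mul hx'.ne' hy'.ne', log_rpow hx, log_rpow hy] at h

/-- A convex set has the same points as its interior, almost everywhere. -/
lemma ae_mem_interior_of_mem {n : ℕ} {s : Set (EuclideanSpace ℝ (Fin n))} (hs : Convex ℝ s) :
    ∀ᵐ x, x ∈ s → x ∈ interior s := by
  have h : ∀ᵐ x, x ∉ frontier s := measure_eq_zero_iff_ae_notMem.1 (hs.addHaar_frontier volume)
  filter_upwards [h] with x hx hxs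
  by_contra hcon
  exact hx ⟨subset_closure hxs, hcon⟩

/-- The barycenter of a logconcave density lies in the interior of its support. -/
lemma zero_mem_interior_pos {n : ℕ} {p : EuclideanSpace ℝ (Fin n) → ℝ}
    (hd : IsDensity p) (hlc : IsLogConcave p) (hi : IsIsotropic p) :
    (0 : EuclideanSpace ℝ (Fin n)) ∈ interior {x | 0 < p x} := by
  by_contra hcon
  obtain ⟨f, hf⟩ := geometric_hahn_banach_open_point hlc.convex_pos.interior isOpen_interior hcon
  rw [map_zero] at hf
  obtain ⟨hintegrable, hzero⟩ := hi.integral_mul_clm hd f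
  have hle : ∀ᵐ x, 0 ≤ -(p x * f x) ∧ (p x * f x = 0 → p x = 0) := by
    filter_upwards [ae_mem_interior_of_mem hlc.convex_pos] with x hx
    rcases (hd.1 x).eq_or_lt with h0 | h0
    · simp [← h0]
    · have := mul_pos_of_neg_of_neg (hf x (hx h0)) (neg_neg_of_pos h0)
      exact ⟨by linarith, fun h => by linarith⟩
  have hneg : ∫ x, -(p x * f x) = 0 := by rw [integral_neg, hzero, neg_zero]
  rw [integral_eq_zero_iff_of_nonneg_ae (hle.mono fun x hx => hx.1) hintegrable.neg] at hneg
  have hp0 : ∀ᵐ x, p x = 0 := by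
    filter_upwards [hneg, hle] with x h1 h2
    exact h2.2 (neg_eq_zero.1 h1)
  have := hd.2.2
  rw [integral_eq_zero_of_ae hp0] at this
  exact zero_ne_one this

/-- A logconcave function is dominated, almost everywhere, by an exponential touching it at a
given interior point of its support. -/
lemma IsLogConcave.exists_le_mul_exp {n : ℕ} {p : EuclideanSpace ℝ (Fin n) → ℝ}
    (h0 : ∀ x, 0 ≤ p x) (hlc : IsLogConcave p)
    (hz : (0 : EuclideanSpace ℝ (Fin n)) ∈ interior {x | 0 < p x}) :
    ∃ g : StrongDual ℝ (EuclideanSpace ℝ (Fin n)), ∀ᵐ x, p x ≤ p 0 * exp (g x) := by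
  set S := {x | 0 < p x}
  have hconc : ConcaveOn ℝ (interior S) fun x => log (p x) :=
    hlc.concaveOn_log.subset interior_subset hlc.convex_pos.interior
  have hcont := hconc.continuousOn isOpen_interior
  have hp0 : 0 < p 0 := interior_subset (s := {x | 0 < p x}) hz
  let H : Set (EuclideanSpace ℝ (Fin n) × ℝ) := {q | q.1 ∈ interior S ∧ q.2 < log (p q.1)}
  have hHconv : Convex ℝ H := hconc.convex_strict_hypograph
  have hHopen : IsOpen H := by
    have hopen : IsOpen (Prod.fst ⁻¹' interior S : Set (EuclideanSpace ℝ (Fin n) × ℝ)) :=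
      isOpen_interior.preimage continuous_fst
    have hc : ContinuousOn (fun q : EuclideanSpace ℝ (Fin n) × ℝ => log (p q.1) - q.2)
        (Prod.fst ⁻¹' interior S) :=
      (hcont.comp continuous_fst.continuousOn fun q hq => hq).sub continuous_snd.continuousOn
    convert hc.isOpen_inter_preimage hopen (isOpen_Ioi (a := (0 : ℝ))) using 1
    ext q
    simp [H]
  obtain ⟨F, hF⟩ := geometric_hahn_banach_open_point (x := ((0 : EuclideanSpace ℝ (Fin n)),
    log (p 0))) hHconv hHopen fun h => lt_irrefl _ h.2
  set g := F.comp (ContinuousLinearMap.inl ℝ (EuclideanSpace ℝ (Fin n)) ℝ)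
  set a := F (0, 1)
  have hsplit : ∀ x s, F (x, s) = g x + s * a := by
    intro x s
    have : (x, s) = (x, (0 : ℝ)) + s • ((0 : EuclideanSpace ℝ (Fin n)), (1 : ℝ)) := by simp
    rw [this, map_add, map_smul]
    simp [g, a]
  have ha : 0 < a := by
    have := hF (0, log (p 0) - 1) ⟨hz, by simp⟩
    rw [hsplit, hsplit] at this
    linarith
  refine ⟨-(a⁻¹ • g), ?_⟩
  filter_upwards [ae_mem_interior_of_mem hlc.convex_pos] with x hx
  rcases (h0 x).eq_or_lt with hpx | hpx
  · rw [← hpx]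
    positivity
  have hxi := hx hpx
  have hlog : log (p x) ≤ log (p 0) + -(a⁻¹ * g x) := by
    refine le_of_forall_lt fun s hs => ?_
    have := hF (x, s) ⟨hxi, hs⟩
    rw [hsplit, hsplit, map_zero, zero_add] at this
    have h3 : a⁻¹ * (g x + s * a) < a⁻¹ * (log (p 0) * a) :=
      mul_lt_mul_of_pos_left this (inv_pos.2 ha)
    have h4 : a⁻¹ * (g x + s * a) = a⁻¹ * g x + s := by field_simp
    have h5 : a⁻¹ * (log (p 0) * a) = log (p 0) := by field_simp
    linarith
  calc p x = exp (log (p x)) := (exp_log hpx).symm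
    _ ≤ exp (log (p 0) + -(a⁻¹ * g x)) := exp_le_exp.2 hlog
    _ = p 0 * exp ((-(a⁻¹ • g)) x) := by rw [exp_add, exp_log hp0]; simp

/-- An isotropic logconcave density is at most `4 ^ n` times its value at the barycenter. -/
lemma le_four_pow_mul_apply_zero {n : ℕ} {p : EuclideanSpace ℝ (Fin n) → ℝ}
    (hd : IsDensity p) (hlc : IsLogConcave p) (hi : IsIsotropic p)
    (y : EuclideanSpace ℝ (Fin n)) : p y ≤ 4 ^ n * p 0 := by
  have hz := zero_mem_interior_pos hd hlc hi
  have hp0 : 0 < p 0 := interior_subset (s := {x | 0 < p x}) hz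
  rcases (hd.1 y).eq_or_lt with hy | hy
  · rw [← hy]
    positivity
  obtain ⟨g, hg⟩ := hlc.exists_le_mul_exp hd.1 hz
  obtain ⟨hgint, hgzero⟩ := hi.integral_mul_clm hd g
  have hhalf : Integrable fun x => p ((2 : ℝ)⁻¹ • (x + y)) :=
    (hd.2.1.comp_smul (by norm_num : (2 : ℝ)⁻¹ ≠ 0)).comp_add_right y
  have hhalf_int : ∫ x, p ((2 : ℝ)⁻¹ • (x + y)) = 2 ^ n := by
    rw [integral_add_right_eq_self fun x => p ((2 : ℝ)⁻¹ • x),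
      Measure.integral_comp_inv_smul_of_nonneg volume p zero_le_two, hd.2.2]
    simp
  have hmid : ∀ x, √(p y) * √(p x) ≤ p ((2 : ℝ)⁻¹ • (x + y)) := by
    intro x
    have := hlc x y (1 / 2) (by norm_num) (by norm_num)
    rw [show (1 : ℝ) - 1 / 2 = 1 / 2 by norm_num, ← sqrt_eq_rpow, ← sqrt_eq_rpow, ← smul_add,
      one_div] at this
    linarith
  have hsqrt : Integrable fun x => √(p y) * √(p x) :=
    hhalf.mono' ((continuous_sqrt.comp_aestronglyMeasurable hd.2.1.1).const_mul _)
      (ae_of_all _ fun x => by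
        rw [Real.norm_of_nonneg (by positivity)]
        exact hmid x)
  have hlow : ∀ᵐ x, √(p y) * (√(p 0))⁻¹ * (p x - p x * g x / 2) ≤ √(p y) * √(p x) := by
    filter_upwards [hg] with x hx
    rw [mul_assoc]
    refine mul_le_mul_of_nonneg_left ?_ (sqrt_nonneg _)
    rw [inv_mul_le_iff₀ (sqrt_pos.2 hp0)]
    have h1 : √(p x) ≤ √(p 0) * exp (g x / 2) := by
      rw [exp_half, ← sqrt_mul hp0.le]
      exact sqrt_le_sqrt hx
    have h2 : exp (g x / 2) * (1 - g x / 2) ≤ 1 := by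
      have := mul_le_mul_of_nonneg_left (add_one_le_exp (-(g x / 2))) (exp_pos (g x / 2)).le
      rw [← exp_add, add_neg_cancel, exp_zero] at this
      linarith
    rcases le_total 0 (1 - g x / 2) with h3 | h3
    · calc p x - p x * g x / 2 = √(p x) * (√(p x) * (1 - g x / 2)) := by
            rw [← mul_assoc, mul_self_sqrt (hd.1 x)]; ring
        _ ≤ √(p x) * (√(p 0) * exp (g x / 2) * (1 - g x / 2)) := by gcongr
        _ = √(p x) * √(p 0) * (exp (g x / 2) * (1 - g x / 2)) := by ring
        _ ≤ √(p x) * √(p 0) * 1 := by gcongr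
        _ = √(p 0) * √(p x) := by ring
    · have h4 := mul_nonpos_of_nonneg_of_nonpos (hd.1 x) h3
      have h5 : 0 ≤ √(p 0) * √(p x) := by positivity
      linarith
  have hI : ∫ x, √(p y) * (√(p 0))⁻¹ * (p x - p x * g x / 2) = √(p y) * (√(p 0))⁻¹ := by
    rw [integral_const_mul, integral_sub hd.2.1 (hgint.div_const 2), integral_div, hgzero, hd.2.2]
    simp
  have hfin : √(p y) * (√(p 0))⁻¹ ≤ 2 ^ n := by
    rw [← hI, ← hhalf_int]
    exact (integral_mono_ae ((hd.2.1.sub (hgint.div_const 2)).const_mul _) hsqrt hlow).trans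
      (integral_mono hsqrt hhalf hmid)
  rw [mul_inv_le_iff₀ (sqrt_pos.2 hp0)] at hfin
  calc p y = √(p y) ^ 2 := (sq_sqrt hy.le).symm
    _ ≤ (2 ^ n * √(p 0)) ^ 2 := by gcongr
    _ = 4 ^ n * p 0 := by
      rw [mul_pow, sq_sqrt hp0.le, ← pow_mul, mul_comm n 2, pow_mul]
      norm_num

/-- The Euclidean ball of radius `√n` in `ℝⁿ` has volume at most exponential in `n`. -/
lemma volume_real_closedBall_sqrt_le (n : ℕ) :
    volume.real (Metric.closedBall (0 : EuclideanSpace ℝ (Fin n)) √n) ≤ (exp 1 * π) ^ n := by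
  set B := Metric.closedBall (0 : EuclideanSpace ℝ (Fin n)) √n
  have hgauss := GaussianFourier.integral_rexp_neg_mul_sq_norm
    (V := EuclideanSpace ℝ (Fin n)) one_pos
  have hpos : 0 < ∫ v : EuclideanSpace ℝ (Fin n), exp (-1 * ‖v‖ ^ 2) := by
    rw [hgauss]
    positivity
  have hintegrable : Integrable fun v : EuclideanSpace ℝ (Fin n) => exp (-1 * ‖v‖ ^ 2) := by
    by_contra h
    rw [integral_undef h] at hpos
    exact lt_irrefl _ hpos
  have hB : volume B ≠ ⊤ := measure_closedBall_lt_top.ne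
  have h1 : exp (-n) * volume.real B ≤ ∫ v in B, exp (-1 * ‖v‖ ^ 2) := by
    refine setIntegral_ge_of_const_le_real Metric.isClosed_closedBall.measurableSet hB
      (fun v hv => ?_) hintegrable.integrableOn
    have h2 : ‖v‖ ^ 2 ≤ n := by
      have := pow_le_pow_left₀ (norm_nonneg v) (mem_closedBall_zero_iff.1 hv) 2
      rwa [sq_sqrt n.cast_nonneg] at this
    exact exp_le_exp.2 (by linarith)
  have h2 : ∫ v in B, exp (-1 * ‖v‖ ^ 2) ≤ π ^ n := by
    refine (setIntegral_le_integral hintegrable (ae_of_all _ fun v => (exp_pos _).le)).trans ?_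
    rw [hgauss, div_one, finrank_euclideanSpace_fin, ← rpow_natCast]
    exact rpow_le_rpow_of_exponent_le (by linarith [pi_gt_three])
      (by linarith [n.cast_nonneg (α := ℝ)])
  have h3 := mul_le_mul_of_nonneg_left (h1.trans h2) (exp_pos (n : ℝ)).le
  rw [← mul_assoc, ← exp_add, add_neg_cancel, exp_zero, one_mul] at h3
  rwa [mul_pow, ← exp_nat_mul, mul_one]

/-- Paouris, small-ball probability: if the slicing conjecture holds with
constant `L`, i.e. every isotropic logconcave density `q` on `ℝⁿ` (for every `n ≥ 1`)
satisfies `q(0)^{1/n} ≤ L`, then there are constants `C, c > 0` (depending only on `L`)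
such that every isotropic logconcave density `p` on `ℝⁿ` satisfies
`P(‖x‖ ≤ t √n) ≤ (C t)ⁿ` for all `0 ≤ t ≤ c`. -/
theorem slicing_implies_small_ball (L : ℝ)
    (hslice : ∀ (n : ℕ) (q : EuclideanSpace ℝ (Fin n) → ℝ), 1 ≤ n →
      IsDensity q → IsLogConcave q → IsIsotropic q → q 0 ^ ((1 : ℝ) / n) ≤ L) :
    ∃ C c : ℝ, 0 < C ∧ 0 < c ∧
      ∀ (n : ℕ) (p : EuclideanSpace ℝ (Fin n) → ℝ), 1 ≤ n →
        IsDensity p → IsLogConcave p → IsIsotropic p →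
        ∀ t : ℝ, 0 ≤ t → t ≤ c →
          (∫ x in {x : EuclideanSpace ℝ (Fin n) | ‖x‖ ≤ t * Real.sqrt n}, p x) ≤
            (C * t) ^ n := by
  refine ⟨4 * (|L| + 1) * (exp 1 * π), 1, by positivity, one_pos, ?_⟩
  intro n p hn hd hlc hi t ht _
  have hn0 : (n : ℝ) ≠ 0 := by exact_mod_cast (by omega : n ≠ 0)
  have hp0 : p 0 ≤ (|L| + 1) ^ n := by
    have h := hslice n p hn hd hlc hi
    calc p 0 = (p 0 ^ ((1 : ℝ) / n)) ^ n := by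
          rw [← rpow_natCast, ← rpow_mul (hd.1 0), one_div, inv_mul_cancel₀ hn0, rpow_one]
      _ ≤ (|L| + 1) ^ n := by
          gcongr
          · exact rpow_nonneg (hd.1 0) _
          · linarith [le_abs_self L]
  have hset : {x : EuclideanSpace ℝ (Fin n) | ‖x‖ ≤ t * √n} = Metric.closedBall 0 (t * √n) := by
    ext x
    simp
  have hvol : volume.real (Metric.closedBall (0 : EuclideanSpace ℝ (Fin n)) (t * √n)) =
      t ^ n * volume.real (Metric.closedBall (0 : EuclideanSpace ℝ (Fin n)) √n) := by
    rw [measureReal_def, Measure.addHaar_closedBall_mul volume _ ht (sqrt_nonneg _),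
      ENNReal.toReal_mul, ENNReal.toReal_ofReal (by positivity), finrank_euclideanSpace_fin,
      measureReal_def]
  rw [hset]
  calc ∫ x in Metric.closedBall 0 (t * √n), p x
      ≤ ∫ _ in Metric.closedBall (0 : EuclideanSpace ℝ (Fin n)) (t * √n), 4 ^ n * p 0 :=
        setIntegral_mono hd.2.1.integrableOn
          (integrableOn_const measure_closedBall_lt_top.ne)
          (le_four_pow_mul_apply_zero hd hlc hi)
    _ = t ^ n * volume.real (Metric.closedBall (0 : EuclideanSpace ℝ (Fin n)) √n)
          * (4 ^ n * p 0) := by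
        rw [setIntegral_const, hvol, smul_eq_mul]
    _ ≤ t ^ n * (exp 1 * π) ^ n * (4 ^ n * (|L| + 1) ^ n) := by
        gcongr
        · exact mul_nonneg (by positivity) (hd.1 0)
        · exact volume_real_closedBall_sqrt_le n
    _ = (4 * (|L| + 1) * (exp 1 * π) * t) ^ n := by
        simp only [mul_pow]
        ring
end
end
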